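/- arXiv:1508.05546 — 2 statements merged into one kernel-verified Lean document; each statement's English description precedes it below -/
import Mathlib

section
/- Let K be an algebraically closed field of characteristic zero, n ≥ 2, d ≥ 3, and let s = s'+s'', t = t'+t'', u = u'+u'', v = v'+v'' be splittings into nonnegative integers. Suppose that for each of the three index tuples (n−1, d, s'', t''+u', u'', s'+v''), (n−1, d−1, s', t'+v'', s''+u', v'), and (n−1, d−2, 0, v', s', 0), one has a(·) ≤ C(·) (subabundance, i.e. a(m,e,σ,τ,υ,ν) ≤ C(m+e,e)) and the statement 𝒜(·) holds. Then a(n,d,s,t,u,v) ≤ C(n+d,d) and 𝒜(n,d,s,t,u,v) holds. In particular, if t = u = v = 0, then there exist d-tuples f_1,…,f_s of linear forms in n+1 variables with dim_K Σ_{i=1}^s Σ_{j=1}^d π_j(f_i)·R_1 = s(dn+1) ≤ C(n+d,d). -/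
set_option maxHeartbeats 1000000

open MvPolynomial

/-- `a(m,e,σ,τ,υ,ν) = σ(em+1) + τ + υ(e+1) + ν(m+1)`. -/
def littleA (m e σ τ υ ν : ℕ) : ℕ :=
  σ * (e * m + 1) + τ + υ * (e + 1) + ν * (m + 1)

/-- The statement `𝒜(m,e,σ,τ,υ,ν)`: there exist `e`-tuples `f_1,…,f_σ`, `(e+1)`-tuples
`f'_1,…,f'_τ` and `f''_1,…,f''_υ`, and `e`-tuples `f'''_1,…,f'''_ν` of linear forms in
`K[x_0,…,x_m]` such that the subspace
`A = Σ_i Σ_j π_j(f_i)·R_1 + Σ_i K·π_1(f'_i) + Σ_i Σ_j K·π_j(f''_i) + Σ_i π_1(f'''_i)·R_1`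
of the degree-`e` part of `K[x_0,…,x_m]` has dimension exactly `a(m,e,σ,τ,υ,ν)`. -/
def stmtA (K : Type*) [Field K] (m e σ τ υ ν : ℕ) : Prop :=
  ∃ (f : Fin σ → Fin e → MvPolynomial (Fin (m + 1)) K)
    (f' : Fin τ → Fin (e + 1) → MvPolynomial (Fin (m + 1)) K)
    (f'' : Fin υ → Fin (e + 1) → MvPolynomial (Fin (m + 1)) K)
    (f''' : Fin ν → Fin e → MvPolynomial (Fin (m + 1)) K),
    (∀ i j, (f i j).IsHomogeneous 1) ∧ (∀ i j, (f' i j).IsHomogeneous 1) ∧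
    (∀ i j, (f'' i j).IsHomogeneous 1) ∧ (∀ i j, (f''' i j).IsHomogeneous 1) ∧
    Module.finrank K ↥(
      (⨆ i : Fin σ, ⨆ j : Fin e,
        Submodule.map (LinearMap.mulLeft K (∏ k ∈ Finset.univ.erase j, f i k))
          (homogeneousSubmodule (Fin (m + 1)) K 1)) ⊔
      (⨆ i : Fin τ,
        Submodule.span K {∏ k ∈ Finset.univ.filter (fun x : Fin (e + 1) => (x : ℕ) ≠ 0),
          f' i k}) ⊔
      (⨆ i : Fin υ, ⨆ j : Fin (e + 1),
        Submodule.span K {∏ k ∈ Finset.univ.erase j, f'' i k}) ⊔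
      (⨆ i : Fin ν,
        Submodule.map
          (LinearMap.mulLeft K (∏ k ∈ Finset.univ.filter (fun x : Fin e => (x : ℕ) ≠ 0),
            f''' i k))
          (homogeneousSubmodule (Fin (m + 1)) K 1)))
      = littleA m e σ τ υ ν

open Polynomial in
/-- Linear independence of a family of polynomial curves is an open condition on the line. -/
theorem finite_not_linearIndependent_eval {K A : Type*} [Field K] [CommRing A] [Algebra K A]
    {r : ℕ} (P : Fin r → A[X]) (h : LinearIndependent K fun i => (P i).eval 0) :
    {c : K | ¬ LinearIndependent K fun i => (P i).eval (algebraMap K A c)}.Finite := by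
  obtain ⟨φ, hφ⟩ := LinearMap.exists_leftInverse_of_injective
    (Fintype.linearCombination K fun i => (P i).eval 0)
    (LinearMap.ker_eq_bot.2 h.fintypeLinearCombination_injective)
  have hφ_single (i : Fin r) : φ ((P i).eval 0) = Pi.single i 1 := by
    have := LinearMap.congr_fun hφ (Pi.single i 1)
    simpa using this
  let Q : Matrix (Fin r) (Fin r) K[X] := Matrix.of fun i j =>
    ∑ k ∈ Finset.range ((P i).natDegree + 1), Polynomial.C (φ ((P i).coeff k) j) * Polynomial.X ^ k
  have hQ (c : K) (i j : Fin r) :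
      (Q i j).eval c = φ ((P i).eval (algebraMap K A c)) j := by
    simp only [Q, Matrix.of_apply, eval_finsetSum, Polynomial.eval_mul,
      Polynomial.eval_C, Polynomial.eval_pow, Polynomial.eval_X]
    rw [eval_eq_sum_range, map_sum, Finset.sum_apply]
    refine Finset.sum_congr rfl fun k _ => ?_
    rw [mul_comm _ (algebraMap K A c ^ k), ← map_pow, ← Algebra.smul_def, map_smul]
    simp [mul_comm]
  have hdet (c : K) : Q.det.eval c =
      (Matrix.of fun i => φ ((P i).eval (algebraMap K A c))).det := by
    rw [← coe_evalRingHom, RingHom.map_det]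
    congr 1
    ext i j
    simp [hQ]
  have hne : Q.det ≠ 0 := by
    intro h0
    have h1 := hdet 0
    have : (Matrix.of fun i => φ ((P i).eval (algebraMap K A 0))) = 1 := by
      ext i j
      simp [hφ_single, Matrix.one_apply, Pi.single_apply, eq_comm]
    rw [this, h0] at h1
    simp at h1
  refine (Q.det.rootSet_finite K).subset fun c hc => ?_
  rw [mem_rootSet_of_ne hne, Polynomial.coe_aeval_eq_eval]
  by_contra hcon
  rw [hdet] at hcon
  exact hc (LinearIndependent.of_comp φ (Matrix.linearIndependent_rows_of_det_ne_zero hcon))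

/-- A one-parameter family of subspaces all of whose members at `0` extend to polynomial
sections. -/
def PolynomialSections {K A : Type*} [Field K] [CommRing A] [Algebra K A]
    (W : K → Submodule K A) : Prop :=
  ∀ w ∈ W 0, ∃ P : Polynomial A, P.eval 0 = w ∧ ∀ c, P.eval (algebraMap K A c) ∈ W c

/-- The subspace `W` contains `r` linearly independent vectors. -/
def ContainsIndependent {K A : Type*} [Field K] [CommRing A] [Algebra K A]
    (W : Submodule K A) (r : ℕ) : Prop :=
  ∃ w : Fin r → A, LinearIndependent K w ∧ ∀ i, w i ∈ W

namespace PolynomialSections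

variable {K A : Type*} [Field K] [CommRing A] [Algebra K A]

theorem finite_not_containsIndependent {W : K → Submodule K A} (hW : PolynomialSections W)
    {r : ℕ} (h : ContainsIndependent (W 0) r) :
    {c : K | ¬ ContainsIndependent (W c) r}.Finite := by
  obtain ⟨w, hw, hmem⟩ := h
  choose P hP0 hP using fun i => hW (w i) (hmem i)
  refine (finite_not_linearIndependent_eval (K := K) P (by simpa only [hP0] using hw)).subset
    fun c hc hli => hc ⟨_, hli, fun i => hP i c⟩

theorem sup {W W' : K → Submodule K A} (hW : PolynomialSections W)
    (hW' : PolynomialSections W') : PolynomialSections fun c => W c ⊔ W' c := by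
  intro w hw
  obtain ⟨a, ha, b, hb, rfl⟩ := Submodule.mem_sup.1 hw
  obtain ⟨P, rfl, hP⟩ := hW a ha
  obtain ⟨Q, rfl, hQ⟩ := hW' b hb
  exact ⟨P + Q, by simp, fun c => by
    simpa using Submodule.add_mem_sup (hP c) (hQ c)⟩

theorem iSup {ι : Type*} {W : ι → K → Submodule K A} (hW : ∀ i, PolynomialSections (W i)) :
    PolynomialSections fun c => ⨆ i, W i c := by
  intro w hw
  refine Submodule.iSup_induction (fun i => W i 0) (motive := fun w => ∃ P : Polynomial A,
    P.eval 0 = w ∧ ∀ c, P.eval (algebraMap K A c) ∈ ⨆ i, W i c) hw ?_ ⟨0, by simp⟩ ?_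
  · intro i w hw
    obtain ⟨P, h0, hP⟩ := hW i w hw
    exact ⟨P, h0, fun c => Submodule.mem_iSup_of_mem i (hP c)⟩
  · rintro _ _ ⟨P, rfl, hP⟩ ⟨Q, rfl, hQ⟩
    exact ⟨P + Q, by simp, fun c => by simpa using add_mem (hP c) (hQ c)⟩

theorem map_mulLeft (P : Polynomial A) (H : Submodule K A) :
    PolynomialSections fun c : K =>
      H.map (LinearMap.mulLeft K (P.eval (algebraMap K A c))) := by
  rintro _ ⟨a, ha, rfl⟩
  exact ⟨P * Polynomial.C a, by simp, fun c => ⟨a, ha, by simp⟩⟩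

theorem span_singleton (P : Polynomial A) :
    PolynomialSections fun c : K => Submodule.span K {P.eval (algebraMap K A c)} := by
  intro w hw
  obtain ⟨a, rfl⟩ := Submodule.mem_span_singleton.1 hw
  refine ⟨P * Polynomial.C (algebraMap K A a), ?_, fun c => ?_⟩
  · simp [Algebra.smul_def, mul_comm]
  · exact Submodule.mem_span_singleton.2 ⟨a, by simp [Algebra.smul_def, mul_comm]⟩

end PolynomialSections

/-- The sum of the four kinds of subspaces spanned by products of the entries of tuples: the
products omitting one entry times `H`, the full products, the products omitting one entry, and
the full products times `H`. -/
def splitSpan {K A : Type*} [Field K] [CommRing A] [Algebra K A] (H : Submodule K A)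
    {σ τ υ ν a b c e : ℕ} (f : Fin σ → Fin a → A) (f' : Fin τ → Fin b → A)
    (f'' : Fin υ → Fin c → A) (f''' : Fin ν → Fin e → A) : Submodule K A :=
  (⨆ i, ⨆ j, H.map (LinearMap.mulLeft K (∏ k ∈ Finset.univ.erase j, f i k))) ⊔
  (⨆ i, Submodule.span K {∏ k, f' i k}) ⊔
  (⨆ i, ⨆ j, Submodule.span K {∏ k ∈ Finset.univ.erase j, f'' i k}) ⊔
  (⨆ i, H.map (LinearMap.mulLeft K (∏ k, f''' i k)))

section SplitSpan

variable {K A : Type*} [Field K] [CommRing A] [Algebra K A] {H : Submodule K A}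
  {σ τ υ ν a b c e : ℕ} {f : Fin σ → Fin a → A} {f' : Fin τ → Fin b → A}
  {f'' : Fin υ → Fin c → A} {f''' : Fin ν → Fin e → A}

theorem splitSpan_le_iff {T : Submodule K A} : splitSpan H f f' f'' f''' ≤ T ↔
    (∀ i j, ∀ l ∈ H, (∏ k ∈ Finset.univ.erase j, f i k) * l ∈ T) ∧
    (∀ i, ∏ k, f' i k ∈ T) ∧
    (∀ i j, ∏ k ∈ Finset.univ.erase j, f'' i k ∈ T) ∧
    (∀ i, ∀ l ∈ H, (∏ k, f''' i k) * l ∈ T) := by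
  simp only [splitSpan, sup_le_iff, iSup_le_iff, Submodule.span_singleton_le_iff_mem,
    Submodule.map_le_iff_le_comap, and_assoc]
  rfl

end SplitSpan

theorem finite_not_containsIndependent_splitSpan {K A I : Type*} [Field K] [CommRing A]
    [Algebra K A] (H : Submodule K A) {σ τ υ ν a b c e r : ℕ} (φ : Fin σ → Fin a → I)
    (φ' : Fin τ → Fin b → I) (φ'' : Fin υ → Fin c → I) (φ''' : Fin ν → Fin e → I)
    (p q : I → A)
    (h : ContainsIndependent (splitSpan H (fun i k => p (φ i k)) (fun i k => p (φ' i k))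
      (fun i k => p (φ'' i k)) (fun i k => p (φ''' i k))) r) :
    {t : K | ¬ ContainsIndependent (splitSpan H
      (fun i k => (p + t • (q - p)) (φ i k)) (fun i k => (p + t • (q - p)) (φ' i k))
      (fun i k => (p + t • (q - p)) (φ'' i k)) (fun i k => (p + t • (q - p)) (φ''' i k)))
      r}.Finite := by
  let L : I → Polynomial A := fun i =>
    Polynomial.C (p i) + Polynomial.X * Polynomial.C (q i - p i)
  have hL (t : K) (i : I) : (p + t • (q - p)) i = (L i).eval (algebraMap K A t) := by
    simp [L, Algebra.smul_def]
  have key : PolynomialSections fun t : K => splitSpan H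
      (fun i k => (p + t • (q - p)) (φ i k)) (fun i k => (p + t • (q - p)) (φ' i k))
      (fun i k => (p + t • (q - p)) (φ'' i k)) (fun i k => (p + t • (q - p)) (φ''' i k)) := by
    simp only [splitSpan, hL, ← Polynomial.eval_prod]
    exact (((PolynomialSections.iSup fun i => .iSup fun j => .map_mulLeft _ H).sup
      (.iSup fun i => .span_singleton _)).sup
      (.iSup fun i => .iSup fun j => .span_singleton _)).sup (.iSup fun i => .map_mulLeft _ H)
  refine key.finite_not_containsIndependent ?_
  simpa using h

section Bounds

variable {K V : Type*} [Field K] [AddCommGroup V] [Module K V]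

theorem rank_iSup_fin_le {r N : ℕ} {W : Fin r → Submodule K V}
    (h : ∀ i, Module.rank K (W i) ≤ N) : Module.rank K ↥(⨆ i, W i) ≤ (r * N : ℕ) := by
  induction r with
  | zero => simp
  | succ r ih =>
    have : (⨆ i, W i) = W 0 ⊔ ⨆ i : Fin r, W i.succ := by
      refine le_antisymm (iSup_le fun i => ?_) (sup_le (le_iSup W 0)
        (iSup_le fun i => le_iSup W i.succ))
      refine Fin.cases le_sup_left (fun i => ?_) i
      exact le_sup_of_le_right (le_iSup (fun i : Fin r => W i.succ) i)
    rw [this]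
    refine (Submodule.rank_add_le_rank_add_rank _ _).trans ?_
    refine (add_le_add (h 0) (ih fun i => h i.succ)).trans (le_of_eq ?_)
    push_cast
    ring

theorem rank_span_singleton_le_one (x : V) : Module.rank K ↥(Submodule.span K {x}) ≤ (1 : ℕ) := by
  simpa using rank_span_le (R := K) {x}

end Bounds

theorem rank_homogeneousSubmodule_one_le (K : Type*) [Field K] (m : ℕ) :
    Module.rank K ↥(homogeneousSubmodule (Fin (m + 1)) K 1) ≤ (m + 1 : ℕ) := by
  rw [homogeneousSubmodule_one_eq_span_X]
  refine (rank_span_le _).trans ?_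
  simpa using Cardinal.mk_range_le_lift (f := (X : Fin (m + 1) → MvPolynomial (Fin (m + 1)) K))

/-- The affine tangent space to the variety of split forms has dimension at most `e m + 1`. -/
theorem rank_iSup_map_mulLeft_prod_erase_le {K : Type*} [Field K] {m e : ℕ}
    (f : Fin (e + 1) → MvPolynomial (Fin (m + 1)) K) (hf : ∀ j, (f j).IsHomogeneous 1) :
    Module.rank K ↥(⨆ j, (homogeneousSubmodule (Fin (m + 1)) K 1).map
      (LinearMap.mulLeft K (∏ k ∈ Finset.univ.erase j, f k))) ≤ ((e + 1) * m + 1 : ℕ) := by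
  set H := homogeneousSubmodule (Fin (m + 1)) K 1 with hH
  have hHfin : Module.Finite K H := Module.Finite.iff_fg.2 (homogeneousSubmodule_fg _ _ _)
  by_cases h0 : ∃ j, f j = 0
  · obtain ⟨j, hj⟩ := h0
    have hle : (⨆ j, H.map (LinearMap.mulLeft K (∏ k ∈ Finset.univ.erase j, f k))) ≤
        H.map (LinearMap.mulLeft K (∏ k ∈ Finset.univ.erase j, f k)) := by
      refine iSup_le fun i => ?_
      by_cases hij : i = j
      · rw [hij]
      · rw [Finset.prod_eq_zero (Finset.mem_erase.2 ⟨Ne.symm hij, Finset.mem_univ j⟩) hj]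
        simp
    refine (Submodule.rank_mono hle).trans <| (rank_map_le _ _).trans <|
      (rank_homogeneousSubmodule_one_le K m).trans ?_
    norm_cast
    nlinarith
  · push Not at h0
    have hW (j : Fin (e + 1)) : ∃ W : Submodule K (MvPolynomial (Fin (m + 1)) K),
        Module.rank K W ≤ m ∧ H ≤ W ⊔ Submodule.span K {f j} := by
      have hx : (⟨f j, hf j⟩ : H) ≠ 0 := fun h => h0 j (congrArg Subtype.val h)
      obtain ⟨C, hC⟩ := Submodule.exists_isCompl (Submodule.span K {(⟨f j, hf j⟩ : H)})
      refine ⟨C.map H.subtype, ?_, ?_⟩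
      · refine (rank_map_le _ _).trans ?_
        have h1 := Submodule.finrank_add_eq_of_isCompl hC
        rw [finrank_span_singleton hx] at h1
        have h2 : Module.finrank K H ≤ m + 1 :=
          Module.finrank_le_of_rank_le (rank_homogeneousSubmodule_one_le K m)
        rw [← Module.finrank_eq_rank]
        norm_cast
        omega
      · intro x hx'
        have : (⟨x, hx'⟩ : H) ∈ C ⊔ Submodule.span K {(⟨f j, hf j⟩ : H)} := by
          rw [sup_comm, hC.sup_eq_top]; trivial
        have := Submodule.mem_map_of_mem (f := H.subtype) this
        rw [Submodule.map_sup, Submodule.map_span] at this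
        simpa using this
    choose W hWr hWle using hW
    have hle : (⨆ j, H.map (LinearMap.mulLeft K (∏ k ∈ Finset.univ.erase j, f k))) ≤
        (⨆ j, (W j).map (LinearMap.mulLeft K (∏ k ∈ Finset.univ.erase j, f k))) ⊔
          Submodule.span K {∏ k, f k} := by
      refine iSup_le fun j => (Submodule.map_mono (hWle j)).trans ?_
      rw [Submodule.map_sup, Submodule.map_span, Set.image_singleton, LinearMap.mulLeft_apply,
        Finset.prod_erase_mul _ _ (Finset.mem_univ j)]
      exact sup_le_sup_right (le_iSup (fun j => (W j).map
        (LinearMap.mulLeft K (∏ k ∈ Finset.univ.erase j, f k))) j) _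
    refine (Submodule.rank_mono hle).trans <| (Submodule.rank_add_le_rank_add_rank _ _).trans ?_
    refine (add_le_add (rank_iSup_fin_le fun j => (rank_map_le _ _).trans (hWr j))
      (rank_span_singleton_le_one _)).trans ?_
    push_cast
    exact le_rfl

theorem rank_splitSpan_le {K : Type*} [Field K] {m e σ τ υ ν : ℕ}
    (f : Fin σ → Fin (e + 1) → MvPolynomial (Fin (m + 1)) K)
    (f' : Fin τ → Fin (e + 1) → MvPolynomial (Fin (m + 1)) K)
    (f'' : Fin υ → Fin (e + 2) → MvPolynomial (Fin (m + 1)) K)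
    (f''' : Fin ν → Fin e → MvPolynomial (Fin (m + 1)) K)
    (hf : ∀ i j, (f i j).IsHomogeneous 1) :
    Module.rank K ↥(splitSpan (homogeneousSubmodule (Fin (m + 1)) K 1) f f' f'' f''') ≤
      littleA m (e + 1) σ τ υ ν := by
  have h₁ := rank_iSup_fin_le fun i => rank_iSup_map_mulLeft_prod_erase_le (f i) (hf i)
  have h₂ := rank_iSup_fin_le fun i => rank_span_singleton_le_one (K := K) (∏ k, f' i k)
  have h₃ := rank_iSup_fin_le fun i => rank_iSup_fin_le fun j =>
    rank_span_singleton_le_one (K := K) (∏ k ∈ Finset.univ.erase j, f'' i k)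
  have h₄ := rank_iSup_fin_le fun i => (rank_map_le (LinearMap.mulLeft K (∏ k, f''' i k)) _).trans
    (rank_homogeneousSubmodule_one_le K m)
  refine (Submodule.rank_add_le_rank_add_rank _ _).trans <| (add_le_add
    ((Submodule.rank_add_le_rank_add_rank _ _).trans <| add_le_add
      ((Submodule.rank_add_le_rank_add_rank _ _).trans <| add_le_add h₁ h₂) h₃) h₄).trans
    (le_of_eq ?_)
  norm_cast
  simp [littleA]

theorem ContainsIndependent.of_le_finrank {K A : Type*} [Field K] [CommRing A] [Algebra K A]
    {W : Submodule K A} {r : ℕ} (h : r ≤ Module.finrank K W) : ContainsIndependent W r := by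
  obtain ⟨w, hw⟩ := exists_linearIndependent_of_le_finrank h
  exact ⟨fun i => w i, hw.map' _ (Submodule.ker_subtype _), fun i => (w i).2⟩

theorem prod_filter_val_ne_zero {M : Type*} [CommMonoid M] {e : ℕ} (g : Fin (e + 1) → M) :
    ∏ k ∈ Finset.univ.filter (fun x : Fin (e + 1) => (x : ℕ) ≠ 0), g k = ∏ k : Fin e, g k.succ := by
  rw [Finset.prod_filter, Fin.prod_univ_succ]
  simp

theorem prod_erase_zero_cons {M : Type*} [CommMonoid M] {e : ℕ} (x : M) (g : Fin e → M) :
    ∏ k ∈ Finset.univ.erase 0, (Fin.cons x g : Fin (e + 1) → M) k = ∏ k, g k := by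
  rw [← Finset.filter_ne', Finset.prod_filter, Fin.prod_univ_succ]
  simp

theorem prod_erase_succ_cons {M : Type*} [CommMonoid M] {e : ℕ} (x : M) (g : Fin e → M)
    (j : Fin e) : ∏ k ∈ Finset.univ.erase j.succ, (Fin.cons x g : Fin (e + 1) → M) k =
      x * ∏ k ∈ Finset.univ.erase j, g k := by
  rw [← Finset.filter_ne', Finset.prod_filter, Fin.prod_univ_succ, ← Finset.filter_ne',
    Finset.prod_filter]
  simp [(Fin.succ_ne_zero j).symm]

theorem sup_iSup_filter_eq_splitSpan {K A : Type*} [Field K] [CommRing A] [Algebra K A]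
    (H : Submodule K A) {e σ τ υ ν : ℕ} (f : Fin σ → Fin (e + 1) → A)
    (f' : Fin τ → Fin (e + 1 + 1) → A) (f'' : Fin υ → Fin (e + 1 + 1) → A)
    (f''' : Fin ν → Fin (e + 1) → A) :
    (⨆ i, ⨆ j, H.map (LinearMap.mulLeft K (∏ k ∈ Finset.univ.erase j, f i k))) ⊔
      (⨆ i, Submodule.span K
        {∏ k ∈ Finset.univ.filter (fun x : Fin (e + 1 + 1) => (x : ℕ) ≠ 0), f' i k}) ⊔
      (⨆ i, ⨆ j, Submodule.span K {∏ k ∈ Finset.univ.erase j, f'' i k}) ⊔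
      (⨆ i, H.map (LinearMap.mulLeft K
        (∏ k ∈ Finset.univ.filter (fun x : Fin (e + 1) => (x : ℕ) ≠ 0), f''' i k))) =
      splitSpan H f (fun i k => f' i k.succ) f'' (fun i k => f''' i k.succ) := by
  simp only [splitSpan, prod_filter_val_ne_zero]

theorem stmtA.exists_containsIndependent {K : Type*} [Field K] {m e σ τ υ ν : ℕ}
    (h : stmtA K m (e + 1) σ τ υ ν) :
    ∃ (f : Fin σ → Fin (e + 1) → MvPolynomial (Fin (m + 1)) K)
      (f' : Fin τ → Fin (e + 1) → MvPolynomial (Fin (m + 1)) K)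
      (f'' : Fin υ → Fin (e + 2) → MvPolynomial (Fin (m + 1)) K)
      (f''' : Fin ν → Fin e → MvPolynomial (Fin (m + 1)) K),
      (∀ i j, (f i j).IsHomogeneous 1) ∧ (∀ i j, (f' i j).IsHomogeneous 1) ∧
      (∀ i j, (f'' i j).IsHomogeneous 1) ∧ (∀ i j, (f''' i j).IsHomogeneous 1) ∧
      ContainsIndependent (splitSpan (homogeneousSubmodule (Fin (m + 1)) K 1) f f' f'' f''')
        (littleA m (e + 1) σ τ υ ν) := by
  obtain ⟨f, f', f'', f''', hf, hf', hf'', hf''', hr⟩ := h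
  refine ⟨f, fun i k => f' i k.succ, f'', fun i k => f''' i k.succ, hf, fun i k => hf' i _, hf'',
    fun i k => hf''' i _, ?_⟩
  rw [sup_iSup_filter_eq_splitSpan] at hr
  exact .of_le_finrank hr.ge

theorem stmtA_of_containsIndependent {K : Type*} [Field K] {m e σ τ υ ν : ℕ}
    {f : Fin σ → Fin (e + 1) → MvPolynomial (Fin (m + 1)) K}
    {f' : Fin τ → Fin (e + 1) → MvPolynomial (Fin (m + 1)) K}
    {f'' : Fin υ → Fin (e + 2) → MvPolynomial (Fin (m + 1)) K}
    {f''' : Fin ν → Fin e → MvPolynomial (Fin (m + 1)) K}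
    (hf : ∀ i j, (f i j).IsHomogeneous 1) (hf' : ∀ i j, (f' i j).IsHomogeneous 1)
    (hf'' : ∀ i j, (f'' i j).IsHomogeneous 1) (hf''' : ∀ i j, (f''' i j).IsHomogeneous 1)
    (h : ContainsIndependent (splitSpan (homogeneousSubmodule (Fin (m + 1)) K 1) f f' f'' f''')
      (littleA m (e + 1) σ τ υ ν)) : stmtA K m (e + 1) σ τ υ ν := by
  refine ⟨f, fun i => Fin.cons 0 (f' i), f'', fun i => Fin.cons 0 (f''' i), hf,
    fun i j => ?_, hf'', fun i j => ?_, ?_⟩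
  · cases j using Fin.cases with
    | zero => exact isHomogeneous_zero _ _ _
    | succ j => exact hf' i j
  · cases j using Fin.cases with
    | zero => exact isHomogeneous_zero _ _ _
    | succ j => exact hf''' i j
  · rw [sup_iSup_filter_eq_splitSpan]
    change Module.finrank K
      ↥(splitSpan (homogeneousSubmodule (Fin (m + 1)) K 1) f f' f'' f''') = _
    have hle := rank_splitSpan_le f f' f'' f''' hf
    have hfin : Module.Finite K
        ↥(splitSpan (homogeneousSubmodule (Fin (m + 1)) K 1) f f' f'' f''') :=
      Module.rank_lt_aleph0_iff.1 (hle.trans_lt Cardinal.natCast_lt_aleph0)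
    refine le_antisymm (Module.finrank_le_of_rank_le hle) ?_
    obtain ⟨w, hw, hmem⟩ := h
    have hli : LinearIndependent K fun i =>
        (⟨w i, hmem i⟩ : ↥(splitSpan (homogeneousSubmodule (Fin (m + 1)) K 1) f f' f'' f''')) :=
      LinearIndependent.of_comp (Submodule.subtype _) hw
    simpa using hli.fintype_card_le_finrank

theorem finSuccEquiv_rename_succ {K : Type*} [Field K] {n : ℕ} (p : MvPolynomial (Fin n) K) :
    finSuccEquiv K n (rename Fin.succ p) = Polynomial.C p := by
  induction p using MvPolynomial.induction_on with
  | C a => simp [finSuccEquiv_apply]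
  | add p q hp hq => simp [hp, hq]
  | mul_X p i hp => simp [hp, finSuccEquiv_X_succ]

/-- Independent forms in the last variables, multiplied by `1`, `x₀` and `x₀²`, remain jointly
independent. -/
theorem containsIndependent_of_X_zero_pow_mul {K : Type*} [Field K] {n r₁ r₂ r₃ : ℕ}
    {A : Submodule K (MvPolynomial (Fin (n + 1)) K)}
    {A₁ A₂ A₃ : Submodule K (MvPolynomial (Fin n) K)}
    (h₁ : ContainsIndependent A₁ r₁) (h₂ : ContainsIndependent A₂ r₂)
    (h₃ : ContainsIndependent A₃ r₃)
    (hA₁ : ∀ w ∈ A₁, rename Fin.succ w ∈ A) (hA₂ : ∀ w ∈ A₂, X 0 * rename Fin.succ w ∈ A)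
    (hA₃ : ∀ w ∈ A₃, X 0 ^ 2 * rename Fin.succ w ∈ A) :
    ContainsIndependent A (r₁ + r₂ + r₃) := by
  obtain ⟨w₁, hw₁, hm₁⟩ := h₁
  obtain ⟨w₂, hw₂, hm₂⟩ := h₂
  obtain ⟨w₃, hw₃, hm₃⟩ := h₃
  let v : (Fin r₁ ⊕ Fin r₂) ⊕ Fin r₃ → MvPolynomial (Fin (n + 1)) K :=
    Sum.elim (Sum.elim (fun i => rename Fin.succ (w₁ i)) (fun i => X 0 * rename Fin.succ (w₂ i)))
      (fun i => X 0 ^ 2 * rename Fin.succ (w₃ i))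
  have hv : LinearIndependent K v := by
    let c (k : ℕ) : MvPolynomial (Fin (n + 1)) K →ₗ[K] MvPolynomial (Fin n) K :=
      ((Polynomial.lcoeff (MvPolynomial (Fin n) K) k).restrictScalars K).comp
        (finSuccEquiv K n).toLinearMap
    refine LinearIndependent.of_comp (((c 0).prod (c 1)).prod (c 2)) ?_
    convert linearIndependent_inl_union_inr' (linearIndependent_inl_union_inr' hw₁ hw₂) hw₃
      using 1
    ext1 i
    rcases i with (i | i) | i <;>
      simp [v, c, finSuccEquiv_rename_succ, finSuccEquiv_X_zero, Polynomial.coeff_C,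
        Polynomial.coeff_X, Polynomial.coeff_X_pow]
  let E : Fin (r₁ + r₂ + r₃) ≃ (Fin r₁ ⊕ Fin r₂) ⊕ Fin r₃ :=
    (finSumFinEquiv.symm).trans (Equiv.sumCongr finSumFinEquiv.symm (Equiv.refl _))
  refine ⟨v ∘ E, hv.comp _ E.injective, fun i => ?_⟩
  change v (E i) ∈ A
  rcases E i with (i | i) | i
  · exact hA₁ _ (hm₁ i)
  · exact hA₂ _ (hm₂ i)
  · exact hA₃ _ (hm₃ i)

/-- The positions of the linear forms occurring in a splitting with parameters
`s' s'' t' t'' u' u'' v' v''` in degree `d + 3`. -/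
inductive SplitSlot (d s' s'' t' t'' u' u'' v' v'' : ℕ) : Type
  | s₁ (i : Fin s') (k : Fin (d + 2))
  | s₂ (i : Fin s'') (k : Fin (d + 3))
  | t₁ (i : Fin t') (k : Fin (d + 2))
  | t₂ (i : Fin t'') (k : Fin (d + 3))
  | u₁ (i : Fin u') (k : Fin (d + 3))
  | u₂ (i : Fin u'') (k : Fin (d + 4))
  | v₁ (i : Fin v') (k : Fin (d + 1))
  | v₂ (i : Fin v'') (k : Fin (d + 2))

/-- Along a line through a point satisfying `C`, all but finitely many points satisfy `C`. -/
def LineGeneric (K : Type*) {V : Type*} [Field K] [AddCommGroup V] [Module K V]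
    (C : V → Prop) : Prop :=
  ∀ p q, C p → {t : K | ¬ C (p + t • (q - p))}.Finite

theorem LineGeneric.exists_and {K V : Type*} [Field K] [Infinite K] [AddCommGroup V] [Module K V]
    {C C' : V → Prop} (hC : LineGeneric K C) (hC' : LineGeneric K C') {H : Submodule K V}
    (h : ∃ p ∈ H, C p) (h' : ∃ p ∈ H, C' p) : ∃ p ∈ H, C p ∧ C' p := by
  obtain ⟨p, hpH, hp⟩ := h
  obtain ⟨q, hqH, hq⟩ := h'
  have hfin : {t : K | ¬ C' (q + (1 - t) • (p - q))}.Finite :=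
    (hC' q p hq).preimage fun x _ y _ hxy => by simpa using hxy
  obtain ⟨t, ht⟩ := ((hC p q hp).union hfin).exists_notMem
  simp only [Set.mem_union, Set.mem_ofPred_eq, not_or, not_not] at ht
  refine ⟨p + t • (q - p), H.add_mem hpH (H.smul_mem _ (H.sub_mem hqH hpH)), ht.1, ?_⟩
  convert ht.2 using 1
  module

theorem LineGeneric.and {K V : Type*} [Field K] [AddCommGroup V] [Module K V]
    {C C' : V → Prop} (hC : LineGeneric K C) (hC' : LineGeneric K C') :
    LineGeneric K fun p => C p ∧ C' p := by
  intro p q hp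
  refine ((hC p q hp.1).union (hC' p q hp.2)).subset fun t ht => ?_
  by_contra h
  simp only [Set.mem_union, Set.mem_ofPred_eq, not_or, not_not] at h
  exact ht h

section SplitSlot

variable {K : Type*} [Field K] {m d s' s'' t' t'' u' u'' v' v'' : ℕ}

open SplitSlot

/-- The coefficient of `1` in the specialized subspace. -/
noncomputable def lowSpan
    (p : SplitSlot d s' s'' t' t'' u' u'' v' v'' → MvPolynomial (Fin (m + 1)) K) :
    Submodule K (MvPolynomial (Fin (m + 1)) K) :=
  splitSpan (homogeneousSubmodule (Fin (m + 1)) K 1) (fun i k => p (s₂ i k))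
    (fun i k => p (Fin.addCases (fun i => t₂ i) (fun i => u₁ i) i k)) (fun i k => p (u₂ i k))
    (fun i k => p (Fin.addCases (fun i => s₁ i) (fun i => v₂ i) i k))

/-- The coefficient of `x₀` in the specialized subspace. -/
noncomputable def midSpan
    (p : SplitSlot d s' s'' t' t'' u' u'' v' v'' → MvPolynomial (Fin (m + 1)) K) :
    Submodule K (MvPolynomial (Fin (m + 1)) K) :=
  splitSpan (homogeneousSubmodule (Fin (m + 1)) K 1) (fun i k => p (s₁ i k))
    (fun i k => p (Fin.addCases (fun i => t₁ i) (fun i => v₂ i) i k))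
    (fun i k => p (Fin.addCases (fun i => s₂ i) (fun i => u₁ i) i k)) (fun i k => p (v₁ i k))

/-- The coefficient of `x₀²` in the specialized subspace. -/
noncomputable def highSpan
    (p : SplitSlot d s' s'' t' t'' u' u'' v' v'' → MvPolynomial (Fin (m + 1)) K) :
    Submodule K (MvPolynomial (Fin (m + 1)) K) :=
  splitSpan (homogeneousSubmodule (Fin (m + 1)) K 1)
    (fun (i : Fin 0) (_ : Fin (d + 1)) => p i.elim0) (fun i k => p (v₁ i k))
    (fun i k => p (s₁ i k)) (fun (i : Fin 0) (_ : Fin d) => p i.elim0)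

theorem lineGeneric_lowSpan (r : ℕ) : LineGeneric K
    fun p : SplitSlot d s' s'' t' t'' u' u'' v' v'' → MvPolynomial (Fin (m + 1)) K =>
      ContainsIndependent (lowSpan p) r :=
  fun p q h => finite_not_containsIndependent_splitSpan _ _ _ _ _ p q h

theorem lineGeneric_midSpan (r : ℕ) : LineGeneric K
    fun p : SplitSlot d s' s'' t' t'' u' u'' v' v'' → MvPolynomial (Fin (m + 1)) K =>
      ContainsIndependent (midSpan p) r :=
  fun p q h => finite_not_containsIndependent_splitSpan _ _ _ _ _ p q h

theorem lineGeneric_highSpan (r : ℕ) : LineGeneric K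
    fun p : SplitSlot d s' s'' t' t'' u' u'' v' v'' → MvPolynomial (Fin (m + 1)) K =>
      ContainsIndependent (highSpan p) r :=
  fun p q h => finite_not_containsIndependent_splitSpan _ _ _ _ _ p q h

/-- The assignments of linear forms to the positions of a splitting. -/
noncomputable abbrev linearSlots (K : Type*) [Field K] (m d s' s'' t' t'' u' u'' v' v'' : ℕ) :
    Submodule K (SplitSlot d s' s'' t' t'' u' u'' v' v'' → MvPolynomial (Fin (m + 1)) K) :=
  Submodule.pi Set.univ fun _ => homogeneousSubmodule (Fin (m + 1)) K 1

theorem exists_containsIndependent_lowSpan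
    (h : stmtA K m (d + 3) s'' (t'' + u') u'' (s' + v'')) :
    ∃ p ∈ linearSlots K m d s' s'' t' t'' u' u'' v' v'',
      ContainsIndependent (lowSpan p) (littleA m (d + 3) s'' (t'' + u') u'' (s' + v'')) := by
  obtain ⟨f, f', f'', f''', hf, hf', hf'', hf''', h⟩ := h.exists_containsIndependent
  let p : SplitSlot d s' s'' t' t'' u' u'' v' v'' → MvPolynomial (Fin (m + 1)) K
    | s₂ i k => f i k
    | t₂ i k => f' (Fin.castAdd _ i) k
    | u₁ i k => f' (Fin.natAdd _ i) k
    | u₂ i k => f'' i k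
    | s₁ i k => f''' (Fin.castAdd _ i) k
    | v₂ i k => f''' (Fin.natAdd _ i) k
    | _ => 0
  refine ⟨p, ?_, ?_⟩
  · rintro (_ | _ | _ | _ | _ | _ | _ | _) -
    all_goals simp only [p, hf, hf', hf'', hf''', SetLike.mem_coe, mem_homogeneousSubmodule,
      isHomogeneous_zero]
  · have e' : f' = fun i k => p (Fin.addCases (fun i => t₂ i) (fun i => u₁ i) i k) := by
      ext1 i
      refine Fin.addCases (fun i => ?_) (fun i => ?_) i <;> simp [p]
    have e''' : f''' = fun i k => p (Fin.addCases (fun i => s₁ i) (fun i => v₂ i) i k) := by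
      ext1 i
      refine Fin.addCases (fun i => ?_) (fun i => ?_) i <;> simp [p]
    rw [e', e'''] at h
    exact h

theorem exists_containsIndependent_midSpan
    (h : stmtA K m (d + 2) s' (t' + v'') (s'' + u') v') :
    ∃ p ∈ linearSlots K m d s' s'' t' t'' u' u'' v' v'',
      ContainsIndependent (midSpan p) (littleA m (d + 2) s' (t' + v'') (s'' + u') v') := by
  obtain ⟨f, f', f'', f''', hf, hf', hf'', hf''', h⟩ := h.exists_containsIndependent
  let p : SplitSlot d s' s'' t' t'' u' u'' v' v'' → MvPolynomial (Fin (m + 1)) K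
    | s₁ i k => f i k
    | t₁ i k => f' (Fin.castAdd _ i) k
    | v₂ i k => f' (Fin.natAdd _ i) k
    | s₂ i k => f'' (Fin.castAdd _ i) k
    | u₁ i k => f'' (Fin.natAdd _ i) k
    | v₁ i k => f''' i k
    | _ => 0
  refine ⟨p, ?_, ?_⟩
  · rintro (_ | _ | _ | _ | _ | _ | _ | _) -
    all_goals simp only [p, hf, hf', hf'', hf''', SetLike.mem_coe, mem_homogeneousSubmodule,
      isHomogeneous_zero]
  · have e' : f' = fun i k => p (Fin.addCases (fun i => t₁ i) (fun i => v₂ i) i k) := by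
      ext1 i
      refine Fin.addCases (fun i => ?_) (fun i => ?_) i <;> simp [p]
    have e'' : f'' = fun i k => p (Fin.addCases (fun i => s₂ i) (fun i => u₁ i) i k) := by
      ext1 i
      refine Fin.addCases (fun i => ?_) (fun i => ?_) i <;> simp [p]
    rw [e', e''] at h
    exact h

theorem exists_containsIndependent_highSpan (h : stmtA K m (d + 1) 0 v' s' 0) :
    ∃ p ∈ linearSlots K m d s' s'' t' t'' u' u'' v' v'',
      ContainsIndependent (highSpan p) (littleA m (d + 1) 0 v' s' 0) := by
  obtain ⟨f, f', f'', f''', hf, hf', hf'', hf''', h⟩ := h.exists_containsIndependent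
  let p : SplitSlot d s' s'' t' t'' u' u'' v' v'' → MvPolynomial (Fin (m + 1)) K
    | v₁ i k => f' i k
    | s₁ i k => f'' i k
    | _ => 0
  refine ⟨p, ?_, ?_⟩
  · rintro (_ | _ | _ | _ | _ | _ | _ | _) -
    all_goals simp only [p, hf', hf'', SetLike.mem_coe, mem_homogeneousSubmodule, isHomogeneous_zero]
  · rw [Subsingleton.elim f fun i _ => p i.elim0, Subsingleton.elim f''' fun i _ => p i.elim0] at h
    exact h

/-- Prepend `x₀` to a tuple of forms in the remaining variables. -/
noncomputable def consXZero {e : ℕ} (g : Fin e → MvPolynomial (Fin (m + 1)) K) :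
    Fin (e + 1) → MvPolynomial (Fin (m + 2)) K :=
  Fin.cons (X 0) fun k => rename Fin.succ (g k)

theorem isHomogeneous_consXZero {e : ℕ} {g : Fin e → MvPolynomial (Fin (m + 1)) K}
    (hg : ∀ k, (g k).IsHomogeneous 1) (k : Fin (e + 1)) : (consXZero g k).IsHomogeneous 1 := by
  cases k using Fin.cases with
  | zero => exact isHomogeneous_X _ _
  | succ k => exact (hg k).rename_isHomogeneous

theorem prod_consXZero {e : ℕ} (g : Fin e → MvPolynomial (Fin (m + 1)) K) :
    ∏ k, consXZero g k = X 0 * rename Fin.succ (∏ k, g k) := by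
  simp [consXZero, Fin.prod_univ_succ]

theorem prod_erase_zero_consXZero {e : ℕ} (g : Fin e → MvPolynomial (Fin (m + 1)) K) :
    ∏ k ∈ Finset.univ.erase 0, consXZero g k = rename Fin.succ (∏ k, g k) := by
  rw [consXZero, prod_erase_zero_cons, map_prod]

theorem prod_erase_succ_consXZero {e : ℕ} (g : Fin e → MvPolynomial (Fin (m + 1)) K)
    (j : Fin e) : ∏ k ∈ Finset.univ.erase j.succ, consXZero g k =
      X 0 * rename Fin.succ (∏ k ∈ Finset.univ.erase j, g k) := by
  rw [consXZero, prod_erase_succ_cons, map_prod]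

theorem splitting_stmtA {p : SplitSlot d s' s'' t' t'' u' u'' v' v'' →
      MvPolynomial (Fin (m + 1)) K} (hp : ∀ i, (p i).IsHomogeneous 1)
    (h₁ : ContainsIndependent (lowSpan p) (littleA m (d + 3) s'' (t'' + u') u'' (s' + v'')))
    (h₂ : ContainsIndependent (midSpan p) (littleA m (d + 2) s' (t' + v'') (s'' + u') v'))
    (h₃ : ContainsIndependent (highSpan p) (littleA m (d + 1) 0 v' s' 0)) :
    stmtA K (m + 1) (d + 3) (s' + s'') (t' + t'') (u' + u'') (v' + v'') := by
  let ρ : MvPolynomial (Fin (m + 1)) K →ₐ[K] MvPolynomial (Fin (m + 2)) K := rename Fin.succ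
  let f : Fin (s' + s'') → Fin (d + 3) → MvPolynomial (Fin (m + 2)) K :=
    Fin.addCases (fun i => consXZero fun k => p (s₁ i k)) (fun i k => ρ (p (s₂ i k)))
  let f' : Fin (t' + t'') → Fin (d + 3) → MvPolynomial (Fin (m + 2)) K :=
    Fin.addCases (fun i => consXZero fun k => p (t₁ i k)) (fun i k => ρ (p (t₂ i k)))
  let f'' : Fin (u' + u'') → Fin (d + 4) → MvPolynomial (Fin (m + 2)) K :=
    Fin.addCases (fun i => consXZero fun k => p (u₁ i k)) (fun i k => ρ (p (u₂ i k)))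
  let f''' : Fin (v' + v'') → Fin (d + 2) → MvPolynomial (Fin (m + 2)) K :=
    Fin.addCases (fun i => consXZero fun k => p (v₁ i k)) (fun i k => ρ (p (v₂ i k)))
  have hρ (i) : (ρ (p i)).IsHomogeneous 1 := (hp i).rename_isHomogeneous
  have hf (i j) : (f i j).IsHomogeneous 1 := by
    refine Fin.addCases (fun i => ?_) (fun i => ?_) i <;>
      simp [f, hρ, isHomogeneous_consXZero, hp]
  have hf' (i j) : (f' i j).IsHomogeneous 1 := by
    refine Fin.addCases (fun i => ?_) (fun i => ?_) i <;>
      simp [f', hρ, isHomogeneous_consXZero, hp]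
  have hf'' (i j) : (f'' i j).IsHomogeneous 1 := by
    refine Fin.addCases (fun i => ?_) (fun i => ?_) i <;>
      simp [f'', hρ, isHomogeneous_consXZero, hp]
  have hf''' (i j) : (f''' i j).IsHomogeneous 1 := by
    refine Fin.addCases (fun i => ?_) (fun i => ?_) i <;>
      simp [f''', hρ, isHomogeneous_consXZero, hp]
  set A := splitSpan (homogeneousSubmodule (Fin (m + 2)) K 1) f f' f'' f''' with hA
  obtain ⟨hA₁, hA₂, hA₃, hA₄⟩ := splitSpan_le_iff.1 hA.ge
  have hX : (X 0 : MvPolynomial (Fin (m + 2)) K) ∈ homogeneousSubmodule (Fin (m + 2)) K 1 :=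
    isHomogeneous_X _ _
  have hl {l : MvPolynomial (Fin (m + 1)) K} (h : l ∈ homogeneousSubmodule (Fin (m + 1)) K 1) :
      ρ l ∈ homogeneousSubmodule (Fin (m + 2)) K 1 := IsHomogeneous.rename_isHomogeneous h
  have key := containsIndependent_of_X_zero_pow_mul (A := A) h₁ h₂ h₃ ?_ ?_ ?_
  · refine stmtA_of_containsIndependent hf hf' hf'' hf''' ?_
    convert key using 1
    simp only [littleA]
    ring
  · change lowSpan p ≤ A.comap ρ.toLinearMap
    refine splitSpan_le_iff.2 ⟨fun i j l h => ?_, fun i => ?_, fun i j => ?_, fun i l h => ?_⟩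
    · simpa [f] using hA₁ (Fin.natAdd _ i) j _ (hl h)
    · refine Fin.addCases (fun i => ?_) (fun i => ?_) i
      · simpa [f'] using hA₂ (Fin.natAdd _ i)
      · simpa [f'', prod_erase_zero_consXZero] using hA₃ (Fin.castAdd _ i) 0
    · simpa [f''] using hA₃ (Fin.natAdd _ i) j
    · refine Fin.addCases (fun i => ?_) (fun i => ?_) i
      · simpa [f, prod_erase_zero_consXZero] using hA₁ (Fin.castAdd _ i) 0 _ (hl h)
      · simpa [f'''] using hA₄ (Fin.natAdd _ i) _ (hl h)
  · change midSpan p ≤ A.comap ((LinearMap.mulLeft K (X 0)).comp ρ.toLinearMap)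
    refine splitSpan_le_iff.2 ⟨fun i j l h => ?_, fun i => ?_, fun i j => ?_, fun i l h => ?_⟩
    · simpa [f, prod_erase_succ_consXZero, mul_assoc] using
        hA₁ (Fin.castAdd _ i) j.succ _ (hl h)
    · refine Fin.addCases (fun i => ?_) (fun i => ?_) i
      · simpa [f', prod_consXZero] using hA₂ (Fin.castAdd _ i)
      · simpa [f''', mul_comm] using hA₄ (Fin.natAdd _ i) _ hX
    · refine Fin.addCases (fun i => ?_) (fun i => ?_) i
      · simpa [f, mul_comm] using hA₁ (Fin.natAdd _ i) j _ hX
      · simpa [f'', prod_erase_succ_consXZero] using hA₃ (Fin.castAdd _ i) j.succ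
    · simpa [f''', prod_consXZero, mul_assoc] using hA₄ (Fin.castAdd _ i) _ (hl h)
  · change highSpan p ≤ A.comap ((LinearMap.mulLeft K (X 0 ^ 2)).comp ρ.toLinearMap)
    refine splitSpan_le_iff.2 ⟨fun i => i.elim0, fun i => ?_, fun i j => ?_, fun i => i.elim0⟩
    · simpa [f''', prod_consXZero, pow_two, mul_assoc, mul_comm, mul_left_comm] using
        hA₄ (Fin.castAdd _ i) _ hX
    · simpa [f, prod_erase_succ_consXZero, pow_two, mul_assoc, mul_comm, mul_left_comm] using
        hA₁ (Fin.castAdd _ i) j.succ _ hX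

end SplitSlot

/-- Theorem 3.2 of the paper, the splitting induction theorem. -/
theorem stmt5 (K : Type*) [Field K] [IsAlgClosed K] [CharZero K]
    (n d s t u v s' s'' t' t'' u' u'' v' v'' : ℕ)
    (hn : 2 ≤ n) (hd : 3 ≤ d)
    (hs : s = s' + s'') (ht : t = t' + t'') (hu : u = u' + u'') (hv : v = v' + v'')
    (h1sub : littleA (n - 1) d s'' (t'' + u') u'' (s' + v'') ≤ (n - 1 + d).choose d)
    (h1 : stmtA K (n - 1) d s'' (t'' + u') u'' (s' + v''))
    (h2sub : littleA (n - 1) (d - 1) s' (t' + v'') (s'' + u') v'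
      ≤ (n - 1 + (d - 1)).choose (d - 1))
    (h2 : stmtA K (n - 1) (d - 1) s' (t' + v'') (s'' + u') v')
    (h3sub : littleA (n - 1) (d - 2) 0 v' s' 0 ≤ (n - 1 + (d - 2)).choose (d - 2))
    (h3 : stmtA K (n - 1) (d - 2) 0 v' s' 0) :
    littleA n d s t u v ≤ (n + d).choose d ∧ stmtA K n d s t u v ∧
    (t = 0 → u = 0 → v = 0 →
      ∃ f : Fin s → Fin d → MvPolynomial (Fin (n + 1)) K,
        (∀ i j, (f i j).IsHomogeneous 1) ∧
        Module.finrank K ↥(⨆ i : Fin s, ⨆ j : Fin d,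
            Submodule.map (LinearMap.mulLeft K (∏ k ∈ Finset.univ.erase j, f i k))
              (homogeneousSubmodule (Fin (n + 1)) K 1))
          = s * (d * n + 1) ∧ s * (d * n + 1) ≤ (n + d).choose d) := by
  obtain ⟨m, rfl⟩ : ∃ m, n = m + 1 := ⟨n - 1, by omega⟩
  obtain ⟨d, rfl⟩ : ∃ e, d = e + 3 := ⟨d - 3, by omega⟩
  subst hs ht hu hv
  rw [show m + 1 - 1 = m from rfl] at *
  rw [show d + 3 - 1 = d + 2 from rfl] at h2sub h2
  rw [show d + 3 - 2 = d + 1 from rfl] at h3sub h3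
  have hsub : littleA (m + 1) (d + 3) (s' + s'') (t' + t'') (u' + u'') (v' + v'') ≤
      (m + 1 + (d + 3)).choose (d + 3) := by
    have e₁ : (m + 1 + (d + 3)).choose (d + 3) =
        (m + (d + 3)).choose (d + 2) + (m + (d + 3)).choose (d + 3) := by
      rw [show m + 1 + (d + 3) = m + (d + 3) + 1 by ring, Nat.choose_succ_succ]
    have e₂ : (m + (d + 3)).choose (d + 2) =
        (m + (d + 2)).choose (d + 1) + (m + (d + 2)).choose (d + 2) :=
      Nat.choose_succ_succ _ _
    have e₃ : (m + (d + 2)).choose (d + 1) =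
        (m + (d + 1)).choose d + (m + (d + 1)).choose (d + 1) :=
      Nat.choose_succ_succ _ _
    have e₄ : littleA (m + 1) (d + 3) (s' + s'') (t' + t'') (u' + u'') (v' + v'') =
        littleA m (d + 3) s'' (t'' + u') u'' (s' + v'') +
        littleA m (d + 2) s' (t' + v'') (s'' + u') v' + littleA m (d + 1) 0 v' s' 0 := by
      simp only [littleA]
      ring
    omega
  have hA : stmtA K (m + 1) (d + 3) (s' + s'') (t' + t'') (u' + u'') (v' + v'') := by
    obtain ⟨p, hp, ⟨hp₁, hp₂⟩, hp₃⟩ :=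
      ((lineGeneric_lowSpan _).and (lineGeneric_midSpan _)).exists_and (lineGeneric_highSpan _)
        ((lineGeneric_lowSpan _).exists_and (lineGeneric_midSpan _)
          (exists_containsIndependent_lowSpan (t' := t') (v' := v') h1)
          (exists_containsIndependent_midSpan h2))
        (exists_containsIndependent_highSpan h3)
    exact splitting_stmtA (fun i => hp i trivial) hp₁ hp₂ hp₃
  refine ⟨hsub, hA, fun ht hu hv => ?_⟩
  rw [ht, hu, hv] at hA hsub
  obtain ⟨f, _, _, _, hf, _, _, _, hr⟩ := hA
  refine ⟨f, hf, ?_, by simpa [littleA] using hsub⟩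
  rw [iSup_of_empty (ι := Fin 0), iSup_of_empty (ι := Fin 0), iSup_of_empty (ι := Fin 0),
    sup_bot_eq, sup_bot_eq, sup_bot_eq] at hr
  simpa [littleA] using hr
end

section
/- Let K be an algebraically closed field of characteristic zero and let d ≥ 3, n ≥ 3, s ≥ 1 be integers with s ≤ s_1(d). Then there exist d-tuples f_1,…,f_s of linear forms in K[x_0,…,x_n] with dim_K Σ_{i=1}^s Σ_{j=1}^d π_j(f_i)·R_1 = min{s(dn+1), C(n+d,d)} (i.e., σ_s(Split_d(P^n)) is nondefective whenever s ≤ s_1(d)). -/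
set_option maxHeartbeats 1000000

open MvPolynomial

/-- The function `s_1` from Theorem 1.2 of the paper (Abo's bound). -/
def s1 (d : ℕ) : ℚ :=
  if d % 6 = 0 then (d : ℚ) ^ 2 / 18 + (d : ℚ) / 6 + 1
  else if d % 6 = 1 then (d : ℚ) ^ 2 / 18 + 2 * (d : ℚ) / 9 - 5 / 18
  else if d % 6 = 2 ∨ d % 6 = 5 then (d : ℚ) ^ 2 / 18 + 5 * (d : ℚ) / 18 + 2 / 9
  else if d % 6 = 3 then (d : ℚ) ^ 2 / 18 + (d : ℚ) / 6
  else (d : ℚ) ^ 2 / 18 + 2 * (d : ℚ) / 9 + 2 / 9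

section Rank

variable {K : Type*} [Field K] {A B : Type*} [CommRing A] [Algebra K A] [CommRing B] [Algebra K B]

/-- The subspace `W` contains `N` linearly independent vectors. -/
def RankGE (N : ℕ) (W : Submodule K A) : Prop :=
  ∃ v : Fin N → A, LinearIndependent K v ∧ ∀ k, v k ∈ W

theorem RankGE.mono {N M : ℕ} {W U : Submodule K A} (h : RankGE N W) (hM : M ≤ N) (hU : W ≤ U) :
    RankGE M U := by
  obtain ⟨v, hv, hm⟩ := h
  exact ⟨v ∘ Fin.castLE hM, hv.comp _ (Fin.castLE_injective hM), fun k => hU (hm _)⟩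

theorem RankGE.zero (W : Submodule K A) : RankGE 0 W :=
  ⟨Fin.elim0, linearIndependent_empty_type, fun k => k.elim0⟩

theorem RankGE.of_fintype {ι : Type*} [Fintype ι] {W : Submodule K A} (v : ι → A)
    (hv : LinearIndependent K v) (hm : ∀ k, v k ∈ W) : RankGE (Fintype.card ι) W :=
  ⟨v ∘ (Fintype.equivFin ι).symm, hv.comp _ (Equiv.injective _), fun _ => hm _⟩

theorem RankGE.map_injective {N : ℕ} {W : Submodule K A} (h : RankGE N W) (f : A →ₗ[K] B)
    (hf : Function.Injective f) : RankGE N (W.map f) := by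
  obtain ⟨v, hv, hm⟩ := h
  exact ⟨f ∘ v, hv.map' f (LinearMap.ker_eq_bot.2 hf), fun k => Submodule.mem_map_of_mem (hm k)⟩

theorem RankGE.add_of_restrict {N₁ N₂ : ℕ} (f : A →ₐ[K] B) (x : A) (hx : f x = 0)
    (hreg : ∀ a, x * a = 0 → a = 0) {W U : Submodule K A}
    (h₁ : RankGE N₁ (W.map f.toLinearMap)) (h₂ : RankGE N₂ U) (hU : ∀ u ∈ U, x * u ∈ W) :
    RankGE (N₁ + N₂) W := by
  obtain ⟨v, hv, hm⟩ := h₁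
  obtain ⟨u, hu, hn⟩ := h₂
  choose w hw hwv using hm
  have hfw : f.toLinearMap ∘ w = v := funext hwv
  have hxu : LinearIndependent K (LinearMap.mulLeft K x ∘ u) := by
    refine hu.map' _ (LinearMap.ker_eq_bot'.2 fun a ha => hreg a ha)
  have hdis := Submodule.range_ker_disjoint (f := f.toLinearMap) (v := w) (hfw ▸ hv)
  have hsum := LinearIndependent.sum_type (LinearIndependent.of_comp f.toLinearMap (hfw ▸ hv)) hxu
    (hdis.mono_right (by
      rw [Submodule.span_le]
      rintro _ ⟨i, rfl⟩
      simp [hx]))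
  have := RankGE.of_fintype (W := W) _ hsum (by
    rintro (i | i)
    · exact hw i
    · exact hU _ (hn i))
  simpa using this

/-- Every vector of `W t₀` lies on a polynomial arc whose value at each `t` is in `W t`. -/
def Follows (W : K → Submodule K A) : Prop :=
  ∀ t₀, ∀ v ∈ W t₀, ∃ F : Polynomial A, F.eval (algebraMap K A t₀) = v ∧
    ∀ t, F.eval (algebraMap K A t) ∈ W t

/-- The function `c` is a polynomial arc in `A`. -/
def IsArc (c : K → A) : Prop := ∃ F : Polynomial A, ∀ t, c t = F.eval (algebraMap K A t)

theorem IsArc.const (a : A) : IsArc (fun _ : K => a) := ⟨Polynomial.C a, fun t => by simp⟩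

theorem IsArc.mul {c d : K → A} (hc : IsArc c) (hd : IsArc d) : IsArc (fun t => c t * d t) := by
  obtain ⟨F, hF⟩ := hc
  obtain ⟨G, hG⟩ := hd
  exact ⟨F * G, fun t => by simp [hF, hG]⟩

theorem IsArc.add {c d : K → A} (hc : IsArc c) (hd : IsArc d) : IsArc (fun t => c t + d t) := by
  obtain ⟨F, hF⟩ := hc
  obtain ⟨G, hG⟩ := hd
  exact ⟨F + G, fun t => by simp [hF, hG]⟩

theorem IsArc.param_smul (a : A) : IsArc (fun t : K => t • a) :=
  ⟨Polynomial.C a * Polynomial.X, fun t => by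
    beta_reduce
    rw [Algebra.smul_def, mul_comm, Polynomial.eval_mul, Polynomial.eval_C, Polynomial.eval_X]⟩

theorem IsArc.smul {c : K → A} (r : K) (hc : IsArc c) : IsArc (fun t => r • c t) := by
  simp only [Algebra.smul_def]
  exact (IsArc.const _).mul hc

theorem IsArc.pow {c : K → A} (hc : IsArc c) (k : ℕ) : IsArc (fun t => c t ^ k) := by
  obtain ⟨F, hF⟩ := hc
  exact ⟨F ^ k, fun t => by simp [hF]⟩

theorem IsArc.list_prod {ι : Type*} (L : List ι) {c : ι → K → A} (hc : ∀ i, IsArc (c i)) :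
    IsArc (fun t => (L.map fun i => c i t).prod) := by
  induction L with
  | nil => simpa using IsArc.const 1
  | cons i L ih => simpa using (hc i).mul ih

theorem Follows.const (W : Submodule K A) : Follows (fun _ => W) :=
  fun t₀ v hv => ⟨Polynomial.C v, by simp, fun t => by simpa using hv⟩

theorem Follows.span {c : K → A} (hc : IsArc c) : Follows (fun t => K ∙ c t) := by
  obtain ⟨F, hF⟩ := hc
  intro t₀ v hv
  obtain ⟨r, rfl⟩ := Submodule.mem_span_singleton.1 hv
  refine ⟨Polynomial.C (algebraMap K A r) * F, by simp [hF, Algebra.smul_def], fun t => ?_⟩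
  exact Submodule.mem_span_singleton.2 ⟨r, by simp [hF, Algebra.smul_def]⟩

theorem Follows.sup {W U : K → Submodule K A} (hW : Follows W) (hU : Follows U) :
    Follows (fun t => W t ⊔ U t) := by
  intro t₀ v hv
  obtain ⟨a, ha, b, hb, rfl⟩ := Submodule.mem_sup.1 hv
  obtain ⟨F, hF, hF'⟩ := hW t₀ a ha
  obtain ⟨G, hG, hG'⟩ := hU t₀ b hb
  refine ⟨F + G, by simp [hF, hG], fun t => ?_⟩
  simpa using Submodule.add_mem_sup (hF' t) (hG' t)

theorem Follows.mul {W U : K → Submodule K A} (hW : Follows W) (hU : Follows U) :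
    Follows (fun t => W t * U t) := by
  intro t₀ v hv
  induction hv using Submodule.mul_induction_on' with
  | mem_mul_mem a ha b hb =>
    obtain ⟨F, hF, hF'⟩ := hW t₀ a ha
    obtain ⟨G, hG, hG'⟩ := hU t₀ b hb
    refine ⟨F * G, by simp [hF, hG], fun t => ?_⟩
    simpa using Submodule.mul_mem_mul (hF' t) (hG' t)
  | add x _ y _ hx hy =>
    obtain ⟨F, hF, hF'⟩ := hx
    obtain ⟨G, hG, hG'⟩ := hy
    refine ⟨F + G, by simp [hF, hG], fun t => ?_⟩
    simpa using Submodule.add_mem _ (hF' t) (hG' t)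

theorem Follows.pow {W : K → Submodule K A} (hW : Follows W) (k : ℕ) :
    Follows (fun t => W t ^ k) := by
  induction k with
  | zero => simpa using Follows.const 1
  | succ k ih => simpa [pow_succ] using ih.mul hW

theorem Follows.multiset_sup {ι : Type*} (m : Multiset ι) {W : ι → K → Submodule K A}
    (hW : ∀ i ∈ m, Follows (W i)) : Follows (fun t => (m.map fun i => W i t).sup) := by
  induction m using Multiset.induction with
  | empty => simpa using Follows.const ⊥
  | cons i m ih =>
    simpa using (hW i (by simp)).sup (ih fun j hj => hW j (Multiset.mem_cons_of_mem hj))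

theorem exists_polynomial_dual (φ : A →ₗ[K] K) (F : Polynomial A) :
    ∃ P : Polynomial K, ∀ t, P.eval t = φ (F.eval (algebraMap K A t)) := by
  refine ⟨∑ i ∈ F.support, Polynomial.C (φ (F.coeff i)) * Polynomial.X ^ i, fun t => ?_⟩
  rw [Polynomial.eval_finsetSum, Polynomial.eval_eq_sum (p := F), Polynomial.sum, map_sum]
  refine Finset.sum_congr rfl fun i _ => ?_
  rw [← map_pow, mul_comm (F.coeff i), ← Algebra.smul_def, map_smul, Polynomial.eval_mul,
    Polynomial.eval_pow, Polynomial.eval_C, Polynomial.eval_X, smul_eq_mul, mul_comm]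

theorem Follows.rankGE {W : K → Submodule K A} (hW : Follows W) {N : ℕ} {t₀ : K}
    (h : RankGE N (W t₀)) :
    ∃ Q : Polynomial K, Q ≠ 0 ∧ ∀ t, Q.eval t ≠ 0 → RankGE N (W t) := by
  obtain ⟨v, hv, hm⟩ := h
  choose F hF hF' using fun k => hW t₀ (v k) (hm k)
  obtain ⟨g, hg⟩ := LinearMap.exists_leftInverse_of_injective _
    (LinearMap.ker_eq_bot.2 (linearIndependent_iff_injective_finsuppLinearCombination.1 hv))
  have hgv : ∀ j, g (v j) = Finsupp.single j 1 := fun j => by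
    simpa using LinearMap.congr_fun hg (Finsupp.single j 1)
  choose P hP using fun i j => exists_polynomial_dual ((Finsupp.lapply i).comp g) (F j)
  let M : Matrix (Fin N) (Fin N) (Polynomial K) := Matrix.of fun i j => P i j
  have heval : ∀ t, M.det.eval t = (Matrix.of fun i j => g ((F j).eval (algebraMap K A t)) i).det := by
    intro t
    rw [← Polynomial.coe_evalRingHom, RingHom.map_det]
    congr 1
    ext i j
    simp [M, hP]
  refine ⟨M.det, fun h0 => ?_, fun t ht => ?_⟩
  · have := heval t₀
    rw [h0] at this
    have h1 : (Matrix.of fun i j => g ((F j).eval (algebraMap K A t₀)) i) =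
        (1 : Matrix (Fin N) (Fin N) K) := by
      ext i j
      simp [hF, hgv, Matrix.one_apply, Finsupp.single_apply, eq_comm]
    rw [h1] at this
    simp at this
  · refine ⟨fun k => (F k).eval (algebraMap K A t), ?_, fun k => hF' k t⟩
    rw [heval] at ht
    have hcol := Matrix.linearIndependent_cols_of_det_ne_zero ht
    refine LinearIndependent.of_comp (Finsupp.lcoeFun.comp g) ?_
    exact hcol

theorem exists_eval_ne_zero [Infinite K] {Q : Polynomial K} (hQ : Q ≠ 0) :
    ∃ t, Q.eval t ≠ 0 := by
  by_contra! h
  exact hQ (Polynomial.funext fun t => by simpa using h t)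

end Rank

section ProductDerivatives

variable {K : Type*} [Field K] {A B : Type*} [CommRing A] [Algebra K A] [CommRing B] [Algebra K B]

/-- The span of the products of all but one entry of a list. -/
def Pd : List A → Submodule K A
  | [] => ⊥
  | a :: L => (K ∙ L.prod) ⊔ (K ∙ a) * Pd L

theorem span_singleton_mul_eq (a b : A) : (K ∙ a * b) = (K ∙ a) * (K ∙ b) := by
  rw [Submodule.span_mul_span, Set.singleton_mul_singleton]

theorem Pd_append (L M : List A) :
    Pd (K := K) (L ++ M) = (K ∙ M.prod) * Pd L ⊔ (K ∙ L.prod) * Pd M := by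
  induction L with
  | nil => simp [Pd, ← Submodule.one_eq_span]
  | cons a L ih =>
    simp only [List.cons_append, Pd, ih, List.prod_append, List.prod_cons, Submodule.mul_sup,
      sup_assoc, span_singleton_mul_eq]
    rw [mul_comm (K ∙ L.prod), ← mul_assoc, ← mul_assoc, ← mul_assoc, mul_comm (K ∙ a) (K ∙ M.prod)]

theorem Pd_map (f : A →ₐ[K] B) (L : List A) :
    (Pd (K := K) L).map f.toLinearMap = Pd (L.map f) := by
  induction L with
  | nil => simp [Pd]
  | cons a L ih =>
    simp only [Pd, Submodule.map_sup, Submodule.map_mul, ih, List.map_cons, Submodule.map_span,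
      Set.image_singleton]
    simp [map_list_prod]

theorem Follows.Pd {ι : Type*} (L : List ι) {c : ι → K → A} (hc : ∀ i, IsArc (c i)) :
    Follows (fun t => Pd (K := K) (L.map fun i => c i t)) := by
  induction L with
  | nil => simpa [_root_.Pd] using Follows.const ⊥
  | cons i L ih =>
    simpa [_root_.Pd] using (Follows.span (IsArc.list_prod L hc)).sup ((Follows.span (hc i)).mul ih)

end ProductDerivatives

section Pencils

variable {K : Type*} [Field K] {A : Type*} [CommRing A] [Algebra K A]

theorem span_pair_pow_succ_le (x h : A) (k : ℕ) :
    ((K ∙ x) ⊔ (K ∙ h)) ^ (k + 1) ≤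
      (K ∙ x) * ((K ∙ x) ⊔ (K ∙ h)) ^ k ⊔ (K ∙ h ^ (k + 1)) := by
  induction k with
  | zero => simp
  | succ k ih =>
    have hh : (K ∙ h) * ((K ∙ x) ⊔ (K ∙ h)) ^ (k + 1) ≤
        (K ∙ x) * ((K ∙ x) ⊔ (K ∙ h)) ^ (k + 1) ⊔ (K ∙ h ^ (k + 1 + 1)) := by
      refine (mul_le_mul' le_rfl ih).trans ?_
      rw [Submodule.mul_sup]
      refine sup_le_sup ?_ ?_
      · rw [← mul_assoc, mul_comm (K ∙ h), mul_assoc, pow_succ' _ k]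
        exact mul_le_mul' le_rfl (mul_le_mul' le_sup_right le_rfl)
      · rw [pow_succ' h (k + 1), span_singleton_mul_eq]
    conv_lhs => rw [pow_succ', Submodule.sup_mul]
    exact sup_le le_sup_left hh

/-- Modulo `x`, a product of `k + 1` elements `x + b h` with `b ≠ 0` is a nonzero multiple of
`h ^ (k + 1)`. -/
theorem pencil_prod_sub_mem (x h : A) (M : List K) (b : K) (hb : b ≠ 0) (hM : ∀ c ∈ M, c ≠ 0) :
    ∃ c : K, c ≠ 0 ∧ ((b :: M).map fun a => x + a • h).prod - c • h ^ (M.length + 1) ∈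
      (K ∙ x) * ((K ∙ x) ⊔ (K ∙ h)) ^ M.length := by
  induction M generalizing b with
  | nil =>
    refine ⟨b, hb, ?_⟩
    simp
  | cons b' M ih =>
    obtain ⟨c, hc, hmem⟩ := ih b' (hM b' (by simp)) (fun c hc => hM c (by simp [hc]))
    set P := (K ∙ x) ⊔ (K ∙ h) with hP
    have hx : x ∈ K ∙ x := Submodule.mem_span_singleton_self x
    have hh : h ∈ P := Submodule.mem_sup_right (Submodule.mem_span_singleton_self h)
    have hx' : x ∈ P := Submodule.mem_sup_left hx
    refine ⟨b * c, mul_ne_zero hb hc, ?_⟩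
    set r := ((b' :: M).map fun a => x + a • h).prod with hr
    have hrP : r ∈ P ^ (M.length + 1) := by
      have : ∀ L : List K, (L.map fun a => x + a • h).prod ∈ P ^ L.length := by
        intro L
        induction L with
        | nil => exact Submodule.one_le.1 (le_refl (1 : Submodule K A))
        | cons a L ih =>
          simp only [List.map_cons, List.prod_cons, List.length_cons, pow_succ']
          exact Submodule.mul_mem_mul (P.add_mem hx' (P.smul_mem _ hh)) ih
      exact this (b' :: M)
    have h1 : x * r ∈ (K ∙ x) * P ^ (M.length + 1) := Submodule.mul_mem_mul hx hrP
    have h2 : h * (r - c • h ^ (M.length + 1)) ∈ (K ∙ x) * P ^ (M.length + 1) := by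
      have := Submodule.mul_mem_mul hh hmem
      rwa [← mul_assoc, mul_comm P, mul_assoc, ← pow_succ'] at this
    have h3 := Submodule.add_mem _ h1 (Submodule.smul_mem _ b h2)
    rw [List.length_cons]
    convert h3 using 1
    have hbr : ((b :: b' :: M).map fun a => x + a • h).prod = (x + b • h) * r := by
      rw [hr, List.map_cons, List.prod_cons]
    rw [hbr]
    simp only [Algebra.smul_def, map_mul]
    ring

theorem span_pair_add_smul (l h : A) (a : K) :
    (K ∙ (l + a • h)) ⊔ (K ∙ h) = (K ∙ l) ⊔ (K ∙ h) := by
  apply le_antisymm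
  · refine sup_le ?_ le_sup_right
    rw [Submodule.span_singleton_le_iff_mem]
    exact Submodule.add_mem_sup (Submodule.mem_span_singleton_self _)
      (Submodule.smul_mem _ _ (Submodule.mem_span_singleton_self _))
  · refine sup_le ?_ le_sup_right
    rw [Submodule.span_singleton_le_iff_mem]
    have := Submodule.add_mem_sup (Submodule.mem_span_singleton_self (R := K) (l + a • h))
      (Submodule.smul_mem _ (-a) (Submodule.mem_span_singleton_self (R := K) h))
    simpa using this

theorem span_pow_le_Pd (l h : A) (L : List K) (a : K) (hL : (a :: L).Nodup) :
    ((K ∙ l) ⊔ (K ∙ h)) ^ L.length ≤ Pd (K := K) ((a :: L).map fun c => l + c • h) := by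
  induction L generalizing a with
  | nil => simp [Pd, Submodule.one_eq_span]
  | cons b L ih =>
    have hab := List.nodup_cons.1 hL
    have ih' := ih b hab.2
    set x := l + a • h with hx
    obtain ⟨c, hc, hmem⟩ := pencil_prod_sub_mem x h (L.map fun c => c - a) (b - a)
      (sub_ne_zero.2 fun h => hab.1 (by simp [h])) (by
        intro c hc
        obtain ⟨c', hc', rfl⟩ := List.mem_map.1 hc
        exact sub_ne_zero.2 fun h => hab.1 (by simp [← h, hc']))
    have hprod : (((b - a) :: L.map fun c => c - a).map fun c => x + c • h) =
        (b :: L).map fun c => l + c • h := by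
      simp [hx, sub_smul]
    rw [hprod, List.length_map] at hmem
    rw [← span_pair_add_smul l h a, ← hx] at ih' ⊢
    rw [List.length_cons]
    refine (span_pair_pow_succ_le x h _).trans ?_
    rw [List.map_cons, Pd]
    have h1 : (K ∙ x) * ((K ∙ x) ⊔ (K ∙ h)) ^ L.length ≤
        (K ∙ ((b :: L).map fun c => l + c • h).prod) ⊔
          (K ∙ x) * Pd ((b :: L).map fun c => l + c • h) :=
      (mul_le_mul' le_rfl ih').trans le_sup_right
    refine sup_le h1 ?_
    rw [Submodule.span_singleton_le_iff_mem]
    have h2 := Submodule.sub_mem _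
      (Submodule.mem_sup_left (Submodule.mem_span_singleton_self _)) (h1 hmem)
    rw [sub_sub_cancel] at h2
    exact (Submodule.smul_mem_iff _ hc).1 h2

/-- The first `k` elements `l + j h` of a pencil. -/
def pencilList (K : Type*) [Field K] [Algebra K A] (l h : A) (k : ℕ) : List A :=
  (List.range k).map fun j : ℕ => l + (j : K) • h

theorem pow_le_Pd_pencilList [CharZero K] (l h : A) (k : ℕ) (hk : 1 ≤ k) :
    ((K ∙ l) ⊔ (K ∙ h)) ^ (k - 1) ≤ Pd (K := K) (pencilList K l h k) := by
  have hnd : ((List.range k).map (Nat.cast : ℕ → K)).Nodup :=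
    (List.nodup_range).map Nat.cast_injective
  have hmap : pencilList K l h k = ((List.range k).map (Nat.cast : ℕ → K)).map
      fun c => l + c • h := by simp [pencilList]
  rw [hmap]
  obtain ⟨k, rfl⟩ := Nat.exists_eq_add_of_le' hk
  have hlen : ((List.range (k + 1)).map (Nat.cast : ℕ → K)).length = k + 1 := by simp
  cases hL : (List.range (k + 1)).map (Nat.cast : ℕ → K) with
  | nil => simp [hL] at hlen
  | cons a L =>
    rw [hL] at hnd hlen
    have : L.length = k := by simpa using hlen
    subst this
    exact span_pow_le_Pd l h L a hnd

end Pencils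

/-- The types of subspaces of forms used in the degeneration argument. -/
inductive Piece
  | T | B | W (k : ℕ) | tube (t : ℕ) | flat (t : ℕ) | MT (t : ℕ) | MB (t : ℕ) | Y (k : ℕ) | zero

namespace Piece

/-- The expected dimension of a piece of degree `e` in `n + 1` variables. -/
def dim (n e : ℕ) : Piece → ℕ
  | T => n * e + 1
  | B => e + 1
  | W k => e + 1 + (n - 1) * (k - 1)
  | tube t => n * t + 1
  | flat t => t + 1
  | MT t => n * t + 1
  | MB t => t
  | Y k => e + n + 2 - k
  | zero => 0

section

variable {K : Type*} [Field K] {A C : Type*} [CommRing A] [Algebra K A] [CommRing C] [Algebra K C]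

/-- The factors `y 2, …, y (k + 1)`. -/
def fac (y : ℕ → A) (k : ℕ) : List A := (List.range k).map fun j => y (j + 2)

/-- The subspace of degree `e` forms of a given type; `R` is the space of linear forms, and the
linear forms `y i` are its parameters. -/
def sub (R : Submodule K A) (e : ℕ) (y : ℕ → A) : Piece → Submodule K A
  | T => Pd (fac y e) * R
  | B => Pd (fac y (e + 1))
  | W k => (K ∙ (fac y (e + 1 - k)).prod) * (((K ∙ y 0) ⊔ (K ∙ y 1)) ^ (k - 2) * R) ⊔
      (K ∙ (pencilList K (y 0) (y 1) k).prod) * Pd (fac y (e + 1 - k))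
  | tube t => (K ∙ (fac y (e - t)).prod) * (((K ∙ y 0) ⊔ (K ∙ y 1)) ^ (t - 1) * R)
  | flat t => (K ∙ (fac y (e - t)).prod) * ((K ∙ y 0) ⊔ (K ∙ y 1)) ^ t
  | MT t => (K ∙ y 0 ^ (e - t)) * (Pd (y 0 :: fac y (t - 1)) * R)
  | MB t => (K ∙ y 0 ^ (e + 1 - t)) * Pd (y 0 :: fac y (t - 1))
  | Y k => (K ∙ y 0 ^ (k - 2)) * ((K ∙ (fac y (e + 1 - k)).prod) * R ⊔
      (K ∙ y 0 ^ 2) * Pd (fac y (e + 1 - k)))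
  | zero => ⊥

theorem fac_map (f : A →ₐ[K] C) (y : ℕ → A) (k : ℕ) :
    (fac y k).map f = fac (fun i => f (y i)) k := by
  simp [fac, Function.comp_def]

theorem pencilList_map (f : A →ₐ[K] C) (l h : A) (k : ℕ) :
    (pencilList K l h k).map f = pencilList K (f l) (f h) k := by
  simp [pencilList, Function.comp_def]

theorem sub_map (f : A →ₐ[K] C) (R : Submodule K A) (e : ℕ) (y : ℕ → A) (P : Piece) :
    (P.sub R e y).map f.toLinearMap = P.sub (R.map f.toLinearMap) e fun i => f (y i) := by
  cases P <;>
    simp [sub, Submodule.map_mul, Submodule.map_sup, Submodule.map_pow, Pd_map, fac_map,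
      Submodule.map_span, map_list_prod, pencilList_map]

theorem isArc_fac_prod {y : K → ℕ → A} (hy : ∀ i, IsArc fun t => y t i) (k : ℕ) :
    IsArc fun t => (fac (y t) k).prod :=
  IsArc.list_prod (List.range k) (c := fun j t => y t (j + 2)) fun _ => hy _

theorem follows_Pd_fac {y : K → ℕ → A} (hy : ∀ i, IsArc fun t => y t i) (k : ℕ) :
    Follows fun t => Pd (K := K) (fac (y t) k) :=
  Follows.Pd (List.range k) (c := fun j t => y t (j + 2)) fun _ => hy _

theorem follows_Pd_cons_fac {y : K → ℕ → A} (hy : ∀ i, IsArc fun t => y t i) (k : ℕ) :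
    Follows fun t => Pd (K := K) (y t 0 :: fac (y t) k) := by
  simpa [Pd] using (Follows.span (isArc_fac_prod hy k)).sup
    ((Follows.span (hy 0)).mul (follows_Pd_fac hy k))

theorem follows_sub {y : K → ℕ → A} (hy : ∀ i, IsArc fun t => y t i) (R : Submodule K A) (e : ℕ)
    (P : Piece) : Follows fun t => P.sub R e (y t) := by
  have hR := Follows.const R
  have hpen : Follows fun t => (K ∙ y t 0) ⊔ (K ∙ y t 1) :=
    (Follows.span (hy 0)).sup (Follows.span (hy 1))
  have hfac := fun k => Follows.span (isArc_fac_prod hy k)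
  have hpd := fun k => follows_Pd_fac hy k
  have hpl : ∀ k, Follows fun t => K ∙ (pencilList K (y t 0) (y t 1) k).prod := fun k =>
    Follows.span (IsArc.list_prod (List.range k) (c := fun j t => y t 0 + (j : K) • y t 1)
      fun j => (hy 0).add ((hy 1).smul _))
  cases P with
  | T => exact (hpd _).mul hR
  | B => exact hpd _
  | W k => exact ((hfac _).mul ((hpen.pow _).mul hR)).sup ((hpl _).mul (hpd _))
  | tube t => exact (hfac _).mul ((hpen.pow _).mul hR)
  | flat t => exact (hfac _).mul (hpen.pow _)
  | MT t => exact (Follows.span ((hy 0).pow _)).mul ((follows_Pd_cons_fac hy _).mul hR)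
  | MB t => exact (Follows.span ((hy 0).pow _)).mul (follows_Pd_cons_fac hy _)
  | Y k =>
    exact (Follows.span ((hy 0).pow _)).mul (((hfac _).mul hR).sup
      ((Follows.span ((hy 0).pow _)).mul (hpd _)))
  | zero => exact Follows.const ⊥

end

end Piece

section LinearForms

variable {K : Type*} [Field K]

/-- The linear form with given coefficients. -/
noncomputable def lin {n : ℕ} : (Fin (n + 1) → K) →ₗ[K] MvPolynomial (Fin (n + 1)) K :=
  Fintype.linearCombination K X

/-- The space of linear forms. -/
noncomputable def linForms (K : Type*) [Field K] (n : ℕ) :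
    Submodule K (MvPolynomial (Fin (n + 1)) K) := LinearMap.range lin

theorem lin_single {n : ℕ} (i : Fin (n + 1)) : lin (K := K) (Pi.single i 1) = X i := by
  simp [lin, Fintype.linearCombination_apply_single]

theorem lin_mem {n : ℕ} (v : Fin (n + 1) → K) : lin v ∈ linForms K n := ⟨v, rfl⟩

/-- The substitution homomorphism attached to a linear map on coefficient vectors. -/
noncomputable def substHom {n m : ℕ} (G : (Fin (n + 1) → K) →ₗ[K] (Fin (m + 1) → K)) :
    MvPolynomial (Fin (n + 1)) K →ₐ[K] MvPolynomial (Fin (m + 1)) K :=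
  aeval fun i => lin (G (Pi.single i 1))

theorem substHom_lin {n m : ℕ} (G : (Fin (n + 1) → K) →ₗ[K] (Fin (m + 1) → K))
    (v : Fin (n + 1) → K) : substHom G (lin v) = lin (G v) := by
  rw [LinearMap.pi_apply_eq_sum_univ G v]
  have h : ∀ i : Fin (n + 1), (fun j => if i = j then (1 : K) else 0) = Pi.single i 1 := by
    intro i
    ext j
    simp [Pi.single_apply, eq_comm]
  simp [lin, Fintype.linearCombination_apply, substHom, h]

theorem substHom_injective {n : ℕ} (G : (Fin (n + 1) → K) ≃ₗ[K] (Fin (n + 1) → K)) :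
    Function.Injective (substHom (G : (Fin (n + 1) → K) →ₗ[K] (Fin (n + 1) → K))) := by
  have : (substHom (G.symm : (Fin (n + 1) → K) →ₗ[K] (Fin (n + 1) → K))).comp
      (substHom (G : (Fin (n + 1) → K) →ₗ[K] (Fin (n + 1) → K))) = AlgHom.id K _ := by
    refine MvPolynomial.algHom_ext fun i => ?_
    rw [← lin_single, AlgHom.comp_apply, substHom_lin, substHom_lin]
    simp
  intro a b hab
  have ha := DFunLike.congr_fun this a
  have hb := DFunLike.congr_fun this b
  rw [AlgHom.comp_apply] at ha hb
  rw [hab, hb] at ha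
  exact ha.symm

theorem linForms_map {n m : ℕ} (G : (Fin (n + 1) → K) →ₗ[K] (Fin (m + 1) → K))
    (hG : Function.Surjective G) : (linForms K n).map (substHom G).toLinearMap = linForms K m := by
  ext z
  simp only [linForms, Submodule.mem_map, LinearMap.mem_range]
  constructor
  · rintro ⟨_, ⟨v, rfl⟩, rfl⟩
    exact ⟨G v, (substHom_lin G v).symm⟩
  · rintro ⟨w, rfl⟩
    obtain ⟨v, rfl⟩ := hG w
    exact ⟨_, ⟨v, rfl⟩, substHom_lin G v⟩

/-- The subspace of forms given by a piece with parameter vectors `p`. -/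
noncomputable def Piece.space {n : ℕ} (e : ℕ) (P : Piece) (p : ℕ → Fin (n + 1) → K) :
    Submodule K (MvPolynomial (Fin (n + 1)) K) :=
  P.sub (linForms K n) e fun i => lin (p i)

theorem Piece.space_map {n m : ℕ} (G : (Fin (n + 1) → K) →ₗ[K] (Fin (m + 1) → K))
    (hG : Function.Surjective G) (e : ℕ) (P : Piece) (p : ℕ → Fin (n + 1) → K) :
    (P.space e p).map (substHom G).toLinearMap = P.space e fun i => G (p i) := by
  simp only [Piece.space, Piece.sub_map, linForms_map G hG, substHom_lin]

theorem Piece.follows_space {n : ℕ} (e : ℕ) (P : Piece) (p q : ℕ → Fin (n + 1) → K) :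
    Follows fun t : K => P.space e fun i => p i + t • q i := by
  refine Piece.follows_sub (y := fun t i => lin (p i + t • q i)) (fun i => ?_) _ _ _
  simp only [map_add, map_smul]
  exact (IsArc.const _).add (IsArc.param_smul _)

/-- Forgetting the coefficient of `x₀`. -/
noncomputable def dropZero (K : Type*) [Field K] (n : ℕ) :
    (Fin (n + 2) → K) →ₗ[K] (Fin (n + 1) → K) :=
  LinearMap.funLeft K K Fin.succ

theorem dropZero_surjective (n : ℕ) : Function.Surjective (dropZero K n) :=
  LinearMap.funLeft_surjective_of_injective _ _ _ (Fin.succ_injective _)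

theorem dropZero_cons {n : ℕ} (c : K) (v : Fin (n + 1) → K) :
    dropZero K n (Fin.cons c v : Fin (n + 2) → K) = v := by
  ext i
  simp [dropZero, LinearMap.funLeft_apply]

/-- The coefficient vector of `x₀`. -/
def unitZero (K : Type*) [Field K] (n : ℕ) : Fin (n + 1) → K := Pi.single 0 1

theorem unitZero_ne_zero (n : ℕ) : unitZero K n ≠ 0 := by
  simp [unitZero]

theorem dropZero_unitZero (n : ℕ) : dropZero K n (unitZero K (n + 1)) = 0 := by
  ext i
  simp [dropZero, LinearMap.funLeft_apply, unitZero]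

theorem lin_unitZero (n : ℕ) : lin (unitZero K n) = X 0 := lin_single 0

end LinearForms

section Configurations

variable (K : Type*) [Field K]

/-- There are pieces of the given types spanning a space of the expected dimension. -/
def GoodM (n e : ℕ) (s : Multiset Piece) : Prop :=
  ∃ m : Multiset (Piece × (ℕ → Fin (n + 1) → K)), m.map Prod.fst = s ∧
    RankGE ((s.map (Piece.dim n e)).sum) (m.map fun x => x.1.space e x.2).sup

/-- A degeneration of the piece `a` with trace `b` on the hyperplane `x₀ = 0` and residual `c`. -/
def IsMove (n e : ℕ) (a b c : Piece) : Prop :=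
  a.dim (n + 1) (e + 1) ≤ b.dim n (e + 1) + c.dim (n + 1) e ∧
  ∀ q : ℕ → Fin (n + 2) → K, ∃ q' : ℕ → Fin (n + 2) → K,
    (b.space (e + 1) fun i => dropZero K n (q i)) ≤
      (a.space (e + 1) q').map (substHom (dropZero K n)).toLinearMap ∧
    ∀ u ∈ c.space e q, X 0 * u ∈ a.space (e + 1) q'

/-- A degeneration as in `IsMove`, for parameters whose entry with index `1` is `x₀`. -/
def IsSpecialMove (n e : ℕ) (a b c : Piece) : Prop :=
  a.dim (n + 1) (e + 1) ≤ b.dim n (e + 1) + c.dim (n + 1) e ∧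
  (∀ p p' : ℕ → Fin (n + 1) → K, (∀ i, i ≠ 1 → p i = p' i) →
    b.space (e + 1) p = b.space (e + 1) p') ∧
  ∀ q : ℕ → Fin (n + 2) → K, q 1 = unitZero K (n + 1) → ∃ q' : ℕ → Fin (n + 2) → K,
    (b.space (e + 1) fun i => dropZero K n (q i)) ≤
      (a.space (e + 1) q').map (substHom (dropZero K n)).toLinearMap ∧
    ∀ u ∈ c.space e q, X 0 * u ∈ a.space (e + 1) q'

/-- Simultaneous degenerations of all pieces of a configuration. -/
inductive Moves (n e : ℕ) : Multiset Piece → Multiset Piece → Multiset Piece → Prop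
  | nil : Moves n e 0 0 0
  | cons {a b c : Piece} {S R U : Multiset Piece} : IsMove K n e a b c → Moves n e S R U →
      Moves n e (a ::ₘ S) (b ::ₘ R) (c ::ₘ U)

variable {K} {n e : ℕ}

theorem Moves.add {S R U S' R' U' : Multiset Piece} (h : Moves K n e S R U)
    (h' : Moves K n e S' R' U') : Moves K n e (S + S') (R + R') (U + U') := by
  induction h with
  | nil => simpa using h'
  | cons hm _ ih =>
    simp only [Multiset.cons_add]
    exact Moves.cons hm ih

theorem Moves.replicate {a b c : Piece} (h : IsMove K n e a b c) (k : ℕ) :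
    Moves K n e (Multiset.replicate k a) (Multiset.replicate k b) (Multiset.replicate k c) := by
  induction k with
  | zero => exact Moves.nil
  | succ k ih =>
    simp only [Multiset.replicate_succ]
    exact Moves.cons h ih

theorem Moves.single {a b c : Piece} (h : IsMove K n e a b c) : Moves K n e {a} {b} {c} :=
  Moves.replicate h 1

theorem Moves.align {S R U : Multiset Piece} (h : Moves K n e S R U)
    (mR : Multiset (Piece × (ℕ → Fin (n + 1) → K))) (mU : Multiset (Piece × (ℕ → Fin (n + 2) → K)))
    (hR : mR.map Prod.fst = R) (hU : mU.map Prod.fst = U) :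
    ∃ M : Multiset ((Piece × Piece × Piece) × (ℕ → Fin (n + 1) → K) × (ℕ → Fin (n + 2) → K)),
      (∀ x ∈ M, IsMove K n e x.1.1 x.1.2.1 x.1.2.2) ∧ M.map (fun x => x.1.1) = S ∧
      M.map (fun x => (x.1.2.1, x.2.1)) = mR ∧ M.map (fun x => (x.1.2.2, x.2.2)) = mU := by
  classical
  induction h generalizing mR mU with
  | nil =>
    refine ⟨0, by simp, by simp, ?_, ?_⟩
    · simpa [eq_comm] using hR
    · simpa [eq_comm] using hU
  | @cons a b c S R U hm _ ih =>
    obtain ⟨⟨b', p⟩, hx, rfl, hR'⟩ := (Multiset.map_eq_cons _ _ _ _).2 hR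
    obtain ⟨⟨c', q⟩, hy, rfl, hU'⟩ := (Multiset.map_eq_cons _ _ _ _).2 hU
    obtain ⟨M, h1, h2, h3, h4⟩ := ih _ _ hR' hU'
    refine ⟨((a, b', c'), p, q) ::ₘ M, ?_, ?_, ?_, ?_⟩
    · intro x hx
      rcases Multiset.mem_cons.1 hx with rfl | hx
      · exact hm
      · exact h1 x hx
    · simp [h2]
    · simp only [Multiset.map_cons, h3]
      exact Multiset.cons_erase hx
    · simp only [Multiset.map_cons, h4]
      exact Multiset.cons_erase hy

theorem Moves.dim_le {S R U : Multiset Piece} (h : Moves K n e S R U) :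
    (S.map (Piece.dim (n + 1) (e + 1))).sum ≤
      (R.map (Piece.dim n (e + 1))).sum + (U.map (Piece.dim (n + 1) e)).sum := by
  induction h with
  | nil => simp
  | cons hm _ ih =>
    simp only [Multiset.map_cons, Multiset.sum_cons]
    have := hm.1
    omega

theorem exists_linearEquiv_apply_eq {n : ℕ} {v w : Fin (n + 1) → K} (hv : v ≠ 0) (hw : w ≠ 0) :
    ∃ G : (Fin (n + 1) → K) ≃ₗ[K] (Fin (n + 1) → K), G v = w := by
  obtain ⟨g, hg⟩ := Submodule.exists_linearEquiv_restrict_eq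
    ((LinearEquiv.toSpanNonzeroSingleton K _ v hv).symm ≪≫ₗ
      LinearEquiv.toSpanNonzeroSingleton K _ w hw)
  refine ⟨g, ?_⟩
  have h1 := hg ⟨v, Submodule.mem_span_singleton_self v⟩
  rw [LinearEquiv.trans_apply] at h1
  have h2 : (LinearEquiv.toSpanNonzeroSingleton K _ v hv).symm
      ⟨v, Submodule.mem_span_singleton_self v⟩ = 1 := by
    rw [LinearEquiv.symm_apply_eq, LinearEquiv.toSpanNonzeroSingleton_one]
  rw [h2, LinearEquiv.toSpanNonzeroSingleton_one] at h1
  exact h1.symm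

theorem exists_substHom_injective {n : ℕ} {v w : Fin (n + 1) → K} (hv : v ≠ 0) (hw : w ≠ 0) :
    ∃ G : (Fin (n + 1) → K) →ₗ[K] (Fin (n + 1) → K), Function.Surjective G ∧
      Function.Injective (substHom G) ∧ G v = w := by
  obtain ⟨G, hG⟩ := exists_linearEquiv_apply_eq hv hw
  exact ⟨G.toLinearMap, G.surjective, substHom_injective G, hG⟩

theorem map_multiset_sup {A C : Type*} [CommRing A] [Algebra K A] [CommRing C] [Algebra K C]
    {ι : Type*} (f : A →ₗ[K] C) (m : Multiset ι) (W : ι → Submodule K A) :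
    ((m.map W).sup).map f = (m.map fun i => (W i).map f).sup := by
  induction m using Multiset.induction with
  | empty => simp
  | cons i m ih => simp [Submodule.map_sup, ih]

theorem goodM_cons {c : Piece} {U : Multiset Piece} (h : GoodM K n e (c ::ₘ U)) :
    ∃ (p : ℕ → Fin (n + 1) → K) (m : Multiset (Piece × (ℕ → Fin (n + 1) → K))),
      m.map Prod.fst = U ∧ RankGE (c.dim n e + (U.map (Piece.dim n e)).sum)
        (c.space e p ⊔ (m.map fun x => x.1.space e x.2).sup) := by
  classical
  obtain ⟨m, hm, hr⟩ := h
  obtain ⟨⟨c', p⟩, hx, hc, hU⟩ := (Multiset.map_eq_cons _ _ _ _).2 hm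
  simp only at hc
  subst hc
  refine ⟨p, _, hU, ?_⟩
  have hr' := hr
  rw [← Multiset.cons_erase hx] at hr'
  simpa using hr'

theorem GoodM.exists_normalized [Infinite K] {c : Piece} {U : Multiset Piece}
    (h : GoodM K n e (c ::ₘ U)) :
    ∃ (p : ℕ → Fin (n + 1) → K) (m : Multiset (Piece × (ℕ → Fin (n + 1) → K))),
      m.map Prod.fst = U ∧ p 1 = unitZero K n ∧
      RankGE (c.dim n e + (U.map (Piece.dim n e)).sum)
        (c.space e p ⊔ (m.map fun x => x.1.space e x.2).sup) := by
  obtain ⟨p, m', hU', hr⟩ := goodM_cons h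
  obtain ⟨p', hp', hr'⟩ : ∃ p' : ℕ → Fin (n + 1) → K, p' 1 ≠ 0 ∧
      RankGE (c.dim n e + (U.map (Piece.dim n e)).sum)
        (c.space e p' ⊔ (m'.map fun x => x.1.space e x.2).sup) := by
    by_cases hp : p 1 = 0
    · have hF : Follows fun t : K => (c.space e fun i => p i + t • unitZero K n) ⊔
          (m'.map fun x => x.1.space e x.2).sup :=
        (Piece.follows_space e c p fun _ => unitZero K n).sup (Follows.const _)
      obtain ⟨Q, hQ, hQ'⟩ := hF.rankGE (t₀ := 0) (by simpa using hr)
      obtain ⟨t, ht⟩ := exists_eval_ne_zero (mul_ne_zero hQ Polynomial.X_ne_zero)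
      rw [Polynomial.eval_mul, Polynomial.eval_X] at ht
      refine ⟨_, ?_, hQ' t (left_ne_zero_of_mul ht)⟩
      simpa [hp] using ⟨right_ne_zero_of_mul ht, unitZero_ne_zero n⟩
    · exact ⟨p, hp, hr⟩
  obtain ⟨G, hGs, hGi, hG⟩ := exists_substHom_injective hp' (unitZero_ne_zero (K := K) n)
  refine ⟨fun i => G (p' i), m'.map fun x => (x.1, fun i => G (x.2 i)), ?_, hG, ?_⟩
  · simpa using hU'
  · have := hr'.map_injective (substHom G).toLinearMap hGi
    rw [Submodule.map_sup, map_multiset_sup, Piece.space_map G hGs] at this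
    simpa [Piece.space_map G hGs, Function.comp_def] using this

theorem multiset_sup_map_mono {A : Type*} [SemilatticeSup A] [OrderBot A] {ι : Type*}
    (m : Multiset ι) {f g : ι → A} (h : ∀ i ∈ m, f i ≤ g i) : (m.map f).sup ≤ (m.map g).sup := by
  rw [Multiset.sup_le]
  intro a ha
  obtain ⟨i, hi, rfl⟩ := Multiset.mem_map.1 ha
  exact (h i hi).trans (Multiset.le_sup (Multiset.mem_map_of_mem g hi))

theorem mul_mem_multiset_sup {A : Type*} [CommRing A] [Algebra K A] {ι : Type*}
    (m : Multiset ι) {f g : ι → Submodule K A} (x : A) (h : ∀ i ∈ m, ∀ u ∈ f i, x * u ∈ g i) :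
    ∀ u ∈ (m.map f).sup, x * u ∈ (m.map g).sup := by
  have : (m.map f).sup ≤ ((m.map g).sup).comap (LinearMap.mulLeft K x) := by
    rw [Multiset.sup_le]
    intro a ha
    obtain ⟨i, hi, rfl⟩ := Multiset.mem_map.1 ha
    intro u hu
    exact Multiset.le_sup (Multiset.mem_map_of_mem g hi) (h i hi u hu)
  exact fun u hu => this hu

theorem GoodM.step_special [Infinite K] {a b c : Piece} {S R U : Multiset Piece}
    (ha : IsSpecialMove K n e a b c) (hm : Moves K n e S R U)
    (hR : GoodM K n (e + 1) (b ::ₘ R)) (hU : GoodM K (n + 1) e (c ::ₘ U)) :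
    GoodM K (n + 1) (e + 1) (a ::ₘ S) := by
  classical
  obtain ⟨p, mR, hR', hrR⟩ := goodM_cons hR
  obtain ⟨q, mU, hmU, hq1, hrU⟩ := hU.exists_normalized
  obtain ⟨M, hM, hMS, hMR, hMU⟩ := hm.align _ _ hR' hmU
  rw [← hMR, Multiset.map_map] at hrR
  rw [← hMU, Multiset.map_map] at hrU
  let lift : (ℕ → Fin (n + 1) → K) → ℕ → Fin (n + 2) → K := fun r i => Fin.cons 0 (r i)
  let p₀ : ℕ → Fin (n + 2) → K := Function.update (lift p) 1 (unitZero K (n + 1))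
  let arc : (ℕ → Fin (n + 2) → K) → (ℕ → Fin (n + 2) → K) → K → ℕ → Fin (n + 2) → K :=
    fun r r' t i => r i + t • (r' i - r i)
  have hdrop0 : (b.space (e + 1) fun i => dropZero K n (p₀ i)) = b.space (e + 1) p := by
    refine ha.2.1 _ _ fun i hi => ?_
    simp [p₀, hi, lift, dropZero_cons]
  have hFR : Follows fun t : K => (b.space (e + 1) fun i => dropZero K n (arc p₀ q t i)) ⊔
      (M.map fun x => x.1.2.1.space (e + 1) fun i =>
        dropZero K n (arc (lift x.2.1) x.2.2 t i)).sup := by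
    simp only [arc, map_add, map_smul]
    exact (Piece.follows_space _ _ _ _).sup
      (Follows.multiset_sup M fun x _ => Piece.follows_space _ _ _ _)
  have hFU : Follows fun t : K => (c.space e (arc p₀ q t)) ⊔
      (M.map fun x => x.1.2.2.space e (arc (lift x.2.1) x.2.2 t)).sup :=
    (Piece.follows_space _ _ _ _).sup
      (Follows.multiset_sup M fun x _ => Piece.follows_space _ _ _ _)
  obtain ⟨Q₁, hQ₁, hQ₁'⟩ := hFR.rankGE (t₀ := 0) 
    (by simpa [arc, hdrop0, lift, dropZero_cons, Function.comp_def] using hrR)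
  obtain ⟨Q₂, hQ₂, hQ₂'⟩ := hFU.rankGE (t₀ := 1) 
    (by
      have h1 : ∀ r r', arc r r' 1 = r' := fun r r' => by ext; simp [arc]
      simpa [h1, Function.comp_def] using hrU)
  obtain ⟨t, ht⟩ := exists_eval_ne_zero (mul_ne_zero hQ₁ hQ₂)
  rw [Polynomial.eval_mul] at ht
  have hrow := hQ₁' t (left_ne_zero_of_mul ht)
  have hres := hQ₂' t (right_ne_zero_of_mul ht)
  have harc1 : arc p₀ q t 1 = unitZero K (n + 1) := by simp [arc, p₀, hq1]
  obtain ⟨q', hq'₁, hq'₂⟩ := ha.2.2 _ harc1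
  have hex : ∀ x : (Piece × Piece × Piece) × (ℕ → Fin (n + 1) → K) × (ℕ → Fin (n + 2) → K),
      ∃ r' : ℕ → Fin (n + 2) → K, x ∈ M →
      (x.1.2.1.space (e + 1) fun i => dropZero K n (arc (lift x.2.1) x.2.2 t i)) ≤
        (x.1.1.space (e + 1) r').map (substHom (dropZero K n)).toLinearMap ∧
      ∀ u ∈ x.1.2.2.space e (arc (lift x.2.1) x.2.2 t), X 0 * u ∈ x.1.1.space (e + 1) r' := by
    intro x
    by_cases hx : x ∈ M
    · obtain ⟨r', hr'⟩ := (hM x hx).2 (arc (lift x.2.1) x.2.2 t)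
      exact ⟨r', fun _ => hr'⟩
    · exact ⟨fun _ => 0, fun h => absurd h hx⟩
  choose r hr using hex
  refine ⟨(a, q') ::ₘ M.map fun x => (x.1.1, r x), ?_, ?_⟩
  · simp [hMS]
  · have hX : substHom (dropZero K n) (X 0) = 0 := by
      rw [← lin_unitZero, substHom_lin, dropZero_unitZero, map_zero]
    have key := RankGE.add_of_restrict (substHom (dropZero K n)) (X 0) hX
      (fun u hu => (mul_eq_zero.1 hu).resolve_left (X_ne_zero 0))
      (W := a.space (e + 1) q' ⊔ (M.map fun x => x.1.1.space (e + 1) (r x)).sup)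
      (hrow.mono le_rfl ?_) hres ?_
    · refine key.mono ?_ ?_
      · have h1 := ha.1
        have h2 := hm.dim_le
        simp only [Multiset.map_cons, Multiset.sum_cons]
        omega
      · simp
    · rw [Submodule.map_sup, map_multiset_sup]
      exact sup_le_sup hq'₁ (multiset_sup_map_mono M fun x hx => (hr x hx).1)
    · intro u hu
      obtain ⟨u₁, h₁, u₂, h₂, rfl⟩ := Submodule.mem_sup.1 hu
      rw [mul_add]
      exact Submodule.add_mem_sup (hq'₂ u₁ h₁)
        (mul_mem_multiset_sup M (X 0) (fun x hx => (hr x hx).2) u₂ h₂)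

theorem GoodM.zero_cons {s : Multiset Piece} (h : GoodM K n e s) :
    GoodM K n e (Piece.zero ::ₘ s) := by
  obtain ⟨m, hm, hr⟩ := h
  refine ⟨(Piece.zero, fun _ => 0) ::ₘ m, by simp [hm], ?_⟩
  simpa [Piece.dim, Piece.space, Piece.sub] using hr

theorem GoodM.of_zero_cons {s : Multiset Piece} (h : GoodM K n e (Piece.zero ::ₘ s)) :
    GoodM K n e s := by
  obtain ⟨p, m, hs, hr⟩ := goodM_cons h
  refine ⟨m, hs, ?_⟩
  simpa [Piece.dim, Piece.space, Piece.sub] using hr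

theorem GoodM.add_zeros {s : Multiset Piece} (h : GoodM K n e s) (k : ℕ) :
    GoodM K n e (s + Multiset.replicate k Piece.zero) := by
  induction k with
  | zero => simpa using h
  | succ k ih => simpa [Multiset.replicate_succ] using ih.zero_cons

theorem isSpecialMove_zero : IsSpecialMove K n e Piece.zero Piece.zero Piece.zero := by
  refine ⟨by simp [Piece.dim], fun _ _ _ => rfl, fun q _ => ⟨q, ?_⟩⟩
  simp [Piece.space, Piece.sub]

theorem GoodM.step [Infinite K] {S R U : Multiset Piece} (hm : Moves K n e S R U)
    (hR : GoodM K n (e + 1) R) (hU : GoodM K (n + 1) e U) : GoodM K (n + 1) (e + 1) S :=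
  (GoodM.step_special isSpecialMove_zero hm hR.zero_cons hU.zero_cons).of_zero_cons

end Configurations

/-- Insert the first `k` values of `L` before the entry with index `2`. -/
def insertAt {α : Type*} (L : ℕ → α) (k : ℕ) (y : ℕ → α) : ℕ → α :=
  fun i => if i < 2 then y i else if i - 2 < k then L (i - 2) else y (i - k)

theorem insertAt_apply_zero {α : Type*} (L : ℕ → α) (k : ℕ) (y : ℕ → α) :
    insertAt L k y 0 = y 0 := rfl

theorem insertAt_apply_one {α : Type*} (L : ℕ → α) (k : ℕ) (y : ℕ → α) :
    insertAt L k y 1 = y 1 := rfl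

theorem apply_insertAt {α β : Type*} (f : α → β) (L : ℕ → α) (k : ℕ) (y : ℕ → α) (i : ℕ) :
    f (insertAt L k y i) = insertAt (fun j => f (L j)) k (fun j => f (y j)) i := by
  simp only [insertAt]
  split_ifs <;> rfl

theorem Piece.fac_insertAt {A : Type*} (L : ℕ → A) (k m : ℕ) (y : ℕ → A) :
    Piece.fac (insertAt L k y) (k + m) = (List.range k).map L ++ Piece.fac y m := by
  rw [Piece.fac, List.range_add, List.map_append, Piece.fac, List.map_map]
  congr 1
  · refine List.map_congr_left fun j hj => ?_
    have := List.mem_range.1 hj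
    simp [insertAt, this]
  · refine List.map_congr_left fun j _ => ?_
    have h1 : ¬ (k + j + 2 < 2) := by omega
    have h2 : ¬ (k + j + 2 - 2 < k) := by omega
    have h3 : k + j + 2 - k = j + 2 := by omega
    simp only [Function.comp_apply, insertAt, h1, h2, h3, if_false]

theorem Piece.fac_insertAt_one {A : Type*} (a : A) (m : ℕ) (y : ℕ → A) :
    Piece.fac (insertAt (fun _ => a) 1 y) (m + 1) = a :: Piece.fac y m := by
  rw [add_comm, Piece.fac_insertAt]
  simp

section

variable {K : Type*} [Field K] {A : Type*} [CommRing A] [Algebra K A]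

theorem Piece.fac_insertAt_pencil (l h : A) (k m : ℕ) (y : ℕ → A) :
    Piece.fac (insertAt (fun j => l + (j : K) • h) k y) (k + m) =
      pencilList K l h k ++ Piece.fac y m := by
  rw [Piece.fac_insertAt, pencilList]

theorem pencilList_zero_right (l : A) (k : ℕ) :
    pencilList K l 0 k = List.replicate k l := by
  simp [pencilList, List.map_const']

theorem pow_mem_Pd_replicate (l : A) (k : ℕ) :
    l ^ k ∈ Pd (K := K) (List.replicate (k + 1) l) := by
  rw [List.replicate_succ, Pd]
  exact Submodule.mem_sup_left (by simp)

theorem span_pow_mul_Pd_cons_le (l : A) (k : ℕ) (L : List A) :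
    (K ∙ l ^ k) * Pd (l :: L) ≤ Pd (List.replicate (k + 1) l ++ L) := by
  rw [Pd, Pd_append, Submodule.mul_sup]
  refine sup_le_sup ?_ ?_
  · rw [mul_comm]
    exact mul_le_mul' le_rfl ((Submodule.span_singleton_le_iff_mem _ _).2 (pow_mem_Pd_replicate l k))
  · rw [← mul_assoc, ← span_singleton_mul_eq, List.prod_replicate, ← pow_succ]

theorem span_mul_pow_le_Pd_pencil_append [CharZero K] (l h : A) (k : ℕ) (L : List A) :
    (K ∙ h) * ((K ∙ L.prod) * ((K ∙ l) ⊔ (K ∙ h)) ^ k) ≤ Pd (pencilList K l h (k + 2) ++ L) := by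
  rw [Pd_append]
  refine le_trans ?_ le_sup_left
  calc (K ∙ h) * ((K ∙ L.prod) * ((K ∙ l) ⊔ (K ∙ h)) ^ k)
      = (K ∙ L.prod) * (((K ∙ l) ⊔ (K ∙ h)) ^ k * (K ∙ h)) := by ring
    _ ≤ (K ∙ L.prod) * (((K ∙ l) ⊔ (K ∙ h)) ^ k * ((K ∙ l) ⊔ (K ∙ h))) :=
      mul_le_mul' le_rfl (mul_le_mul' le_rfl le_sup_right)
    _ ≤ _ := by
      rw [← pow_succ]
      exact mul_le_mul' le_rfl (pow_le_Pd_pencilList l h (k + 2) (by omega))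

theorem forall_mul_mem_of_le {S U : Submodule K A} {x : A} (h : (K ∙ x) * S ≤ U) :
    ∀ u ∈ S, x * u ∈ U :=
  fun _ hu => h (Submodule.mul_mem_mul (Submodule.mem_span_singleton_self x) hu)

end

section AbstractMoves

open Piece

variable {K : Type*} [Field K] {A : Type*} [CommRing A] [Algebra K A] {R : Submodule K A} {e : ℕ}
  {y : ℕ → A} {x : A}

theorem sub_T_idle_row (a : A) :
    (tube 1).sub R (e + 1) y ≤ T.sub R (e + 1) (insertAt (fun _ => a) 1 y) := by
  simp only [sub, fac_insertAt_one, Pd, Nat.add_sub_cancel, Nat.sub_self, pow_zero, one_mul]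
  exact mul_le_mul' le_sup_left le_rfl

theorem sub_T_idle_res :
    (K ∙ x) * T.sub R e y ≤ T.sub R (e + 1) (insertAt (fun _ => x) 1 y) := by
  simp only [sub, fac_insertAt_one, Pd]
  rw [← mul_assoc]
  exact mul_le_mul' le_sup_right le_rfl

theorem sub_T_gen_res (hx : x ∈ R) : (K ∙ x) * B.sub R e y ≤ T.sub R (e + 1) y := by
  simp only [sub]
  rw [mul_comm]
  exact mul_le_mul' le_rfl ((Submodule.span_singleton_le_iff_mem _ _).2 hx)

theorem sub_B_idle_row (a : A) :
    (flat 0).sub R (e + 1) y ≤ B.sub R (e + 1) (insertAt (fun _ => a) 1 y) := by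
  simp only [sub, fac_insertAt_one, Pd, Nat.sub_zero, pow_zero, mul_one]
  exact le_sup_left

theorem sub_B_idle_res :
    (K ∙ x) * B.sub R e y ≤ B.sub R (e + 1) (insertAt (fun _ => x) 1 y) := by
  simp only [sub, fac_insertAt_one, Pd]
  exact le_sup_right

theorem sub_MT_gen_res (hx : x ∈ R) (t : ℕ) :
    (K ∙ x) * (MB t).sub R e y ≤ (MT t).sub R (e + 1) y := by
  simp only [sub]
  calc _ = (K ∙ y 0 ^ (e + 1 - t)) * (Pd (y 0 :: fac y (t - 1)) * (K ∙ x)) := by ring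
    _ ≤ _ := mul_le_mul' le_rfl
      (mul_le_mul' le_rfl ((Submodule.span_singleton_le_iff_mem _ _).2 hx))

theorem sub_tube_gen_res (hx : x ∈ R) {t : ℕ} (ht : 1 ≤ t) (hte : t ≤ e + 1) :
    (K ∙ x) * (flat (t - 1)).sub R e y ≤ (tube t).sub R (e + 1) y := by
  simp only [sub]
  rw [show e - (t - 1) = e + 1 - t by omega]
  calc _ = (K ∙ (fac y (e + 1 - t)).prod) *
        (((K ∙ y 0) ⊔ (K ∙ y 1)) ^ (t - 1) * (K ∙ x)) := by ring
    _ ≤ _ := mul_le_mul' le_rfl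
      (mul_le_mul' le_rfl ((Submodule.span_singleton_le_iff_mem _ _).2 hx))

theorem sub_tube_zero_res {t : ℕ} (hte : t ≤ e) :
    (K ∙ x) * (tube t).sub R e y ≤ (tube t).sub R (e + 1) (insertAt (fun _ => x) 1 y) := by
  simp only [sub, insertAt_apply_zero, insertAt_apply_one]
  rw [show e + 1 - t = e - t + 1 by omega, fac_insertAt_one, List.prod_cons,
    span_singleton_mul_eq, mul_assoc]

theorem sub_flat_zero_res {t : ℕ} (hte : t ≤ e) :
    (K ∙ x) * (flat t).sub R e y ≤ (flat t).sub R (e + 1) (insertAt (fun _ => x) 1 y) := by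
  simp only [sub, insertAt_apply_zero, insertAt_apply_one]
  rw [show e + 1 - t = e - t + 1 by omega, fac_insertAt_one, List.prod_cons,
    span_singleton_mul_eq, mul_assoc]

theorem sub_W_gen_res (hx : x ∈ R) (k : ℕ) :
    (K ∙ x) * (flat k).sub R e y ≤ (W (k + 2)).sub R (e + 1) y := by
  simp only [sub, Nat.add_sub_cancel]
  rw [show e + 1 + 1 - (k + 2) = e - k by omega]
  refine le_trans ?_ le_sup_left
  calc _ = (K ∙ (fac y (e - k)).prod) * (((K ∙ y 0) ⊔ (K ∙ y 1)) ^ k * (K ∙ x)) := by ring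
    _ ≤ _ := mul_le_mul' le_rfl
      (mul_le_mul' le_rfl ((Submodule.span_singleton_le_iff_mem _ _).2 hx))

theorem sub_W_axis_row {k : ℕ} (hk : 2 ≤ k) (hy : y 1 = 0) :
    (Y k).sub R e y ≤ (W k).sub R e y := by
  simp only [sub, hy, pencilList_zero_right, List.prod_replicate]
  rw [Submodule.mul_sup]
  have h0 : (K ∙ (0 : A)) = ⊥ := by simp
  have hp : ∀ j, (K ∙ y 0) ^ j = K ∙ y 0 ^ j := fun j => by rw [Submodule.span_pow, Set.singleton_pow]
  rw [h0, sup_bot_eq, hp]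
  refine sup_le_sup (le_of_eq (by ring)) ?_
  rw [← mul_assoc, ← span_singleton_mul_eq, ← pow_add, Nat.sub_add_cancel hk]

theorem sub_W_axis_res (k : ℕ) :
    (K ∙ y 1) * (tube (k + 1)).sub R e y ≤ (W (k + 3)).sub R (e + 1) y := by
  simp only [sub, Nat.add_sub_cancel]
  rw [show e + 1 + 1 - (k + 3) = e - (k + 1) by omega, show k + 3 - 2 = k + 1 by omega]
  refine le_trans ?_ le_sup_left
  calc _ = (K ∙ (fac y (e - (k + 1))).prod) *
        ((((K ∙ y 0) ⊔ (K ∙ y 1)) ^ k * (K ∙ y 1)) * R) := by ring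
    _ ≤ _ := by
      rw [pow_succ]
      exact mul_le_mul' le_rfl (mul_le_mul' (mul_le_mul' le_rfl le_sup_right) le_rfl)

variable (K) in
/-- The parameters obtained by inserting `k` members of the pencil spanned by `y 0` and `y 1`. -/
def insertPencil (k : ℕ) (y : ℕ → A) : ℕ → A := insertAt (fun j => y 0 + (j : K) • y 1) k y

theorem sub_T_axis_row {k : ℕ} (hk : 1 ≤ k) (hke : k ≤ e) (hy : y 1 = 0) :
    (MT (e + 1 - k)).sub R e y ≤ T.sub R e (insertPencil K k y) := by
  obtain ⟨m, rfl⟩ := Nat.exists_eq_add_of_le hke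
  obtain ⟨k, rfl⟩ := Nat.exists_eq_add_of_le' hk
  simp only [sub, insertPencil, fac_insertAt_pencil, hy, pencilList_zero_right]
  rw [← mul_assoc, show k + 1 + m + 1 - (k + 1) - 1 = m by omega,
    show k + 1 + m - (k + 1 + m + 1 - (k + 1)) = k by omega]
  exact mul_le_mul' (span_pow_mul_Pd_cons_le _ _ _) le_rfl

theorem sub_T_axis_res [CharZero K] {k : ℕ} (hk : 2 ≤ k) (hke : k ≤ e + 1) (hy : y 1 ∈ R) :
    (K ∙ y 1) * (W k).sub R e y ≤ T.sub R (e + 1) (insertPencil K k y) := by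
  obtain ⟨m, hm⟩ := Nat.exists_eq_add_of_le hke
  obtain ⟨k, rfl⟩ := Nat.exists_eq_add_of_le' hk
  simp only [sub, insertPencil, hm, fac_insertAt_pencil]
  rw [Nat.add_sub_cancel_left, Nat.add_sub_cancel, Submodule.mul_sup]
  refine sup_le ?_ ?_
  · calc _ = (K ∙ y 1) * ((K ∙ (fac y m).prod) * ((K ∙ y 0) ⊔ (K ∙ y 1)) ^ k) * R := by ring
      _ ≤ _ := mul_le_mul' (span_mul_pow_le_Pd_pencil_append _ _ _ _) le_rfl
  · rw [mul_comm, Pd_append]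
    exact mul_le_mul' le_sup_right ((Submodule.span_singleton_le_iff_mem _ _).2 hy)

theorem sub_B_axis_row {k : ℕ} (hk : 1 ≤ k) (hke : k ≤ e + 1) (hy : y 1 = 0) :
    (MB (e + 2 - k)).sub R e y ≤ B.sub R e (insertPencil K k y) := by
  obtain ⟨m, hm⟩ := Nat.exists_eq_add_of_le hke
  obtain ⟨k, rfl⟩ := Nat.exists_eq_add_of_le' hk
  simp only [sub, insertPencil, hm, fac_insertAt_pencil, hy, pencilList_zero_right]
  rw [show e + 2 - (k + 1) - 1 = m by omega,
    show k + 1 + m - (e + 2 - (k + 1)) = k by omega]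
  exact span_pow_mul_Pd_cons_le _ _ _

theorem sub_B_axis_res [CharZero K] {k : ℕ} (hk : 2 ≤ k) (hke : k ≤ e + 2) :
    (K ∙ y 1) * (flat (k - 2)).sub R e y ≤ B.sub R (e + 1) (insertPencil K k y) := by
  obtain ⟨m, hm⟩ := Nat.exists_eq_add_of_le hke
  obtain ⟨k, rfl⟩ := Nat.exists_eq_add_of_le' hk
  simp only [sub, insertPencil]
  rw [show e + 1 + 1 = k + 2 + m by omega, fac_insertAt_pencil, Nat.add_sub_cancel,
    show e - k = m by omega]
  exact span_mul_pow_le_Pd_pencil_append _ _ _ _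

end AbstractMoves

section ConcreteMoves

open Piece

variable {K : Type*} [Field K] {n e : ℕ}

theorem isMove_of_space {a b c : Piece}
    (hdim : a.dim (n + 1) (e + 1) ≤ b.dim n (e + 1) + c.dim (n + 1) e)
    (h : ∀ q : ℕ → Fin (n + 2) → K, ∃ q' : ℕ → Fin (n + 2) → K,
      (b.space (e + 1) fun i => dropZero K n (q i)) ≤
        (a.space (e + 1) fun i => dropZero K n (q' i)) ∧
      (K ∙ (X 0 : MvPolynomial (Fin (n + 2)) K)) * c.space e q ≤ a.space (e + 1) q') :
    IsMove K n e a b c := by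
  refine ⟨hdim, fun q => ?_⟩
  obtain ⟨q', h1, h2⟩ := h q
  refine ⟨q', ?_, forall_mul_mem_of_le h2⟩
  rw [Piece.space_map _ (dropZero_surjective n)]
  exact h1

theorem isSpecialMove_of_space {a b c : Piece}
    (hdim : a.dim (n + 1) (e + 1) ≤ b.dim n (e + 1) + c.dim (n + 1) e)
    (hb : ∀ p p' : ℕ → Fin (n + 1) → K, (∀ i, i ≠ 1 → p i = p' i) →
      b.space (e + 1) p = b.space (e + 1) p')
    (h : ∀ q : ℕ → Fin (n + 2) → K, q 1 = unitZero K (n + 1) → ∃ q' : ℕ → Fin (n + 2) → K,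
      (b.space (e + 1) fun i => dropZero K n (q i)) ≤
        (a.space (e + 1) fun i => dropZero K n (q' i)) ∧
      (K ∙ (X 0 : MvPolynomial (Fin (n + 2)) K)) * c.space e q ≤ a.space (e + 1) q') :
    IsSpecialMove K n e a b c := by
  refine ⟨hdim, hb, fun q hq => ?_⟩
  obtain ⟨q', h1, h2⟩ := h q hq
  refine ⟨q', ?_, forall_mul_mem_of_le h2⟩
  rw [Piece.space_map _ (dropZero_surjective n)]
  exact h1

theorem space_insertAt_unitZero (P : Piece) (q : ℕ → Fin (n + 1) → K) :
    P.space e (insertAt (fun _ => unitZero K n) 1 q) =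
      P.sub (linForms K n) e (insertAt (fun _ => X 0) 1 fun i => lin (q i)) := by
  unfold Piece.space
  congr 1
  funext i
  rw [apply_insertAt (fun v => lin v)]
  simp only [lin_unitZero]

theorem space_dropZero_insertAt_unitZero (P : Piece) (q : ℕ → Fin (n + 2) → K) :
    (P.space e fun i => dropZero K n (insertAt (fun _ => unitZero K (n + 1)) 1 q i)) =
      P.sub (linForms K n) e (insertAt (fun _ => 0) 1 fun i => lin (dropZero K n (q i))) := by
  unfold Piece.space
  congr 1
  funext i
  rw [apply_insertAt (fun v => lin (dropZero K n v))]
  simp only [dropZero_unitZero, map_zero]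

theorem X_zero_mem_linForms : (X 0 : MvPolynomial (Fin (n + 1)) K) ∈ linForms K n := by
  rw [← lin_unitZero]
  exact lin_mem _

theorem isMove_T_idle : IsMove K n e T (tube 1) T :=
  isMove_of_space (by simp only [dim]; nlinarith) fun q =>
    ⟨_, by rw [space_dropZero_insertAt_unitZero]; exact sub_T_idle_row 0,
      by rw [space_insertAt_unitZero]; exact sub_T_idle_res⟩

theorem isMove_B_idle : IsMove K n e B (flat 0) B :=
  isMove_of_space (by simp only [dim]; omega) fun q =>
    ⟨_, by rw [space_dropZero_insertAt_unitZero]; exact sub_B_idle_row 0,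
      by rw [space_insertAt_unitZero]; exact sub_B_idle_res⟩

theorem isMove_T_gen : IsMove K n e T T B :=
  isMove_of_space (by simp only [dim]; nlinarith) fun q =>
    ⟨q, le_rfl, sub_T_gen_res X_zero_mem_linForms⟩

theorem isMove_zero_right {a : Piece} (h : a.dim (n + 1) (e + 1) ≤ a.dim n (e + 1)) :
    IsMove K n e a a zero :=
  isMove_of_space (h.trans (Nat.le_add_right _ _)) fun q =>
    ⟨q, le_rfl, by simp [Piece.space, sub]⟩

theorem isMove_B_gen : IsMove K n e B B zero := isMove_zero_right le_rfl

theorem isMove_flat_gen (t : ℕ) : IsMove K n e (flat t) (flat t) zero := isMove_zero_right le_rfl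

theorem isMove_MB_gen (t : ℕ) : IsMove K n e (MB t) (MB t) zero := isMove_zero_right le_rfl

theorem isMove_zero : IsMove K n e zero zero zero := isMove_zero_right le_rfl

theorem isMove_MT_gen (t : ℕ) : IsMove K n e (MT t) (MT t) (MB t) :=
  isMove_of_space (by simp only [dim]; nlinarith) fun q =>
    ⟨q, le_rfl, sub_MT_gen_res X_zero_mem_linForms t⟩

theorem isMove_tube_gen {t : ℕ} (ht : 1 ≤ t) (hte : t ≤ e + 1) :
    IsMove K n e (tube t) (tube t) (flat (t - 1)) :=
  isMove_of_space (by
    obtain ⟨t, rfl⟩ := Nat.exists_eq_add_of_le' ht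
    simp only [dim, Nat.add_sub_cancel]; nlinarith) fun q =>
    ⟨q, le_rfl, sub_tube_gen_res X_zero_mem_linForms ht hte⟩

theorem isMove_tube_zero {t : ℕ} (hte : t ≤ e) : IsMove K n e (tube t) zero (tube t) :=
  isMove_of_space (by simp only [dim]; omega) fun q =>
    ⟨_, by simp only [Piece.space, sub, bot_le],
      by rw [space_insertAt_unitZero]; exact sub_tube_zero_res hte⟩

theorem isMove_flat_zero {t : ℕ} (hte : t ≤ e) : IsMove K n e (flat t) zero (flat t) :=
  isMove_of_space (by simp only [dim]; omega) fun q =>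
    ⟨_, by simp only [Piece.space, sub, bot_le],
      by rw [space_insertAt_unitZero]; exact sub_flat_zero_res hte⟩

theorem isMove_W_gen {k : ℕ} (hn : 1 ≤ n) (hk : 2 ≤ k) :
    IsMove K n e (W k) (W k) (flat (k - 2)) := by
  obtain ⟨k, rfl⟩ := Nat.exists_eq_add_of_le' hk
  obtain ⟨n, rfl⟩ := Nat.exists_eq_add_of_le' hn
  refine isMove_of_space ?_ fun q => ⟨q, le_rfl, ?_⟩
  · simp only [dim]
    rw [show k + 2 - 1 = k + 1 by omega, show k + 2 - 2 = k by omega,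
      show n + 1 + 1 - 1 = n + 1 by omega, show n + 1 - 1 = n by omega]
    nlinarith
  · exact sub_W_gen_res X_zero_mem_linForms k

theorem Piece.fac_congr {A : Type*} {y y' : ℕ → A} (h : ∀ i, i ≠ 1 → y i = y' i) (k : ℕ) :
    fac y k = fac y' k :=
  List.map_congr_left fun j _ => h _ (by omega)

theorem isSpecialMove_W_axis {k : ℕ} (hk : 3 ≤ k) (hke : k ≤ e + 2) :
    IsSpecialMove K n e (W k) (Y k) (tube (k - 2)) := by
  obtain ⟨k, rfl⟩ := Nat.exists_eq_add_of_le' hk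
  refine isSpecialMove_of_space ?_ ?_ fun q hq => ⟨q, ?_, ?_⟩
  · simp only [dim]
    rw [show k + 3 - 1 = k + 2 by omega, show k + 3 - 2 = k + 1 by omega,
      show n + 1 - 1 = n by omega]
    have : e + 1 + n + 2 - (k + 3) + k = e + n := by omega
    nlinarith
  · intro p p' h
    simp only [Piece.space, sub]
    rw [h 0 (by omega), Piece.fac_congr (y' := fun i => lin (p' i)) fun i hi => by rw [h i hi]]
  · exact sub_W_axis_row (by omega) (by simp only [hq, dropZero_unitZero, map_zero])
  · have := sub_W_axis_res (R := linForms K (n + 1)) (e := e) (y := fun i => lin (q i)) k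
    rw [hq, lin_unitZero] at this
    exact this

theorem space_insertPencil (P : Piece) (k : ℕ) (q : ℕ → Fin (n + 1) → K) :
    P.space e (insertAt (fun j => q 0 + (j : K) • q 1) k q) =
      P.sub (linForms K n) e (insertPencil K k fun i => lin (q i)) := by
  unfold Piece.space insertPencil
  congr 1
  funext i
  rw [apply_insertAt (fun v => lin v)]
  simp only [map_add, map_smul]

theorem space_dropZero_insertPencil (P : Piece) (k : ℕ) (q : ℕ → Fin (n + 2) → K) :
    (P.space e fun i => dropZero K n (insertAt (fun j => q 0 + (j : K) • q 1) k q i)) =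
      P.sub (linForms K n) e (insertPencil K k fun i => lin (dropZero K n (q i))) := by
  unfold Piece.space insertPencil
  congr 1
  funext i
  rw [apply_insertAt (fun v => lin (dropZero K n v))]
  simp only [map_add, map_smul]

theorem isSpecialMove_T_axis [CharZero K] {k : ℕ} (hk : 2 ≤ k) (hke : k ≤ e + 1) :
    IsSpecialMove K n e T (MT (e + 2 - k)) (W k) := by
  refine isSpecialMove_of_space ?_ ?_ fun q hq =>
    ⟨insertAt (fun j => q 0 + (j : K) • q 1) k q, ?_, ?_⟩
  · simp only [dim]
    rw [show n + 1 - 1 = n by omega]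
    have : e + 2 - k + (k - 1) = e + 1 := by omega
    nlinarith
  · intro p p' h
    simp only [Piece.space, sub]
    rw [h 0 (by omega), Piece.fac_congr (y' := fun i => lin (p' i)) fun i hi => by rw [h i hi]]
  · rw [space_dropZero_insertPencil]
    exact sub_T_axis_row (by omega) (by omega) (by simp only [hq, dropZero_unitZero, map_zero])
  · have := sub_T_axis_res (R := linForms K (n + 1)) (e := e) (y := fun i => lin (q i)) hk hke
      (lin_mem _)
    rw [hq, lin_unitZero] at this
    rw [space_insertPencil]
    exact this

theorem isSpecialMove_B_axis [CharZero K] {k : ℕ} (hk : 2 ≤ k) (hke : k ≤ e + 2) :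
    IsSpecialMove K n e B (MB (e + 3 - k)) (flat (k - 2)) := by
  refine isSpecialMove_of_space ?_ ?_ fun q hq =>
    ⟨insertAt (fun j => q 0 + (j : K) • q 1) k q, ?_, ?_⟩
  · simp only [dim]
    omega
  · intro p p' h
    simp only [Piece.space, sub]
    rw [h 0 (by omega), Piece.fac_congr (y' := fun i => lin (p' i)) fun i hi => by rw [h i hi]]
  · rw [space_dropZero_insertPencil]
    exact sub_B_axis_row (by omega) (by omega) (by simp only [hq, dropZero_unitZero, map_zero])
  · have := sub_B_axis_res (R := linForms K (n + 1)) (e := e) (y := fun i => lin (q i)) hk hke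
    rw [hq, lin_unitZero] at this
    rw [space_insertPencil]
    exact this

end ConcreteMoves

section BinaryForms

open Piece

variable {K : Type*} [Field K] {A : Type*} [CommRing A] [Algebra K A]

variable (K) in
/-- The parameters `x, y, x + c y, x + (c + 1) y, …`. -/
def pencilParams (c : ℕ) (x y : A) (i : ℕ) : A :=
  if i = 0 then x else if i = 1 then y else x + ((i - 2 + c : ℕ) : K) • y

theorem fac_pencilParams_zero (x y : A) (k : ℕ) :
    fac (pencilParams K 0 x y) k = pencilList K x y k :=
  List.map_congr_left fun j _ => by simp [pencilParams]

theorem cons_fac_pencilParams_one (x y : A) (k : ℕ) :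
    x :: fac (pencilParams K 1 x y) k = pencilList K x y (k + 1) := by
  rw [pencilList, List.range_succ_eq_map, List.map_cons, List.map_map]
  simp only [Nat.cast_zero, zero_smul, add_zero]
  exact congrArg _ (List.map_congr_left fun j _ => by simp [pencilParams])

theorem pow_le_Pd_pencilParams_one [CharZero K] (x y : A) (k : ℕ) :
    ((K ∙ x) ⊔ (K ∙ y)) ^ k ≤ Pd (fac (pencilParams K 1 x y) (k + 1)) := by
  have h : fac (pencilParams K 1 x y) (k + 1) =
      ((1 : K) :: (List.range k).map fun j => ((j + 2 : ℕ) : K)).map fun a => x + a • y := by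
    rw [fac, List.range_succ_eq_map]
    simp [pencilParams, Function.comp_def, add_assoc, one_add_one_eq_two]
  rw [h]
  have := span_pow_le_Pd x y ((List.range k).map fun j => ((j + 2 : ℕ) : K)) 1 (by
    refine List.nodup_cons.2 ⟨?_, List.Nodup.map (fun a b hab => ?_) List.nodup_range⟩
    · simp only [List.mem_map, not_exists, not_and]
      intro j _ hj
      have : j + 2 = 1 := by exact_mod_cast hj
      omega
    · have : a + 2 = b + 2 := by exact_mod_cast hab
      omega)
  simpa using this

theorem pow_le_span_prod_mul_sup [CharZero K] (x y : A) (k : ℕ) :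
    ((K ∙ x) ⊔ (K ∙ y)) ^ (k + 1) ≤
      (K ∙ (fac (pencilParams K 1 x y) k).prod) * ((K ∙ x) ⊔ (K ∙ y)) ⊔
        (K ∙ x ^ 2) * Pd (fac (pencilParams K 1 x y) k) := by
  cases k with
  | zero =>
    refine le_trans (le_of_eq ?_) le_sup_left
    simp [fac, ← Submodule.one_eq_span]
  | succ m =>
    have hPd := pow_le_Pd_pencilParams_one (K := K) x y m
    have hL : fac (pencilParams K 1 x y) (m + 1) =
        ((1 : K) :: (List.range m).map fun j => ((j + 2 : ℕ) : K)).map fun a => x + a • y := by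
      rw [fac, List.range_succ_eq_map]
      simp [pencilParams, Function.comp_def, add_assoc, one_add_one_eq_two]
    obtain ⟨c, hc, hP⟩ := pencil_prod_sub_mem x y
      ((List.range m).map fun j => ((j + 2 : ℕ) : K)) 1 one_ne_zero (by
        intro a ha
        obtain ⟨j, _, rfl⟩ := List.mem_map.1 ha
        exact Nat.cast_ne_zero.2 (by omega))
    rw [← hL, List.length_map, List.length_range] at hP
    generalize fac (pencilParams K 1 x y) (m + 1) = L at hPd hP
    set R := (K ∙ x) ⊔ (K ∙ y) with hR
    set V := (K ∙ L.prod) * R ⊔ (K ∙ x ^ 2) * Pd L with hV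
    have hxR : x ∈ R := Submodule.mem_sup_left (Submodule.mem_span_singleton_self x)
    have hyR : y ∈ R := Submodule.mem_sup_right (Submodule.mem_span_singleton_self y)
    have h1 : (K ∙ x) * ((K ∙ x) * R ^ m) ≤ V := by
      rw [← mul_assoc, ← span_singleton_mul_eq, ← sq]
      exact (mul_le_mul' le_rfl hPd).trans le_sup_right
    have hPR : ∀ z ∈ R, L.prod * z ∈ V := fun z hz => Submodule.mem_sup_left
      (Submodule.mul_mem_mul (Submodule.mem_span_singleton_self _) hz)
    have key : ∀ z ∈ R, z * (L.prod - c • y ^ (m + 1)) ∈ V → z * y ^ (m + 1) ∈ V := by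
      intro z hz h
      have : z * y ^ (m + 1) = c⁻¹ • (L.prod * z - z * (L.prod - c • y ^ (m + 1))) := by
        rw [show L.prod * z - z * (L.prod - c • y ^ (m + 1)) = c • (z * y ^ (m + 1)) by
          rw [← mul_smul_comm]; ring, smul_smul, inv_mul_cancel₀ hc, one_smul]
      rw [this]
      exact V.smul_mem _ (V.sub_mem (hPR z hz) h)
    have h2 : x * y ^ (m + 1) ∈ V := key x hxR
      (h1 (Submodule.mul_mem_mul (Submodule.mem_span_singleton_self x) hP))
    have h3 : (K ∙ x) * R ^ (m + 1) ≤ V := by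
      refine (mul_le_mul' le_rfl (span_pair_pow_succ_le x y m)).trans ?_
      rw [Submodule.mul_sup, ← span_singleton_mul_eq]
      exact sup_le h1 ((Submodule.span_singleton_le_iff_mem _ _).2 h2)
    have h4 : y ^ (m + 1 + 1) ∈ V := by
      rw [pow_succ']
      refine key y hyR (h3 ?_)
      have : (K ∙ x) * R ^ (m + 1) = R * ((K ∙ x) * R ^ m) := by rw [pow_succ]; ring
      rw [this]
      exact Submodule.mul_mem_mul hyR hP
    exact (span_pair_pow_succ_le x y (m + 1)).trans
      (sup_le h3 ((Submodule.span_singleton_le_iff_mem _ _).2 h4))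

/-- Pieces on a line which can be specialized to all forms divisible by a power of a given form. -/
inductive Piece.IsTop (e : ℕ) : Piece → Prop
  | T (h : 1 ≤ e) : IsTop e T
  | B : IsTop e B
  | MT (t : ℕ) (h : 1 ≤ t) (h' : t ≤ e) : IsTop e (MT t)
  | MB (t : ℕ) (h : 1 ≤ t) (h' : t ≤ e + 1) : IsTop e (MB t)
  | Y (k : ℕ) (h : 2 ≤ k) (h' : k ≤ e + 1) : IsTop e (Y k)

theorem Piece.IsTop.exists_le_sub [CharZero K] {e : ℕ} {P : Piece} (hP : P.IsTop e) (x y : A) :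
    ∃ c t, P.dim 1 e = t + 1 ∧ t ≤ e ∧ (K ∙ x ^ (e - t)) * ((K ∙ x) ⊔ (K ∙ y)) ^ t ≤
      P.sub ((K ∙ x) ⊔ (K ∙ y)) e (pencilParams K c x y) := by
  have h0 : ∀ c, pencilParams K c x y 0 = x := fun _ => rfl
  cases hP with
  | T h =>
    refine ⟨0, e, by simp [dim], le_rfl, ?_⟩
    obtain ⟨e, rfl⟩ := Nat.exists_eq_add_of_le' h
    simp only [sub, fac_pencilParams_zero, Nat.sub_self, pow_zero, ← Submodule.one_eq_span, one_mul]
    rw [pow_succ]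
    exact mul_le_mul' (pow_le_Pd_pencilList x y (e + 1) (by omega)) le_rfl
  | B =>
    refine ⟨0, e, by simp [dim], le_rfl, ?_⟩
    simp only [sub, fac_pencilParams_zero, Nat.sub_self, pow_zero, ← Submodule.one_eq_span, one_mul]
    exact pow_le_Pd_pencilList x y (e + 1) (by omega)
  | MT t h h' =>
    refine ⟨1, t, by simp [dim], h', ?_⟩
    simp only [sub, h0, cons_fac_pencilParams_one, Nat.sub_add_cancel h]
    refine mul_le_mul' le_rfl ?_
    calc _ = ((K ∙ x) ⊔ (K ∙ y)) ^ (t - 1) * ((K ∙ x) ⊔ (K ∙ y)) := by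
          rw [← pow_succ, Nat.sub_add_cancel h]
      _ ≤ _ := mul_le_mul' (pow_le_Pd_pencilList x y t h) le_rfl
  | MB t h h' =>
    refine ⟨1, t - 1, by simp [dim, h], by omega, ?_⟩
    simp only [sub, h0, cons_fac_pencilParams_one, Nat.sub_add_cancel h]
    rw [show e - (t - 1) = e + 1 - t by omega]
    exact mul_le_mul' le_rfl (pow_le_Pd_pencilList x y t h)
  | Y k h h' =>
    refine ⟨1, e + 1 - k + 1, by simp only [dim]; omega, by omega, ?_⟩
    simp only [sub, h0]
    rw [show e - (e + 1 - k + 1) = k - 2 by omega]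
    exact mul_le_mul' le_rfl (pow_le_span_prod_mul_sup x y _)

/-- Pieces on a line which can be specialized to arbitrary monomial intervals. -/
inductive Piece.IsFiller : Piece → Prop
  | tube (t : ℕ) (h : 1 ≤ t) : IsFiller (tube t)
  | flat (t : ℕ) : IsFiller (flat t)
  | zero : IsFiller zero

theorem fac_ite_prod (x y : A) (a b : ℕ) :
    (fac (fun i => if i = 0 then x else if i = 1 then y else if i < a + 2 then x else y)
      (a + b)).prod = x ^ a * y ^ b := by
  rw [fac, List.range_add, List.map_append, List.prod_append, List.map_map]
  congr 1
  · rw [List.map_congr_left (g := fun _ => x) fun j hj => ?_]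
    · simp
    · have := List.mem_range.1 hj
      simp [this]
  · rw [List.map_congr_left (g := fun _ => y) fun j hj => ?_]
    · simp
    · simp

theorem Piece.IsFiller.exists_le_sub {e : ℕ} {P : Piece} (hP : P.IsFiller) (x y : A) (lo : ℕ)
    (h : lo + P.dim 1 e ≤ e + 1) (i : ℕ) (hi : lo ≤ i) (hi' : i < lo + P.dim 1 e) :
    x ^ i * y ^ (e - i) ∈ P.sub ((K ∙ x) ⊔ (K ∙ y)) e
      (fun i => if i = 0 then x else if i = 1 then y else if i < lo + 2 then x else y) := by
  have key : ∀ t, lo + t ≤ e → i ≤ lo + t → x ^ i * y ^ (e - i) ∈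
      (K ∙ (fac (fun i => if i = 0 then x else if i = 1 then y else if i < lo + 2 then x else y)
        (e - t)).prod) * ((K ∙ x) ⊔ (K ∙ y)) ^ t := by
    intro t ht hit
    rw [show e - t = lo + (e - t - lo) by omega, fac_ite_prod]
    have : x ^ i * y ^ (e - i) = x ^ lo * y ^ (e - t - lo) * (x ^ (i - lo) * y ^ (t - (i - lo))) := by
      rw [show e - i = (e - t - lo) + (t - (i - lo)) by omega, pow_add]
      nth_rw 1 [show i = lo + (i - lo) by omega]
      rw [pow_add]
      ring
    rw [this]
    refine Submodule.mul_mem_mul (Submodule.mem_span_singleton_self _) ?_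
    have hp := Submodule.mul_mem_mul
      (Submodule.pow_mem_pow ((K ∙ x) ⊔ (K ∙ y))
        (Submodule.mem_sup_left (Submodule.mem_span_singleton_self x)) (i - lo))
      (Submodule.pow_mem_pow ((K ∙ x) ⊔ (K ∙ y))
        (Submodule.mem_sup_right (Submodule.mem_span_singleton_self y)) (t - (i - lo)))
    rwa [← pow_add, show i - lo + (t - (i - lo)) = t by omega] at hp
  cases hP with
  | tube t ht =>
    simp only [dim, one_mul] at h hi'
    have := key t (by omega) (by omega)
    simp only [sub, if_true, if_false, one_ne_zero]
    rwa [← pow_succ, Nat.sub_add_cancel ht]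
  | flat t =>
    simp only [dim] at h hi'
    exact key t (by omega) (by omega)
  | zero =>
    simp only [dim] at hi'
    omega

end BinaryForms

section BinaryRows

open Piece

variable {K : Type*} [Field K]

theorem linForms_one : linForms K 1 = (K ∙ (X 0 : MvPolynomial (Fin 2) K)) ⊔ (K ∙ X 1) := by
  apply le_antisymm
  · rintro _ ⟨v, rfl⟩
    rw [lin, Fintype.linearCombination_apply, Fin.sum_univ_two]
    exact Submodule.add_mem_sup (Submodule.smul_mem _ _ (Submodule.mem_span_singleton_self _))
      (Submodule.smul_mem _ _ (Submodule.mem_span_singleton_self _))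
  · refine sup_le ?_ ?_ <;>
    · rw [Submodule.span_singleton_le_iff_mem, ← lin_single]
      exact lin_mem _

variable (K) in
/-- Pieces of the given types span all monomials of degree `e` with exponent of `x₀` in
`[lo, lo + N)`. -/
def Covers (e lo N : ℕ) (s : Multiset Piece) : Prop :=
  ∃ m : Multiset (Piece × (ℕ → Fin 2 → K)), m.map Prod.fst = s ∧
    ∀ i, lo ≤ i → i < lo + N →
      (X 0 : MvPolynomial (Fin 2) K) ^ i * X 1 ^ (e - i) ∈ (m.map fun x => x.1.space e x.2).sup

theorem Covers.add {e lo N N' : ℕ} {s s' : Multiset Piece} (h : Covers K e lo N s)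
    (h' : Covers K e (lo + N) N' s') : Covers K e lo (N + N') (s + s') := by
  obtain ⟨m, hm, h⟩ := h
  obtain ⟨m', hm', h'⟩ := h'
  refine ⟨m + m', by simp [hm, hm'], fun i hi hi' => ?_⟩
  rw [Multiset.map_add, Multiset.sup_add]
  by_cases hc : i < lo + N
  · exact Submodule.mem_sup_left (h i hi hc)
  · exact Submodule.mem_sup_right (h' i (by omega) (by omega))

theorem covers_single {e lo N : ℕ} {P : Piece} (q : ℕ → Fin 2 → K)
    (h : ∀ i, lo ≤ i → i < lo + N →
      (X 0 : MvPolynomial (Fin 2) K) ^ i * X 1 ^ (e - i) ∈ P.space e q) : Covers K e lo N {P} :=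
  ⟨{(P, q)}, by simp, by simpa using h⟩

theorem Piece.IsFiller.covers {e : ℕ} {P : Piece} (hP : P.IsFiller) (lo : ℕ)
    (h : lo + P.dim 1 e ≤ e + 1) : Covers K e lo (P.dim 1 e) {P} := by
  refine covers_single (fun i => if i = 0 then Pi.single 0 1 else if i = 1 then Pi.single 1 1 else
    if i < lo + 2 then Pi.single 0 1 else Pi.single 1 1) fun i hi hi' => ?_
  have := hP.exists_le_sub (K := K) (X 0 : MvPolynomial (Fin 2) K) (X 1) lo h i hi hi'
  unfold Piece.space
  rw [linForms_one]
  convert this using 2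
  funext j
  simp only [apply_ite lin, lin_single]

theorem lin_pencilParams (c : ℕ) (u v : Fin 2 → K) (i : ℕ) :
    lin (pencilParams K c u v i) = pencilParams K c (lin u) (lin v) i := by
  simp only [pencilParams, apply_ite lin, map_add, map_smul]

theorem Piece.IsTop.covers_top [CharZero K] {e : ℕ} {P : Piece} (hP : P.IsTop e) (lo : ℕ)
    (hlo : lo + P.dim 1 e = e + 1) : Covers K e lo (P.dim 1 e) {P} := by
  obtain ⟨c, t, hd, ht, h⟩ := hP.exists_le_sub (K := K) (X 0 : MvPolynomial (Fin 2) K) (X 1)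
  refine covers_single (pencilParams K c (Pi.single 0 1) (Pi.single 1 1)) fun i hi hi' => ?_
  unfold Piece.space
  simp only [linForms_one, lin_pencilParams, lin_single]
  refine h ?_
  have : (X 0 : MvPolynomial (Fin 2) K) ^ i * X 1 ^ (e - i) =
      X 0 ^ (e - t) * (X 0 ^ (i - (e - t)) * X 1 ^ (e - i)) := by
    rw [← mul_assoc, ← pow_add]
    congr 2
    omega
  rw [this]
  refine Submodule.mul_mem_mul (Submodule.mem_span_singleton_self _) ?_
  rw [show t = (i - (e - t)) + (e - i) by omega, pow_add]
  rw [show i - (e - (i - (e - t) + (e - i))) = i - (e - t) by omega]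
  exact Submodule.mul_mem_mul
    (Submodule.pow_mem_pow _ (Submodule.mem_sup_left (Submodule.mem_span_singleton_self _)) _)
    (Submodule.pow_mem_pow _ (Submodule.mem_sup_right (Submodule.mem_span_singleton_self _)) _)

theorem Piece.IsTop.covers_bottom [CharZero K] {e : ℕ} {P : Piece} (hP : P.IsTop e) :
    Covers K e 0 (P.dim 1 e) {P} := by
  obtain ⟨c, t, hd, ht, h⟩ := hP.exists_le_sub (K := K) (X 1 : MvPolynomial (Fin 2) K) (X 0)
  refine covers_single (pencilParams K c (Pi.single 1 1) (Pi.single 0 1)) fun i hi hi' => ?_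
  unfold Piece.space
  simp only [linForms_one, lin_pencilParams, lin_single]
  rw [sup_comm]
  refine h ?_
  have : (X 0 : MvPolynomial (Fin 2) K) ^ i * X 1 ^ (e - i) =
      X 1 ^ (e - t) * (X 1 ^ (t - i) * X 0 ^ i) := by
    rw [← mul_assoc, ← pow_add, mul_comm]
    congr 2
    omega
  rw [this]
  refine Submodule.mul_mem_mul (Submodule.mem_span_singleton_self _) ?_
  have hp := Submodule.mul_mem_mul
    (Submodule.pow_mem_pow ((K ∙ (X 1 : MvPolynomial (Fin 2) K)) ⊔ (K ∙ X 0))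
      (Submodule.mem_sup_left (Submodule.mem_span_singleton_self _)) (t - i))
    (Submodule.pow_mem_pow ((K ∙ (X 1 : MvPolynomial (Fin 2) K)) ⊔ (K ∙ X 0))
      (Submodule.mem_sup_right (Submodule.mem_span_singleton_self _)) i)
  rwa [← pow_add, show t - i + i = t by omega] at hp

theorem covers_fillers {e : ℕ} (s : Multiset Piece) (hs : ∀ P ∈ s, P.IsFiller) (lo : ℕ)
    (h : lo + (s.map (dim 1 e)).sum ≤ e + 1) : Covers K e lo (s.map (dim 1 e)).sum s := by
  induction s using Multiset.induction generalizing lo with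
  | empty => exact ⟨0, by simp, fun i hi hi' => by simp at hi'; omega⟩
  | cons P s ih =>
    simp only [Multiset.map_cons, Multiset.sum_cons] at h ⊢
    have h1 := (hs P (Multiset.mem_cons_self _ _)).covers (K := K) (e := e) lo (by omega)
    have h2 := ih (fun Q hQ => hs Q (Multiset.mem_cons_of_mem hQ)) (lo + P.dim 1 e) (by omega)
    exact h1.add h2

theorem Covers.goodM_add {e N lo N' : ℕ} {s s' : Multiset Piece} (h : Covers K e 0 N s)
    (h' : Covers K e lo N' s') (hN : N ≤ lo) (hd : (s.map (dim 1 e)).sum ≤ N)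
    (hd' : (s'.map (dim 1 e)).sum ≤ N') : GoodM K 1 e (s + s') := by
  obtain ⟨m, hm, h⟩ := h
  obtain ⟨m', hm', h'⟩ := h'
  refine ⟨m + m', by simp [hm, hm'], ?_⟩
  let I : Finset ℕ := Finset.range N ∪ Finset.Ico lo (lo + N')
  have hI : I.card = N + N' := by
    rw [Finset.card_union_of_disjoint]
    · simp
    · rw [Finset.disjoint_left]
      intro i hi hi'
      simp at hi hi'
      omega
  have hli : LinearIndependent K fun i : I =>
      (X 0 : MvPolynomial (Fin 2) K) ^ (i : ℕ) * X 1 ^ (e - i) := by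
    have h1 := (basisMonomials (Fin 2) K).linearIndependent.comp
      (fun i : I => Finsupp.single 0 (i : ℕ) + Finsupp.single 1 (e - i)) (by
        intro i j hij
        have := DFunLike.congr_fun hij 0
        simp at this
        exact this)
    have h2 : (fun i : I => (X 0 : MvPolynomial (Fin 2) K) ^ (i : ℕ) * X 1 ^ (e - i)) =
        ⇑(basisMonomials (Fin 2) K) ∘
          fun i : I => Finsupp.single 0 (i : ℕ) + Finsupp.single 1 (e - i) := by
      funext i
      simp [X_pow_eq_monomial]
    rw [h2]
    exact h1
  have key := RankGE.of_fintype (W := ((m + m').map fun x => x.1.space e x.2).sup) _ hli fun i => by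
    rw [Multiset.map_add, Multiset.sup_add]
    have hi := i.2
    rcases Finset.mem_union.1 hi with hi | hi
    · exact Submodule.mem_sup_left (h i (Nat.zero_le _) (by simpa using hi))
    · exact Submodule.mem_sup_right (h' i (Finset.mem_Ico.1 hi).1 (Finset.mem_Ico.1 hi).2)
  rw [Fintype.card_coe, hI] at key
  exact key.mono (by simp only [Multiset.map_add, Multiset.sum_add]; omega) le_rfl

theorem goodM_row [CharZero K] {e : ℕ} {a b : Piece} {s : Multiset Piece}
    (ha : a.IsTop e ∨ a.IsFiller) (hb : b.IsTop e ∨ b.IsFiller) (hs : ∀ P ∈ s, P.IsFiller)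
    (h : a.dim 1 e + b.dim 1 e + (s.map (dim 1 e)).sum ≤ e + 1) :
    GoodM K 1 e (a ::ₘ b ::ₘ s) := by
  have hA : Covers K e 0 (a.dim 1 e) {a} := by
    rcases ha with ha | ha
    · exact ha.covers_bottom
    · exact ha.covers 0 (by omega)
  have hS := covers_fillers (K := K) (e := e) s hs (a.dim 1 e) (by omega)
  have hB : Covers K e (e + 1 - b.dim 1 e) (b.dim 1 e) {b} := by
    rcases hb with hb | hb
    · exact hb.covers_top _ (by omega)
    · exact hb.covers _ (by omega)
  have hAS := hA.add (by rwa [Nat.zero_add])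
  have := hAS.goodM_add hB (by omega) (by simp) (by simp)
  convert this using 1
  rw [add_comm, Multiset.singleton_add, Multiset.singleton_add, Multiset.cons_swap]

end BinaryRows

section DegreeZero

open Piece

variable {K : Type*} [Field K] {n : ℕ}

theorem goodM_nil {e : ℕ} : GoodM K n e 0 := ⟨0, rfl, RankGE.zero _⟩

theorem goodM_singleton_of_one_mem {P : Piece} (hd : P.dim n 0 = 1)
    (h : 1 ∈ P.space (K := K) (n := n) 0 fun _ => 0) : GoodM K n 0 {P} := by
  refine ⟨{(P, fun _ => 0)}, rfl, ?_⟩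
  rw [Multiset.map_singleton, Multiset.sum_singleton, hd]
  exact ⟨fun _ => 1, LinearIndependent.of_subsingleton 0 one_ne_zero, fun _ => by simpa using h⟩

theorem goodM_flat_degree_zero : GoodM K n 0 {flat 0} :=
  goodM_singleton_of_one_mem rfl (by
    simp [Piece.space, Piece.sub, fac, ← Submodule.one_eq_span, Submodule.one_le.1 le_rfl])

theorem goodM_B_degree_zero : GoodM K n 0 {B} :=
  goodM_singleton_of_one_mem rfl (by
    simp [Piece.space, Piece.sub, fac, Pd, ← Submodule.one_eq_span, Submodule.one_le.1 le_rfl])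

end DegreeZero

section Planar

open Piece Multiset

variable {K : Type*} [Field K] [CharZero K] {e : ℕ}

/-- The configuration with `α` pieces `T`, `β` pieces `B`, `γ` pieces `tube 1` and `δ` pieces
`flat 0`. -/
def cfg (α β γ δ : ℕ) : Multiset Piece :=
  replicate α T + replicate β B + replicate γ (tube 1) + replicate δ (flat 0)

theorem goodM_step_two {a b c a' b' c' : Piece} {α β γ δ x y : ℕ}
    (ha : IsSpecialMove K 1 e a b c) (ha' : IsMove K 1 e a' b' c')
    (hb : b.IsTop (e + 1) ∨ b.IsFiller) (hb' : b'.IsTop (e + 1) ∨ b'.IsFiller)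
    (he : 1 ≤ e ∨ γ = 0)
    (hlen : b.dim 1 (e + 1) + b'.dim 1 (e + 1) + 2 * α + β + 2 * x + y ≤ e + 2)
    (hU : GoodM K 2 e (c ::ₘ c' ::ₘ cfg α β γ (x + δ))) :
    GoodM K 2 (e + 1) (a ::ₘ a' ::ₘ cfg α β (x + γ) (y + δ)) := by
  have hγ : Moves K 1 e (replicate γ (tube 1)) (replicate γ zero) (replicate γ (tube 1)) := by
    rcases he with he | rfl
    · exact Moves.replicate (isMove_tube_zero he) γ
    · exact Moves.nil
  have hm := Moves.cons ha' (((((Moves.replicate (isMove_T_idle (K := K) (n := 1) (e := e)) α).add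
    (Moves.replicate isMove_B_idle β)).add
    (Moves.replicate (isMove_tube_gen (t := 1) le_rfl (by omega)) x)).add hγ).add
    ((Moves.replicate (isMove_flat_gen 0) y).add
      (Moves.replicate (isMove_flat_zero (t := 0) (Nat.zero_le _)) δ)))
  have hS : cfg α β (x + γ) (y + δ) = replicate α T + replicate β B + replicate x (tube 1) +
      replicate γ (tube 1) + (replicate y (flat 0) + replicate δ (flat 0)) := by
    simp only [cfg, replicate_add]
    abel
  rw [hS]
  refine GoodM.step_special ha hm ?_ ?_
  · refine goodM_row hb hb' ?_ ?_
    · intro P hP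
      simp only [mem_add, mem_replicate] at hP
      rcases hP with (((⟨_, rfl⟩ | ⟨_, rfl⟩) | ⟨_, rfl⟩) | ⟨_, rfl⟩) | (⟨_, rfl⟩ | ⟨_, rfl⟩)
      · exact IsFiller.tube 1 le_rfl
      · exact IsFiller.flat 0
      · exact IsFiller.tube 1 le_rfl
      · exact IsFiller.zero
      · exact IsFiller.flat 0
      · exact IsFiller.zero
    · simp only [Multiset.map_add, map_replicate, sum_add, sum_replicate, smul_eq_mul]
      have h₁ : dim 1 (e + 1) (tube 1) = 2 := rfl
      have h₂ : dim 1 (e + 1) (flat 0) = 1 := rfl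
      have h₃ : dim 1 (e + 1) zero = 0 := rfl
      rw [h₁, h₂, h₃]
      omega
  · have := hU.add_zeros y
    convert this using 1
    simp only [cfg, replicate_add, cons_add]
    rw [show 1 - 1 = 0 from rfl]
    congr 2
    abel

theorem goodM_step_special {a b c : Piece} {α β γ δ x y : ℕ}
    (ha : IsSpecialMove K 1 e a b c) (hb : b.IsTop (e + 1) ∨ b.IsFiller) (he : 1 ≤ e ∨ γ = 0)
    (hlen : b.dim 1 (e + 1) + 2 * α + β + 2 * x + y ≤ e + 2)
    (hU : GoodM K 2 e (c ::ₘ cfg α β γ (x + δ))) :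
    GoodM K 2 (e + 1) (a ::ₘ cfg α β (x + γ) (y + δ)) := by
  refine GoodM.of_zero_cons ?_
  rw [cons_swap]
  refine goodM_step_two ha isMove_zero hb (Or.inr IsFiller.zero) he (by simpa [dim] using hlen) ?_
  rw [cons_swap]
  exact hU.zero_cons

theorem goodM_step {a b c : Piece} {α β γ δ x y : ℕ}
    (ha : IsMove K 1 e a b c) (hb : b.IsTop (e + 1) ∨ b.IsFiller) (he : 1 ≤ e ∨ γ = 0)
    (hlen : b.dim 1 (e + 1) + 2 * α + β + 2 * x + y ≤ e + 2)
    (hU : GoodM K 2 e (c ::ₘ cfg α β γ (x + δ))) :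
    GoodM K 2 (e + 1) (a ::ₘ cfg α β (x + γ) (y + δ)) :=
  (goodM_step_two isSpecialMove_zero ha (Or.inr IsFiller.zero) hb he (by simpa [dim] using hlen)
    hU.zero_cons).of_zero_cons

theorem exists_fill (γ δ u : ℕ) : ∃ x y γ' δ', γ = x + γ' ∧ δ = y + δ' ∧ 2 * x + y ≤ u ∧
    (γ' = 0 ∨ u / 2 ≤ x) ∧ (2 * x + y = u ∨ (γ' = 0 ∧ δ' = 0) ∨ (2 * x + 1 = u ∧ δ = 0)) := by
  by_cases h : γ ≤ u / 2
  · by_cases h' : δ ≤ u - 2 * γ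
    · exact ⟨γ, δ, 0, 0, by omega⟩
    · exact ⟨γ, u - 2 * γ, 0, δ - (u - 2 * γ), by omega⟩
  · by_cases h' : δ ≤ u - 2 * (u / 2)
    · exact ⟨u / 2, δ, γ - u / 2, 0, by omega⟩
    · exact ⟨u / 2, u - 2 * (u / 2), γ - u / 2, δ - (u - 2 * (u / 2)), by omega⟩

theorem cfg_succ_left (α β γ δ : ℕ) : cfg (α + 1) β γ δ = T ::ₘ cfg α β γ δ := by
  simp [cfg, replicate_succ]

theorem cfg_zero_succ (β γ δ : ℕ) : cfg 0 (β + 1) γ δ = B ::ₘ cfg 0 β γ δ := by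
  simp [cfg, replicate_succ]

theorem goodM_T_steps {α β x₀ y₀ γ₁ δ₁ x₁ y₁ γ₂ δ₂ : ℕ} (hc : 2 * α + β ≤ e)
    (h₀ : 2 * x₀ + y₀ + 4 * α + 2 * β ≤ e + 3)
    (h₁ : 2 * x₁ + y₁ + 4 * α + 2 * β ≤ e + 2) (hγ : γ₁ = x₁ + γ₂) (hδ : x₀ + δ₁ = y₁ + δ₂)
    (he : 1 ≤ e ∨ γ₂ = 0) (hU : GoodM K 2 e (cfg α β γ₂ (x₁ + δ₂))) :
    GoodM K 2 (e + 4) (cfg (α + 1) β (x₀ + γ₁) (y₀ + δ₁)) := by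
  obtain ⟨r, hr⟩ := Nat.exists_eq_add_of_le hc
  rw [cfg_succ_left]
  have hax := isSpecialMove_T_axis (K := K) (n := 1) (e := e + 3) (k := r + 4) (by omega) (by omega)
  rw [show e + 3 + 2 - (r + 4) = 2 * α + β + 1 by omega] at hax
  refine goodM_step_special hax (Or.inl (IsTop.MT _ (by omega) (by omega))) (by omega)
    (by simp only [dim]; omega) ?_
  rw [hγ, hδ]
  refine goodM_step_special (e := e + 2) (isSpecialMove_W_axis (by omega) (by omega))
    (Or.inl (IsTop.Y _ (by omega) (by omega))) (by omega) (by simp only [dim]; omega) ?_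
  rw [show r + 4 - 2 = r + 2 by omega, ← Nat.zero_add γ₂, ← Nat.zero_add (x₁ + δ₂)]
  refine goodM_step (e := e + 1) (isMove_tube_gen (by omega) (by omega))
    (Or.inr (IsFiller.tube _ (by omega))) (by omega) (by simp only [dim]; omega) ?_
  rw [show r + 2 - 1 = r + 1 by omega, ← Nat.zero_add γ₂]
  exact goodM_step (isMove_flat_gen _) (Or.inr (IsFiller.flat _)) he (by simp only [dim]; omega)
    (GoodM.zero_cons (by simpa using hU))

theorem goodM_B_steps {β x y γ δ : ℕ} (hc : β ≤ e) (h : 2 * x + y + 2 * β ≤ e + 2)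
    (he : 1 ≤ e ∨ γ = 0) (hU : GoodM K 2 e (cfg 0 β γ (x + δ))) :
    GoodM K 2 (e + 2) (cfg 0 (β + 1) (x + γ) (y + δ)) := by
  obtain ⟨r, hr⟩ := Nat.exists_eq_add_of_le hc
  rw [cfg_zero_succ]
  have hax := isSpecialMove_B_axis (K := K) (n := 1) (e := e + 1) (k := r + 3) (by omega) (by omega)
  rw [show e + 1 + 3 - (r + 3) = β + 1 by omega, show r + 3 - 2 = r + 1 by omega] at hax
  refine goodM_step_special hax (Or.inl (IsTop.MB _ (by omega) (by omega))) (by omega)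
    (by simp only [dim]; omega) ?_
  rw [← Nat.zero_add γ, ← Nat.zero_add (x + δ)]
  exact goodM_step (isMove_flat_gen _) (Or.inr (IsFiller.flat _)) he (by simp only [dim]; omega)
    (GoodM.zero_cons (by simpa using hU))

theorem goodM_step_fill {x y γ δ : ℕ} (h : 2 * x + y ≤ e + 2)
    (he : 1 ≤ e ∨ γ = 0) (hU : GoodM K 2 e (cfg 0 0 γ (x + δ))) :
    GoodM K 2 (e + 1) (cfg 0 0 (x + γ) (y + δ)) :=
  (goodM_step isMove_zero (Or.inr IsFiller.zero) he (by simp only [dim]; omega)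
    hU.zero_cons).of_zero_cons

theorem goodM_planar (e α β γ δ v : ℕ) (hv : v + 4 * α + 2 * β = e + 2) (hv2 : 2 ≤ v)
    (hcap : 2 * (3 * γ + δ) ≤ (e + 1) * v + 2 * α)
    (H : γ = 0 ∨ 1 ≤ δ ∨ 2 * (3 * γ + δ) + 2 ≤ (e + 1) * v + 2 * α ∨
      (α = 0 ∧ 1 ≤ β ∧ Even e) ∨ (α = 0 ∧ β = 0 ∧ Odd e)) :
    GoodM K 2 e (cfg α β γ δ) := by
  induction e using Nat.strong_induction_on generalizing α β γ δ v with
  | _ e ih =>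
  rcases Nat.eq_zero_or_pos α with rfl | hα
  · rcases Nat.eq_zero_or_pos β with rfl | hβ
    · obtain rfl : v = e + 2 := by omega
      rcases e with _ | e
      · obtain rfl : γ = 0 := by omega
        obtain rfl | rfl : δ = 0 ∨ δ = 1 := by omega
        · exact goodM_nil
        · exact goodM_flat_degree_zero
      · obtain ⟨x, y, γ', δ', rfl, rfl, hu, hx, hf⟩ := exists_fill γ δ (e + 2)
        have hprod : (e + 1 + 1) * (e + 1 + 2) = (e + 1) * (e + 2) + 2 * (e + 2) := by ring
        have hprod' : e + 2 ≤ (e + 1) * (e + 2) := by nlinarith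
        have hcap' : 2 * (3 * γ' + (x + δ')) ≤ (e + 1) * (e + 2) + 2 * 0 := by
          rcases hf with hf | hf | ⟨hf, hf'⟩
          · omega
          · omega
          · rcases H with H | H | H | H | ⟨_, _, H⟩
            · omega
            · omega
            · omega
            · omega
            · obtain ⟨k, hk⟩ := H
              omega
        refine goodM_step_fill hu ?_ (ih e (by omega) 0 0 _ _ (e + 2) (by omega) (by omega) hcap' ?_)
        · rcases e with _ | e
          · omega
          · omega
        · omega
    · obtain ⟨β, rfl⟩ := Nat.exists_eq_add_of_le' hβ
      obtain ⟨e, rfl⟩ := Nat.exists_eq_add_of_le' (show 2 ≤ e by omega)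
      obtain ⟨x, y, γ', δ', rfl, rfl, hu, hx, hf⟩ := exists_fill γ δ v
      have hprod : (e + 2 + 1) * v = (e + 1) * v + 2 * v := by ring
      have hprod' : v ≤ (e + 1) * v := by nlinarith
      have hcap' : 2 * (3 * γ' + (x + δ')) ≤ (e + 1) * v + 2 * 0 := by
        rcases hf with hf | hf | ⟨hf, hf'⟩
        · omega
        · omega
        · rcases H with H | H | H | ⟨_, _, H⟩ | H
          · omega
          · omega
          · omega
          · obtain ⟨k, hk⟩ := H
            omega
          · omega
      refine goodM_B_steps (by omega) (by omega) ?_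
        (ih e (by omega) 0 β _ _ v (by omega) (by omega) hcap' (by omega))
      rcases e with _ | e
      · obtain rfl : v = 2 := by omega
        omega
      · omega
  · obtain ⟨α, rfl⟩ := Nat.exists_eq_add_of_le' hα
    obtain ⟨e, rfl⟩ := Nat.exists_eq_add_of_le' (show 4 ≤ e by omega)
    obtain ⟨x₀, y₀, γ₁, δ₁, rfl, rfl, hu₀, hx₀, hf₀⟩ := exists_fill γ δ (v + 1)
    obtain ⟨x₁, y₁, γ₂, δ₂, hγ, hδ, hu₁, hx₁, hf₁⟩ := exists_fill γ₁ (x₀ + δ₁) v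
    have hprod : (e + 4 + 1) * v = (e + 1) * v + 4 * v := by ring
    have hprod' : v ≤ (e + 1) * v := by nlinarith
    have hcap₁ : 2 * (3 * γ₁ + (x₀ + δ₁)) ≤ (e + 1) * v + 2 * v + 2 * α := by
      omega
    have hcap' : 2 * (3 * γ₂ + (x₁ + δ₂)) ≤ (e + 1) * v + 2 * α := by
      omega
    refine goodM_T_steps (by omega) (by omega) (by omega) hγ hδ ?_
      (ih e (by omega) α β _ _ v (by omega) (by omega) hcap' (by omega))
    rcases e with _ | e
    · obtain rfl : v = 2 := by omega
      omega
    · omega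

end Planar

section Space

open Piece Multiset

variable {K : Type*} [Field K] [CharZero K] {n e : ℕ}

theorem goodM_step_TB_two {a b c a' b' c' : Piece} {p q r t : ℕ}
    (ha : IsSpecialMove K n e a b c) (ha' : IsMove K n e a' b' c')
    (hR : GoodM K n (e + 1) (b ::ₘ b' ::ₘ cfg p r q t))
    (hU : GoodM K (n + 1) e (c ::ₘ c' ::ₘ cfg q (p + t) 0 0)) :
    GoodM K (n + 1) (e + 1) (a ::ₘ a' ::ₘ cfg (p + q) (r + t) 0 0) := by
  have hm := Moves.cons ha' (((Moves.replicate (isMove_T_gen (K := K) (n := n) (e := e)) p).add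
    (Moves.replicate isMove_B_gen r)).add ((Moves.replicate isMove_T_idle q).add
    (Moves.replicate isMove_B_idle t)))
  have hS : cfg (p + q) (r + t) 0 0 = replicate p T + replicate r B +
      (replicate q T + replicate t B) := by
    simp only [cfg, replicate_add, replicate_zero]
    abel
  rw [hS]
  refine GoodM.step_special ha hm ?_ ?_
  · rwa [← add_assoc]
  · convert hU.add_zeros r using 1
    simp only [cfg, replicate_add, replicate_zero, cons_add]
    congr 2
    abel

theorem goodM_step_TB_special {a b c : Piece} {p q r t : ℕ} (ha : IsSpecialMove K n e a b c)
    (hR : GoodM K n (e + 1) (b ::ₘ cfg p r q t))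
    (hU : GoodM K (n + 1) e (c ::ₘ cfg q (p + t) 0 0)) :
    GoodM K (n + 1) (e + 1) (a ::ₘ cfg (p + q) (r + t) 0 0) := by
  refine GoodM.of_zero_cons ?_
  rw [cons_swap]
  refine goodM_step_TB_two ha isMove_zero ?_ ?_
  · rw [cons_swap]
    exact hR.zero_cons
  · rw [cons_swap]
    exact hU.zero_cons

theorem goodM_step_TB_cons {a b c : Piece} {p q r t : ℕ} (ha : IsMove K n e a b c)
    (hR : GoodM K n (e + 1) (b ::ₘ cfg p r q t))
    (hU : GoodM K (n + 1) e (c ::ₘ cfg q (p + t) 0 0)) :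
    GoodM K (n + 1) (e + 1) (a ::ₘ cfg (p + q) (r + t) 0 0) :=
  (goodM_step_TB_two isSpecialMove_zero ha hR.zero_cons hU.zero_cons).of_zero_cons

theorem goodM_step_TB {p q r t : ℕ} (hR : GoodM K n (e + 1) (cfg p r q t))
    (hU : GoodM K (n + 1) e (cfg q (p + t) 0 0)) :
    GoodM K (n + 1) (e + 1) (cfg (p + q) (r + t) 0 0) :=
  (goodM_step_TB_cons isMove_zero hR.zero_cons hU.zero_cons).of_zero_cons

theorem goodM_step_TB_of (p q r t : ℕ) {α β β' : ℕ} (hα : α = p + q) (hβ : β = r + t)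
    (hβ' : β' = p + t) (hR : GoodM K n (e + 1) (cfg p r q t))
    (hU : GoodM K (n + 1) e (cfg q β' 0 0)) : GoodM K (n + 1) (e + 1) (cfg α β 0 0) := by
  subst hα hβ hβ'
  exact goodM_step_TB hR hU

theorem goodM_step_TB_cons_of (p q r t : ℕ) {a b c : Piece} {α β β' : ℕ}
    (ha : IsMove K n e a b c) (hα : α = p + q) (hβ : β = r + t) (hβ' : β' = p + t)
    (hR : GoodM K n (e + 1) (b ::ₘ cfg p r q t))
    (hU : GoodM K (n + 1) e (c ::ₘ cfg q β' 0 0)) :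
    GoodM K (n + 1) (e + 1) (a ::ₘ cfg α β 0 0) := by
  subst hα hβ hβ'
  exact goodM_step_TB_cons ha hR hU

theorem goodM_single_B (n e : ℕ) : GoodM K (n + 1) e (cfg 0 1 0 0) := by
  induction n with
  | zero =>
    refine GoodM.of_zero_cons ?_
    rw [cfg_zero_succ]
    exact goodM_row (Or.inr IsFiller.zero) (Or.inl IsTop.B) (by simp [cfg]) (by simp [cfg, dim])
  | succ n ih =>
    cases e with
    | zero => simpa [cfg] using goodM_B_degree_zero (K := K) (n := n + 2)
    | succ e => exact goodM_step_TB_of 0 0 1 0 rfl rfl (β' := 0) rfl ih goodM_nil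

theorem goodM_single_T (n e : ℕ) : GoodM K (n + 1) (e + 1) (cfg 1 0 0 0) := by
  induction n with
  | zero =>
    refine GoodM.of_zero_cons ?_
    rw [cfg_succ_left]
    exact goodM_row (Or.inr IsFiller.zero) (Or.inl (IsTop.T (by omega))) (by simp [cfg])
      (by simp [cfg, dim])
  | succ n ih =>
    exact goodM_step_TB (p := 1) (q := 0) (r := 0) (t := 0) ih (goodM_single_B _ _)

theorem goodM_step_special_of (x y : ℕ) {a b c : Piece} {α β γ δ γ' δ' : ℕ}
    (ha : IsSpecialMove K 1 e a b c) (hb : b.IsTop (e + 1) ∨ b.IsFiller)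
    (hγ : γ = x + γ') (hδ : δ + x = y + δ') (hy : y ≤ δ) (he : 1 ≤ e ∨ γ' = 0)
    (hlen : b.dim 1 (e + 1) + 2 * α + β + 2 * x + y ≤ e + 2)
    (hU : GoodM K 2 e (c ::ₘ cfg α β γ' δ')) :
    GoodM K 2 (e + 1) (a ::ₘ cfg α β γ δ) := by
  obtain ⟨z, rfl⟩ := Nat.exists_eq_add_of_le hy
  obtain rfl : δ' = x + z := by omega
  rw [hγ]
  exact goodM_step_special ha hb he hlen hU

theorem goodM_step_of (x y : ℕ) {a b c : Piece} {α β γ δ γ' δ' : ℕ}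
    (ha : IsMove K 1 e a b c) (hb : b.IsTop (e + 1) ∨ b.IsFiller)
    (hγ : γ = x + γ') (hδ : δ + x = y + δ') (hy : y ≤ δ) (he : 1 ≤ e ∨ γ' = 0)
    (hlen : b.dim 1 (e + 1) + 2 * α + β + 2 * x + y ≤ e + 2)
    (hU : GoodM K 2 e (c ::ₘ cfg α β γ' δ')) :
    GoodM K 2 (e + 1) (a ::ₘ cfg α β γ δ) := by
  obtain ⟨z, rfl⟩ := Nat.exists_eq_add_of_le hy
  obtain rfl : δ' = x + z := by omega
  rw [hγ]
  exact goodM_step ha hb he hlen hU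

/-! Planar configurations for blocks of even size `2 c + 2`. -/

theorem goodM_plane_MT_even (c N : ℕ) (hN : N = (c + 1) * (2 * c + 1)) :
    GoodM K 2 (6 * c + 5) (MT (2 * c + 2) ::ₘ cfg (c + 1) 0 (N + c) 0) := by
  rcases Nat.eq_zero_or_pos c with rfl | hc
  · obtain rfl : N = 1 := by omega
    refine goodM_step_of 0 0 (isMove_MT_gen _) (Or.inl (IsTop.MT _ (by omega) (by omega)))
      (γ' := 1) (δ' := 0) rfl rfl le_rfl (by omega) (by simp only [dim]; omega) ?_
    refine goodM_step_of (e := 3) 0 0 (isMove_MB_gen _)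
      (Or.inl (IsTop.MB _ (by omega) (by omega)))
      (γ' := 1) (δ' := 0) rfl rfl le_rfl (by omega) (by simp only [dim]; omega) (GoodM.zero_cons ?_)
    rw [cfg_succ_left]
    refine goodM_step_of (e := 2) 0 0 isMove_T_gen (Or.inl (IsTop.T (by omega)))
      (γ' := 1) (δ' := 0) rfl rfl le_rfl (by omega) (by simp only [dim]; omega) ?_
    refine goodM_step_of (e := 1) 0 0 isMove_B_gen (Or.inl IsTop.B)
      (γ' := 1) (δ' := 0) rfl rfl le_rfl (by omega) (by simp only [dim]; omega) (GoodM.zero_cons ?_)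
    exact goodM_planar 1 0 0 1 0 3 (by omega) (by omega) (by omega) (by decide)
  · obtain ⟨c, rfl⟩ := Nat.exists_eq_add_of_le' hc
    obtain ⟨γ, hγ⟩ : ∃ γ, N = c + 1 + γ := Nat.exists_eq_add_of_le (by nlinarith)
    refine goodM_step_of (c + 1) 0 (isMove_MT_gen _) (Or.inl (IsTop.MT _ (by omega) (by omega)))
      (γ' := N) (δ' := c + 1) (by omega) (by omega) le_rfl (by omega) (by simp only [dim]; omega) ?_
    refine goodM_step_of (e := 6 * (c + 1) + 3) (c + 1) 1 (isMove_MB_gen _)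
      (Or.inl (IsTop.MB _ (by omega) (by omega)))
      (γ' := γ) (δ' := 2 * c + 1) (by omega) (by omega) (by omega) (by omega)
      (by simp only [dim]; omega) (GoodM.zero_cons ?_)
    exact goodM_planar _ _ _ _ _ (2 * c + 3) (by omega) (by omega) (by nlinarith) (by omega)

theorem goodM_plane_W_even (c N : ℕ) (hN : N = (c + 1) * (2 * c + 1)) :
    GoodM K 2 (6 * c + 4) (W (4 * c + 4) ::ₘ cfg c 0 N (c + 1)) := by
  obtain ⟨γ, hγ⟩ : ∃ γ, N = c + 1 + γ := Nat.exists_eq_add_of_le (by nlinarith)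
  refine goodM_step_special_of (c + 1) 0 (isSpecialMove_W_axis (by omega) (by omega))
    (Or.inl (IsTop.Y _ (by omega) (by omega)))
    (γ' := γ) (δ' := 2 * c + 2) (by omega) (by omega) (by omega) (by omega)
    (by simp only [dim]; omega) ?_
  refine goodM_step_of (e := 6 * c + 2) 0 0 (isMove_tube_gen (by omega) (by omega))
    (Or.inr (IsFiller.tube _ (by omega)))
    (γ' := γ) (δ' := 2 * c + 2) (by omega) (by omega) (by omega) (by omega)
    (by simp only [dim]; omega) ?_
  refine goodM_step_of (e := 6 * c + 1) 0 0 (isMove_flat_gen _) (Or.inr (IsFiller.flat _))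
    (γ' := γ) (δ' := 2 * c + 2) (by omega) (by omega) (by omega) (by omega)
    (by simp only [dim]; omega) (GoodM.zero_cons ?_)
  exact goodM_planar _ _ _ _ _ (2 * c + 3) (by omega) (by omega) (by nlinarith) (by omega)

theorem goodM_plane_flat_even (c N : ℕ) (hN : N = (c + 1) * (2 * c + 1)) :
    GoodM K 2 (6 * c + 3) (flat (4 * c + 2) ::ₘ cfg 0 (2 * c + 1) N 0) := by
  refine goodM_step_of 0 0 (isMove_flat_gen _) (Or.inr (IsFiller.flat _))
    (γ' := N) (δ' := 0) (by omega) (by omega) (by omega) (by omega)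
    (by simp only [dim]; omega) (GoodM.zero_cons ?_)
  exact goodM_planar _ _ _ _ _ (2 * c + 2) (by omega) (by omega) (by nlinarith)
    (Or.inr (Or.inr (Or.inr (Or.inl ⟨rfl, by omega, 3 * c + 1, by ring⟩))))

theorem goodM_block_even (c N : ℕ) (hN : N = (c + 1) * (2 * c + 1))
    (h : GoodM K 3 (6 * c + 2) (cfg N 0 0 0)) :
    GoodM K 3 (6 * c + 5) (cfg (N + 2 * c + 2) 0 0 0) := by
  rw [show N + 2 * c + 2 = (c + 1) + (N + c) + 1 by omega, cfg_succ_left]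
  have hax := isSpecialMove_T_axis (K := K) (n := 2) (e := 6 * c + 4) (k := 4 * c + 4)
    (by omega) (by omega)
  rw [show 6 * c + 4 + 2 - (4 * c + 4) = 2 * c + 2 by omega] at hax
  refine goodM_step_TB_special (r := 0) (t := 0) hax (goodM_plane_MT_even c N hN) ?_
  refine goodM_step_TB_cons_of (e := 6 * c + 3) c N 0 (c + 1) (isMove_W_gen (by omega) (by omega))
    (β' := 2 * c + 1) (by omega) (by omega) (by omega) (goodM_plane_W_even c N hN) ?_
  rw [show 4 * c + 4 - 2 = 4 * c + 2 by omega]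
  exact goodM_step_TB_cons_of (e := 6 * c + 2) 0 N (2 * c + 1) 0 (isMove_flat_gen _)
    (β' := 0) (by omega) (by omega) (by omega) (goodM_plane_flat_even c N hN) h.zero_cons

/-! Planar configurations for blocks of odd size `2 c + 3`. -/

theorem goodM_plane_MT_odd (c N : ℕ) (hN : N = (c + 1) * (2 * c + 3)) :
    GoodM K 2 (6 * c + 8) (MT (4 * c + 5) ::ₘ cfg (c + 1) 0 (N + (c + 1)) 0) := by
  refine goodM_step_of 0 0 (isMove_MT_gen _) (Or.inl (IsTop.MT _ (by omega) (by omega)))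
    (γ' := N + (c + 1)) (δ' := 0) (by omega) (by omega) le_rfl (by omega)
    (by simp only [dim]; omega) ?_
  refine goodM_step_of (e := 6 * c + 6) 0 0 (isMove_MB_gen _)
    (Or.inl (IsTop.MB _ (by omega) (by omega)))
    (γ' := N + (c + 1)) (δ' := 0) (by omega) (by omega) (by omega) (by omega)
    (by simp only [dim]; omega) (GoodM.zero_cons ?_)
  refine goodM_planar _ _ _ _ _ (2 * c + 4) (by omega) (by omega) (by nlinarith)
    (Or.inr (Or.inr (Or.inl (by nlinarith))))

theorem goodM_plane_W_odd (c N : ℕ) (hN : N = (c + 1) * (2 * c + 3)) :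
    GoodM K 2 (6 * c + 7) (W (2 * c + 4) ::ₘ cfg (c + 1) 0 N (c + 1)) := by
  obtain ⟨γ, hγ⟩ : ∃ γ, N = 2 * c + 2 + γ := Nat.exists_eq_add_of_le (by nlinarith)
  refine goodM_step_special_of 0 0 (isSpecialMove_W_axis (by omega) (by omega))
    (Or.inl (IsTop.Y _ (by omega) (by omega)))
    (γ' := N) (δ' := c + 1) (by omega) (by omega) (by omega) (by omega)
    (by simp only [dim]; omega) ?_
  refine goodM_step_of (e := 6 * c + 5) (c + 1) 0 (isMove_tube_gen (by omega) (by omega))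
    (Or.inr (IsFiller.tube _ (by omega)))
    (γ' := c + 1 + γ) (δ' := 2 * c + 2) (by omega) (by omega) (by omega) (by omega)
    (by simp only [dim]; omega) ?_
  refine goodM_step_of (e := 6 * c + 4) (c + 1) 0 (isMove_flat_gen _) (Or.inr (IsFiller.flat _))
    (γ' := γ) (δ' := 3 * c + 3) (by omega) (by omega) (by omega) (by omega)
    (by simp only [dim]; omega) (GoodM.zero_cons ?_)
  exact goodM_planar _ _ _ _ _ (2 * c + 2) (by omega) (by omega) (by nlinarith) (by omega)

theorem goodM_plane_flat_odd (c N : ℕ) (hN : N = (c + 1) * (2 * c + 3)) :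
    GoodM K 2 (6 * c + 6) (flat (2 * c + 2) ::ₘ cfg 0 (2 * c + 2) N 0) := by
  obtain ⟨γ, hγ⟩ : ∃ γ, N = c + 1 + γ := Nat.exists_eq_add_of_le (by nlinarith)
  refine goodM_step_of (c + 1) 0 (isMove_flat_gen _) (Or.inr (IsFiller.flat _))
    (γ' := γ) (δ' := c + 1) (by omega) (by omega) (by omega) (by omega)
    (by simp only [dim]; omega) (GoodM.zero_cons ?_)
  exact goodM_planar _ _ _ _ _ (2 * c + 3) (by omega) (by omega) (by nlinarith) (by omega)

theorem goodM_block_odd (c N : ℕ) (hN : N = (c + 1) * (2 * c + 3))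
    (h : GoodM K 3 (6 * c + 5) (cfg N 0 0 0)) :
    GoodM K 3 (6 * c + 8) (cfg (N + 2 * c + 3) 0 0 0) := by
  rw [show N + 2 * c + 3 = (c + 1) + (N + (c + 1)) + 1 by omega, cfg_succ_left]
  have hax := isSpecialMove_T_axis (K := K) (n := 2) (e := 6 * c + 7) (k := 2 * c + 4)
    (by omega) (by omega)
  rw [show 6 * c + 7 + 2 - (2 * c + 4) = 4 * c + 5 by omega] at hax
  refine goodM_step_TB_special (r := 0) (t := 0) hax (goodM_plane_MT_odd c N hN) ?_
  refine goodM_step_TB_cons_of (e := 6 * c + 6) (c + 1) N 0 (c + 1) (isMove_W_gen (by omega) (by omega))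
    (β' := 2 * c + 2) (by omega) (by omega) (by omega) (goodM_plane_W_odd c N hN) ?_
  rw [show 2 * c + 4 - 2 = 2 * c + 2 by omega]
  exact goodM_step_TB_cons_of (e := 6 * c + 5) 0 N (2 * c + 2) 0 (isMove_flat_gen _)
    (β' := 0) (by omega) (by omega) (by omega) (goodM_plane_flat_odd c N hN) h.zero_cons

theorem goodM_space_triangular (m N : ℕ) (hN : 2 * N = (m + 1) * (m + 2)) :
    GoodM K 3 (3 * m + 2) (cfg N 0 0 0) := by
  induction m generalizing N with
  | zero =>
    obtain rfl : N = 1 := by omega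
    exact goodM_single_T _ _
  | succ m ih =>
    obtain ⟨M, rfl⟩ : ∃ M, N = M + (m + 2) := Nat.exists_eq_add_of_le' (by nlinarith)
    have hM : 2 * M = (m + 1) * (m + 2) := by nlinarith
    have h := ih M hM
    rcases Nat.even_or_odd' m with ⟨c, rfl | rfl⟩
    · rw [show 3 * (2 * c + 1) + 2 = 6 * c + 5 by omega]
      exact goodM_block_even c M (by nlinarith) (by convert h using 1; omega)
    · rw [show 3 * (2 * c + 1 + 1) + 2 = 6 * c + 8 by omega]
      exact goodM_block_odd c M (by nlinarith) (by convert h using 1; omega)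

end Space

section Solid

open Piece Multiset

variable {K : Type*} [Field K] [CharZero K] {n e : ℕ}

theorem goodM_space_B (e s : ℕ) (h : 6 * s ≤ e * (e + 1)) : GoodM K 3 e (cfg 0 s 0 0) := by
  induction e generalizing s with
  | zero =>
    obtain rfl : s = 0 := by omega
    exact goodM_nil
  | succ e ih =>
    obtain ⟨β, δ, rfl, hβ, hδ⟩ : ∃ β δ, s = β + δ ∧ β ≤ (e + 3) / 3 ∧
        (δ = 0 ∨ β = (e + 3) / 3) := by
      rcases le_total s ((e + 3) / 3) with hs | hs
      · exact ⟨s, 0, by omega⟩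
      · exact ⟨(e + 3) / 3, s - (e + 3) / 3, by omega⟩
    refine goodM_step_TB_of 0 0 β δ rfl rfl (β' := δ) (by omega) ?_ (ih δ ?_)
    · have hsmall : 2 * β + 2 ≤ e + 3 := by
        rcases lt_or_ge e 3 with he | he
        · interval_cases e <;> omega
        · omega
      obtain ⟨v, hv⟩ := Nat.exists_eq_add_of_le' hsmall
      have hv3 : e + 1 ≤ 3 * (v + 2) := by omega
      refine goodM_planar _ _ _ _ _ (v + 2) (by omega) (by omega) ?_ (Or.inl rfl)
      nlinarith [Nat.mul_le_mul_left (e + 2) hv3]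
    · rcases hδ with rfl | hδ
      · omega
      · have h3 : e + 1 ≤ 3 * β := by omega
        nlinarith

theorem goodM_space_one_mod_three (m N : ℕ) (hm : 1 ≤ m) (hN : 2 * N = m * (m + 1)) :
    GoodM K 3 (3 * m + 1) (cfg (N + (m + 1) / 2) 0 0 0) := by
  obtain ⟨m, rfl⟩ := Nat.exists_eq_add_of_le' hm
  have h := goodM_space_triangular (K := K) m N (by nlinarith)
  obtain ⟨k, hk⟩ : ∃ k, (m + 1 + 1) / 2 = k := ⟨_, rfl⟩
  obtain ⟨v, hv⟩ : ∃ v, v + 2 + 4 * k = 3 * m + 6 := ⟨3 * m + 4 - 4 * k, by omega⟩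
  obtain ⟨w, hw⟩ : ∃ w, w + 2 + 2 * k = 3 * m + 5 := ⟨3 * m + 3 - 2 * k, by omega⟩
  have hvm : m + 2 ≤ v + 2 := by omega
  have hwm : 2 * m + 3 ≤ w + 2 := by omega
  rw [hk]
  refine goodM_step_TB_of (e := 3 * (m + 1)) k N 0 0 (by omega) rfl (β' := k) rfl ?_ ?_
  · refine goodM_planar _ _ _ _ _ (v + 2) (by omega) (by omega) ?_ (Or.inr (Or.inr (Or.inl ?_)))
    · nlinarith [Nat.mul_le_mul_left (3 * (m + 1) + 1 + 1) hvm]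
    · nlinarith [Nat.mul_le_mul_left (3 * (m + 1) + 1 + 1) hvm]
  · refine goodM_step_TB_of (e := 3 * m + 2) 0 N k 0 (by omega) rfl (β' := 0) rfl ?_ h
    refine goodM_planar _ _ _ _ _ (w + 2) (by omega) (by omega) ?_ (Or.inr (Or.inr (Or.inl ?_)))
    · nlinarith [Nat.mul_le_mul_left (3 * m + 2 + 1 + 1) hwm]
    · nlinarith [Nat.mul_le_mul_left (3 * m + 2 + 1 + 1) hwm]

theorem goodM_space_zero_mod_three (m N : ℕ) (hm : 1 ≤ m) (hN : 2 * N = m * (m + 1)) :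
    GoodM K 3 (3 * m) (cfg N 0 0 0) := by
  obtain ⟨m, rfl⟩ := Nat.exists_eq_add_of_le' hm
  refine goodM_step_TB_of (e := 3 * m + 2) 0 N 0 0 (by omega) rfl (β' := 0) rfl ?_
    (goodM_space_triangular m N (by nlinarith))
  refine goodM_planar _ _ _ _ _ (3 * m + 5) (by omega) (by omega) ?_
    (Or.inr (Or.inr (Or.inl ?_))) <;> nlinarith

theorem goodM_space_zero_mod_six (c N : ℕ) (hN : N = (c + 2) * (2 * c + 3)) :
    GoodM K 3 (6 * c + 12) (cfg (N + 2 * c + 5) 0 0 0) := by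
  have h := goodM_space_triangular (K := K) (2 * c + 2) N (by nlinarith)
  refine goodM_step_TB_of (e := 6 * c + 11) (c + 2) (N + c + 3) 0 0 (by omega) rfl
    (β' := c + 2) rfl ?_ ?_
  · refine goodM_planar _ _ _ _ _ (2 * c + 6) (by omega) (by omega) ?_
      (Or.inr (Or.inr (Or.inl ?_))) <;> nlinarith
  refine goodM_step_TB_of (e := 6 * c + 10) (c + 2) (N + 1) 0 (c + 2) (by omega) (by omega)
    (β' := 2 * c + 4) (by omega) ?_ ?_
  · refine goodM_planar _ _ _ _ _ (2 * c + 5) (by omega) (by omega) (by nlinarith) (by omega)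
  refine goodM_step_TB_of (e := 6 * c + 9) 1 N 2 (2 * c + 2) (by omega) (by omega)
    (β' := 2 * c + 3) (by omega) ?_ ?_
  · refine goodM_planar _ _ _ _ _ (6 * c + 4) (by omega) (by omega) (by nlinarith) (by omega)
  refine goodM_step_TB_of (e := 6 * c + 8) 0 N (2 * c + 3) 0 (by omega) (by omega)
    (β' := 0) (by omega) ?_ ?_
  · refine goodM_planar _ _ _ _ _ (2 * c + 5) (by omega) (by omega) ?_
      (Or.inr (Or.inr (Or.inl ?_))) <;> nlinarith
  · convert h using 1
    omega

/-! The configuration of four pieces `T` of degree `6`. -/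

theorem isSpecialMove_flat_zero {K : Type*} [Field K] {n e t : ℕ} (ht : t ≤ e) :
    IsSpecialMove K n e (flat t) zero (flat t) :=
  ⟨(isMove_flat_zero (K := K) ht).1, fun _ _ _ => rfl, fun q _ => (isMove_flat_zero ht).2 q⟩

theorem goodM_step_two_of (x y : ℕ) {a b c a' b' c' : Piece} {α β γ δ γ' δ' : ℕ}
    (ha : IsSpecialMove K 1 e a b c) (ha' : IsMove K 1 e a' b' c')
    (hb : b.IsTop (e + 1) ∨ b.IsFiller) (hb' : b'.IsTop (e + 1) ∨ b'.IsFiller)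
    (hγ : γ = x + γ') (hδ : δ + x = y + δ') (hy : y ≤ δ) (he : 1 ≤ e ∨ γ' = 0)
    (hlen : b.dim 1 (e + 1) + b'.dim 1 (e + 1) + 2 * α + β + 2 * x + y ≤ e + 2)
    (hU : GoodM K 2 e (c ::ₘ c' ::ₘ cfg α β γ' δ')) :
    GoodM K 2 (e + 1) (a ::ₘ a' ::ₘ cfg α β γ δ) := by
  obtain ⟨z, rfl⟩ := Nat.exists_eq_add_of_le hy
  obtain rfl : δ' = x + z := by omega
  rw [hγ]
  exact goodM_step_two ha ha' hb hb' he hlen hU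

theorem goodM_plane_flat_one : GoodM K 2 1 (flat 1 ::ₘ cfg 0 0 0 1) :=
  goodM_step_of 0 0 (isMove_flat_gen _) (Or.inr (IsFiller.flat _)) (γ' := 0) (δ' := 1)
    (by omega) (by omega) (by omega) (by omega) (by simp [dim])
    (GoodM.zero_cons (goodM_planar _ _ _ _ _ 2 (by omega) (by omega) (by omega) (by omega)))

theorem goodM_plane_flat_tube : GoodM K 2 2 (flat 1 ::ₘ cfg 0 0 1 0) :=
  goodM_step_of 1 0 (isMove_flat_zero le_rfl) (Or.inr IsFiller.zero) (γ' := 0) (δ' := 1)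
    (by omega) (by omega) (by omega) (by omega) (by simp [dim]) goodM_plane_flat_one

theorem goodM_plane_tube_flat : GoodM K 2 2 (tube 2 ::ₘ cfg 0 0 0 1) :=
  goodM_step_of 0 0 (isMove_tube_gen (by omega) (by omega)) (Or.inr (IsFiller.tube _ (by omega)))
    (γ' := 0) (δ' := 1) (by omega) (by omega) (by omega) (by omega) (by simp [dim])
    goodM_plane_flat_one

theorem goodM_plane_tube_flat_tube : GoodM K 2 3 (tube 2 ::ₘ cfg 0 0 1 1) :=
  goodM_step_of 0 1 (isMove_tube_gen (by omega) (by omega)) (Or.inr (IsFiller.tube _ (by omega)))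
    (γ' := 1) (δ' := 0) (by omega) (by omega) (by omega) (by omega) (by simp [dim])
    goodM_plane_flat_tube

theorem goodM_plane_flats_tube : GoodM K 2 3 (flat 1 ::ₘ flat 2 ::ₘ cfg 0 0 1 1) := by
  refine goodM_step_two_of 0 1 (isSpecialMove_flat_zero (by omega)) (isMove_flat_gen _)
    (Or.inr IsFiller.zero) (Or.inr (IsFiller.flat _)) (γ' := 1) (δ' := 0)
    (by omega) (by omega) (by omega) (by omega) (by simp [dim]) ?_
  rw [cons_swap]
  exact goodM_plane_flat_tube.zero_cons

theorem goodM_plane_T_MB_four : GoodM K 2 4 (MB 3 ::ₘ cfg 1 0 1 0) := by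
  rw [cfg_succ_left, cons_swap]
  refine goodM_step_two_of (e := 3) 0 0 (isSpecialMove_T_axis (k := 4) (by omega) (by omega))
    (isMove_MB_gen _) (Or.inl (IsTop.MT _ (by omega) (by omega)))
    (Or.inl (IsTop.MB _ (by omega) (by omega))) (γ' := 1) (δ' := 0)
    (by omega) (by omega) (by omega) (by omega) (by simp [dim]) ?_
  rw [cons_swap]
  exact (goodM_step_special_of (e := 2) 1 0 (isSpecialMove_W_axis (by omega) (by omega))
    (Or.inl (IsTop.Y _ (by omega) (by omega))) (γ' := 0) (δ' := 1)
    (by omega) (by omega) (by omega) (by omega) (by simp [dim]) goodM_plane_tube_flat).zero_cons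

theorem goodM_plane_T_MB_five : GoodM K 2 5 (MB 3 ::ₘ cfg 1 0 2 0) := by
  rw [cfg_succ_left, cons_swap]
  refine goodM_step_two_of (e := 4) 0 0 (isSpecialMove_T_axis (k := 4) (by omega) (by omega))
    (isMove_MB_gen _) (Or.inl (IsTop.MT _ (by omega) (by omega)))
    (Or.inl (IsTop.MB _ (by omega) (by omega))) (γ' := 2) (δ' := 0)
    (by omega) (by omega) (by omega) (by omega) (by simp [dim]) ?_
  rw [cons_swap]
  exact (goodM_step_special_of (e := 3) 1 0 (isSpecialMove_W_axis (by omega) (by omega))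
    (Or.inl (IsTop.Y _ (by omega) (by omega))) (γ' := 1) (δ' := 1)
    (by omega) (by omega) (by omega) (by omega) (by simp [dim])
    goodM_plane_tube_flat_tube).zero_cons

theorem goodM_plane_T_flat : GoodM K 2 2 (cfg 1 0 0 1) := by
  rw [cfg_succ_left]
  refine goodM_step_of (e := 1) 0 0 isMove_T_gen (Or.inl (IsTop.T (by omega)))
    (γ' := 0) (δ' := 1) (by omega) (by omega) (by omega) (by omega) (by simp [dim]) ?_
  exact goodM_step_of (e := 0) 0 0 isMove_B_gen (Or.inl IsTop.B)
    (γ' := 0) (δ' := 1) (by omega) (by omega) (by omega) (by omega) (by simp [dim])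
    (goodM_planar _ _ _ _ _ 2 (by omega) (by omega) (by omega) (by omega)).zero_cons

theorem goodM_plane_B_flat : GoodM K 2 1 (cfg 0 1 0 1) := by
  rw [cfg_zero_succ]
  exact goodM_step_of (e := 0) 0 0 isMove_B_gen (Or.inl IsTop.B)
    (γ' := 0) (δ' := 1) (by omega) (by omega) (by omega) (by omega) (by simp [dim])
    (goodM_planar _ _ _ _ _ 2 (by omega) (by omega) (by omega) (by omega)).zero_cons

theorem goodM_space_T_B : GoodM K 3 2 (cfg 1 1 0 0) :=
  goodM_step_TB_of 1 0 0 1 rfl rfl (β' := 2) rfl goodM_plane_T_flat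
    (goodM_step_TB_of 0 0 1 1 rfl rfl (β' := 1) rfl goodM_plane_B_flat
      (by simpa [cfg] using goodM_B_degree_zero))

theorem goodM_space_flats : GoodM K 3 3 (flat 1 ::ₘ flat 2 ::ₘ cfg 1 1 0 0) := by
  have hm := Moves.cons (isMove_flat_gen (K := K) (n := 2) (e := 2) 1) (Moves.cons
    (isMove_flat_gen 2) (Moves.cons isMove_T_idle (Moves.cons isMove_B_idle Moves.nil)))
  have hS : cfg 1 1 0 0 = T ::ₘ B ::ₘ 0 := rfl
  rw [hS]
  refine GoodM.step hm ?_ ?_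
  · exact goodM_plane_flats_tube
  · exact goodM_space_T_B.zero_cons.zero_cons

theorem cfg_succ_middle (α β γ δ : ℕ) : cfg α (β + 1) γ δ = B ::ₘ cfg α β γ δ := by
  simp [cfg, replicate_succ]

theorem goodM_space_six : GoodM K 3 6 (cfg 4 0 0 0) := by
  refine goodM_step_TB_of (e := 5) 1 3 0 0 rfl rfl (β' := 1) rfl
    (goodM_planar _ _ _ _ _ 4 (by omega) (by omega) (by omega) (by omega)) ?_
  rw [cfg_succ_middle]
  refine goodM_step_TB_special (e := 4) (p := 1) (q := 2) (r := 0) (t := 0) (isSpecialMove_B_axis (k := 4) (by omega) (by omega))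
    goodM_plane_T_MB_five ?_
  rw [show 1 + 0 = 0 + 1 from rfl, cfg_succ_middle, cons_swap]
  refine goodM_step_TB_two (e := 3) (p := 1) (q := 1) (r := 0) (t := 0) (isSpecialMove_B_axis (k := 3) (by omega) (by omega))
    (isMove_flat_zero (by omega)) ?_ goodM_space_flats
  rw [cons_swap]
  exact goodM_plane_T_MB_four.zero_cons

end Solid

section Bounds

variable {K : Type*} [Field K] {A : Type*} [CommRing A] [Algebra K A]

theorem span_singleton_mul_eq_map (a : A) (R : Submodule K A) :
    (K ∙ a) * R = R.map (LinearMap.mulLeft K a) := by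
  ext x
  simp [Submodule.mem_span_singleton_mul, Submodule.mem_map]

theorem exists_complement_span_singleton (R : Submodule K A) [Module.Finite K R] {n : ℕ}
    (hR : Module.finrank K R ≤ n + 1) {a : A} (ha : a ∈ R) (ha0 : a ≠ 0) :
    ∃ C : Submodule K A, Module.Finite K C ∧ Module.finrank K C ≤ n ∧ R = (K ∙ a) ⊔ C := by
  obtain ⟨C, hC⟩ := Submodule.exists_isCompl (K ∙ (⟨a, ha⟩ : R))
  refine ⟨C.map R.subtype, inferInstance, ?_, ?_⟩
  · have h := Submodule.finrank_add_eq_of_isCompl hC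
    rw [finrank_span_singleton (by simpa using ha0)] at h
    exact (Submodule.finrank_map_le _ _).trans (by omega)
  · have h := congrArg (Submodule.map R.subtype) hC.sup_eq_top
    rw [Submodule.map_sup, Submodule.map_span, Submodule.map_top, Submodule.range_subtype] at h
    simpa using h.symm

theorem finrank_Pd_mul_le (R : Submodule K A) [Module.Finite K R] {n : ℕ}
    (hR : Module.finrank K R ≤ n + 1) (L : List A) (hL : ∀ a ∈ L, a ∈ R) (hne : L ≠ []) :
    Module.Finite K ↥(Pd L * R : Submodule K A) ∧
      Module.finrank K ↥(Pd L * R : Submodule K A) ≤ n * L.length + 1 := by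
  induction L with
  | nil => exact absurd rfl hne
  | cons a L ih =>
    rcases eq_or_ne L [] with rfl | hL0
    · have h : Pd [a] * R = R := by simp [Pd, ← Submodule.one_eq_span]
      rw [h]
      exact ⟨inferInstance, by simpa using hR⟩
    obtain ⟨hfin, hle⟩ := ih (fun b hb => hL b (by simp [hb])) hL0
    have hmul : Pd (a :: L) * R = R.map (LinearMap.mulLeft K L.prod) ⊔
        (Pd L * R).map (LinearMap.mulLeft K a) := by
      rw [Pd, Submodule.sup_mul, mul_assoc, span_singleton_mul_eq_map, span_singleton_mul_eq_map]
    refine ⟨by rw [hmul]; infer_instance, ?_⟩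
    rw [List.length_cons, mul_add, mul_one]
    rcases eq_or_ne a 0 with rfl | ha0
    · have h0 : LinearMap.mulLeft K (0 : A) = 0 := LinearMap.ext fun x => zero_mul x
      rw [hmul, h0, Submodule.map_zero, sup_bot_eq]
      refine (Submodule.finrank_map_le _ _).trans ?_
      omega
    · obtain ⟨C, hCfin, hC, hRC⟩ := exists_complement_span_singleton R hR (hL a (by simp)) ha0
      have hprod : L.prod ∈ Pd L * R := by
        obtain ⟨b, M, rfl⟩ := List.exists_cons_of_ne_nil hL0
        rw [List.prod_cons, mul_comm b]
        exact Submodule.mul_mem_mul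
          (Submodule.mem_sup_left (Submodule.mem_span_singleton_self _)) (hL b (by simp))
      have hmul' : Pd (a :: L) * R ≤ C.map (LinearMap.mulLeft K L.prod) ⊔
          (Pd L * R).map (LinearMap.mulLeft K a) := by
        rw [hmul]
        refine sup_le ?_ le_sup_right
        conv_lhs => rw [hRC]
        rw [Submodule.map_sup]
        refine sup_le ?_ le_sup_left
        rw [Submodule.map_span, Set.image_singleton, Submodule.span_singleton_le_iff_mem]
        exact Submodule.mem_sup_right ⟨_, hprod, by simp [mul_comm]⟩
      have h₁ := Submodule.finrank_mono hmul'
      have h₂ := Submodule.finrank_add_le_finrank_add_finrank (C.map (LinearMap.mulLeft K L.prod))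
        ((Pd L * R).map (LinearMap.mulLeft K a))
      have h₃ := Submodule.finrank_map_le (LinearMap.mulLeft K L.prod) C
      have h₄ := Submodule.finrank_map_le (LinearMap.mulLeft K a) (Pd L * R)
      omega

theorem Pd_ofFn {d : ℕ} (f : Fin d → A) :
    Pd (K := K) (List.ofFn f) = ⨆ j, K ∙ ∏ m ∈ Finset.univ.erase j, f m := by
  induction d with
  | zero => rw [iSup_of_empty, List.ofFn_zero, Pd]
  | succ d ih =>
    have herase : ∀ {k : ℕ} (g : Fin k → A) (j : Fin k),
        ∏ m ∈ Finset.univ.erase j, g m = ∏ m, if m ≠ j then g m else 1 := fun g j => by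
      rw [← Finset.filter_ne', Finset.prod_filter]
    have h0 : ∏ m ∈ Finset.univ.erase (0 : Fin (d + 1)), f m = ∏ m : Fin d, f m.succ := by
      rw [herase, Fin.prod_univ_succ]
      simp
    have hs : ∀ j : Fin d, ∏ m ∈ Finset.univ.erase j.succ, f m =
        f 0 * ∏ m ∈ Finset.univ.erase j, f m.succ := by
      intro j
      rw [herase, herase, Fin.prod_univ_succ, if_pos (Fin.succ_ne_zero j).symm]
      simp
    rw [List.ofFn_succ, Pd, ih, List.prod_ofFn, Submodule.mul_iSup, ← h0]
    simp only [← span_singleton_mul_eq, ← hs]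
    refine le_antisymm (sup_le (le_iSup_of_le 0 le_rfl)
      (iSup_le fun j => le_iSup_of_le j.succ le_rfl)) (iSup_le fun j => ?_)
    refine Fin.cases le_sup_left (fun j => ?_) j
    exact le_sup_of_le_right (le_iSup_of_le j le_rfl)

theorem finrank_finset_sup_le {ι : Type*} [DecidableEq ι] (V : ι → Submodule K A)
    [∀ i, Module.Finite K (V i)]
    {D : ℕ} (hV : ∀ i, Module.finrank K (V i) ≤ D) (s : Finset ι) :
    Module.finrank K ↥(s.sup V) ≤ s.card * D := by
  induction s using Finset.induction_on with
  | empty => simp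
  | insert i s hi ih =>
    rw [Finset.sup_insert, Finset.card_insert_of_notMem hi, add_mul, one_mul, add_comm]
    exact (Submodule.finrank_add_le_finrank_add_finrank _ _).trans (add_le_add (hV i) ih)

/-- If `S` subspaces of dimension at most `D` are independent of dimension `D`, then so are the
first `s` of them. -/
theorem finrank_iSup_castLE {S s D : ℕ} (h : s ≤ S) (V : Fin S → Submodule K A)
    [∀ i, Module.Finite K (V i)] (hV : ∀ i, Module.finrank K (V i) ≤ D)
    (hrank : RankGE (S * D) (⨆ i, V i)) :
    Module.finrank K ↥(⨆ i : Fin s, V (Fin.castLE h i)) = s * D := by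
  have hfirst : ⨆ i : Fin s, V (Fin.castLE h i) =
      (Finset.univ.map (Fin.castLEEmb h)).sup V := by
    rw [Finset.sup_map, Finset.sup_univ_eq_iSup]
    rfl
  have hcard : (Finset.univ.map (Fin.castLEEmb h)).card = s := by simp
  set T := Finset.univ.map (Fin.castLEEmb h)
  rw [hfirst]
  refine le_antisymm ((finrank_finset_sup_le V hV T).trans (by rw [hcard])) ?_
  have hall : ⨆ i, V i = T.sup V ⊔ Tᶜ.sup V := by
    rw [← Finset.sup_union, Finset.union_compl, Finset.sup_univ_eq_iSup]
  obtain ⟨v, hv, hm⟩ := hrank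
  have hge : S * D ≤ Module.finrank K ↥(⨆ i, V i) := by
    have hv' : LinearIndependent K fun k => (⟨v k, hm k⟩ : ↥(⨆ i, V i)) :=
      LinearIndependent.of_comp (Submodule.subtype _) hv
    simpa using hv'.fintype_card_le_finrank
  rw [hall] at hge
  have h1 := hge.trans (Submodule.finrank_add_le_finrank_add_finrank _ _)
  have h2 := finrank_finset_sup_le V hV Tᶜ
  rw [Finset.card_compl, Fintype.card_fin, hcard] at h2
  obtain ⟨r, rfl⟩ := Nat.exists_eq_add_of_le h
  rw [Nat.add_sub_cancel_left] at h2
  nlinarith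

end Bounds

section Numerics

theorem mul_le_choose_three {s d : ℕ} (hd : 3 ≤ d)
    (hs : 18 * s ≤ d ^ 2 + 5 * d + 4 ∨ 18 * s ≤ d ^ 2 + 3 * d + 18) :
    s * (d * 3 + 1) ≤ (3 + d).choose 3 := by
  have h : (3 + d).choose 3 * 6 = (d + 3) * (d + 2) * (d + 1) := by
    have h1 := Nat.choose_succ_right_eq (3 + d) 2
    have h2 := Nat.choose_succ_right_eq (3 + d) 1
    rw [Nat.choose_one_right] at h2
    rw [show 3 + d - 2 = d + 1 by omega] at h1
    rw [show 3 + d - 1 = d + 2 by omega] at h2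
    nlinarith
  obtain ⟨c, rfl⟩ := Nat.exists_eq_add_of_le hd
  have h3 : 18 * (s * ((3 + c) * 3 + 1)) ≤ 3 * ((3 + (3 + c)).choose 3 * 6) := by
    rw [h]
    rcases hs with hs | hs
    · have := Nat.mul_le_mul_right ((3 + c) * 3 + 1) hs
      nlinarith
    · have := Nat.mul_le_mul_right ((3 + c) * 3 + 1) hs
      nlinarith
  omega

theorem mul_le_choose {s n d : ℕ} (hn : 3 ≤ n) (hd : 3 ≤ d)
    (hs : 18 * s ≤ d ^ 2 + 5 * d + 4 ∨ 18 * s ≤ d ^ 2 + 3 * d + 18) :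
    s * (d * n + 1) ≤ (n + d).choose n := by
  have h3 := mul_le_choose_three hd hs
  induction n, hn using Nat.le_induction with
  | base => exact h3
  | succ n hn ih =>
    have h4 := Nat.choose_succ_right_eq (3 + d) 3
    rw [Nat.add_sub_cancel_left] at h4
    have hsd : s * d ≤ (3 + d).choose 4 := by nlinarith
    have hmono : (3 + d).choose 4 ≤ (n + d).choose (n + 1) := by
      rw [show 3 + d = 4 + (d - 1) by omega, show n + d = n + 1 + (d - 1) by omega,
        Nat.choose_symm_add, Nat.choose_symm_add]
      exact Nat.choose_le_choose _ (by omega)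
    rw [show n + 1 + d = n + d + 1 by omega, Nat.choose_succ_succ']
    nlinarith

end Numerics

section Assembly

variable (K : Type*) [Field K]

theorem exists_goodM_space [CharZero K] (d : ℕ) (hd : 3 ≤ d) :
    ∃ S : ℕ, (S : ℚ) = s1 d ∧ 6 * S ≤ (d - 1) * (d - 1 + 1) ∧
      (18 * S ≤ d ^ 2 + 5 * d + 4 ∨ 18 * S ≤ d ^ 2 + 3 * d + 18) ∧
      GoodM K 3 d (cfg S 0 0 0) := by
  rw [Nat.sub_add_cancel (by omega : 1 ≤ d)]
  obtain ⟨c, r, hr, rfl⟩ : ∃ c r, r < 6 ∧ d = 6 * c + r := ⟨d / 6, d % 6, by omega, by omega⟩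
  have hmod : (6 * c + r) % 6 = r := by omega
  interval_cases r
  · obtain ⟨c, rfl⟩ := Nat.exists_eq_add_of_le' (show 1 ≤ c by omega)
    rcases c with _ | c
    · exact ⟨4, by norm_num [s1], by omega, by omega, goodM_space_six⟩
    · refine ⟨(c + 2) * (2 * c + 3) + 2 * c + 5, ?_, ?_, Or.inr (by nlinarith),
        goodM_space_zero_mod_six c _ rfl⟩
      · simp only [s1, hmod]
        push_cast
        ring
      · rw [show 6 * (c + 1 + 1) + 0 - 1 = 6 * c + 11 by omega]
        nlinarith
  · obtain ⟨c, rfl⟩ := Nat.exists_eq_add_of_le' (show 1 ≤ c by omega)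
    have h := goodM_space_one_mod_three (K := K) (2 * (c + 1)) ((c + 1) * (2 * c + 3)) (by omega)
      (by ring)
    rw [show (2 * (c + 1) + 1) / 2 = c + 1 by omega,
      show 3 * (2 * (c + 1)) + 1 = 6 * (c + 1) + 1 by omega] at h
    refine ⟨_, ?_, ?_, Or.inl (by nlinarith), h⟩
    · simp only [s1, hmod]
      push_cast
      norm_num
      ring
    · rw [show 6 * (c + 1) + 1 - 1 = 6 * c + 6 by omega]
      nlinarith
  · have h := goodM_space_triangular (K := K) (2 * c) ((c + 1) * (2 * c + 1)) (by ring)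
    rw [show 3 * (2 * c) + 2 = 6 * c + 2 by omega] at h
    refine ⟨_, ?_, ?_, Or.inl (by nlinarith), h⟩
    · simp only [s1, hmod]
      push_cast
      norm_num
      ring
    · obtain ⟨c, rfl⟩ := Nat.exists_eq_add_of_le' (show 1 ≤ c by omega)
      rw [show 6 * (c + 1) + 2 - 1 = 6 * c + 7 by omega]
      nlinarith
  · have h := goodM_space_zero_mod_three (K := K) (2 * c + 1) ((c + 1) * (2 * c + 1)) (by omega)
      (by ring)
    rw [show 3 * (2 * c + 1) = 6 * c + 3 by omega] at h
    refine ⟨_, ?_, ?_, Or.inl (by nlinarith), h⟩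
    · simp only [s1, hmod]
      push_cast
      norm_num
      ring
    · rw [show 6 * c + 3 - 1 = 6 * c + 2 by omega]
      nlinarith
  · have h := goodM_space_one_mod_three (K := K) (2 * c + 1) ((c + 1) * (2 * c + 1)) (by omega)
      (by ring)
    rw [show (2 * c + 1 + 1) / 2 = c + 1 by omega,
      show 3 * (2 * c + 1) + 1 = 6 * c + 4 by omega] at h
    refine ⟨_, ?_, ?_, Or.inl (by nlinarith), h⟩
    · simp only [s1, hmod]
      push_cast
      norm_num
      ring
    · rw [show 6 * c + 4 - 1 = 6 * c + 3 by omega]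
      nlinarith
  · have h := goodM_space_triangular (K := K) (2 * c + 1) ((c + 1) * (2 * c + 3)) (by ring)
    rw [show 3 * (2 * c + 1) + 2 = 6 * c + 5 by omega] at h
    refine ⟨_, ?_, ?_, Or.inl (by nlinarith), h⟩
    · simp only [s1, hmod]
      push_cast
      norm_num
      ring
    · rw [show 6 * c + 5 - 1 = 6 * c + 4 by omega]
      nlinarith

variable {K}

theorem goodM_B_of_space [CharZero K] {n e s : ℕ} (hn : 3 ≤ n)
    (h : 6 * s ≤ (e + 1) * (e + 1 + 1)) : GoodM K n (e + 1) (cfg 0 s 0 0) := by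
  induction n, hn using Nat.le_induction with
  | base => exact goodM_space_B _ _ h
  | succ n _ ih => exact goodM_step_TB_of 0 0 s 0 rfl rfl (β' := 0) rfl ih goodM_nil

theorem goodM_T_of_space [CharZero K] {n e s : ℕ} (hn : 3 ≤ n)
    (h : 6 * s ≤ (e + 1) * (e + 1 + 1)) (hT : GoodM K 3 (e + 2) (cfg s 0 0 0)) :
    GoodM K n (e + 2) (cfg s 0 0 0) := by
  induction n, hn using Nat.le_induction with
  | base => exact hT
  | succ n hn ih =>
    exact goodM_step_TB_of s 0 0 0 rfl rfl (β' := s) rfl ih (goodM_B_of_space (by omega) h)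

theorem GoodM.exists_fin {n e S : ℕ} (h : GoodM K n e (cfg S 0 0 0)) :
    ∃ p : Fin S → ℕ → Fin (n + 1) → K,
      RankGE (S * (e * n + 1)) (⨆ i, Piece.T.space e (p i)) := by
  obtain ⟨m, hm, hr⟩ := h
  have hcfg : cfg S 0 0 0 = Multiset.replicate S Piece.T := by simp [cfg]
  rw [hcfg] at hm hr
  obtain ⟨L, rfl⟩ : ∃ L : List (Piece × (ℕ → Fin (n + 1) → K)), ↑L = m := Quot.exists_rep m
  have hcard := congrArg Multiset.card hm
  rw [Multiset.card_map, Multiset.card_replicate] at hcard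
  obtain rfl : L.length = S := hcard
  refine ⟨fun i => (L.get i).2, hr.mono ?_ ?_⟩
  · simp [Piece.dim, mul_comm]
  · refine Multiset.sup_le.2 fun W hW => ?_
    obtain ⟨x, hx, rfl⟩ := Multiset.mem_map.1 hW
    have hT : x.1 = Piece.T := Multiset.eq_of_mem_replicate (hm ▸ Multiset.mem_map_of_mem _ hx)
    obtain ⟨i, hi⟩ := List.mem_iff_get.1 (show x ∈ L from hx)
    refine le_iSup_of_le i ?_
    simp only [hi, hT, le_refl]

theorem linForms_eq_homogeneousSubmodule (n : ℕ) :
    linForms K n = homogeneousSubmodule (Fin (n + 1)) K 1 := by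
  rw [homogeneousSubmodule_one_eq_span_X]
  refine le_antisymm ?_ (Submodule.span_le.2 ?_)
  · rintro _ ⟨v, rfl⟩
    rw [pi_eq_sum_univ' v, map_sum]
    refine Submodule.sum_mem _ fun i _ => ?_
    rw [map_smul]
    exact Submodule.smul_mem _ _ (Submodule.subset_span ⟨i, (lin_single i).symm⟩)
  · rintro _ ⟨i, rfl⟩
    exact ⟨_, lin_single i⟩

instance (n : ℕ) : Module.Finite K (linForms K n) := by
  unfold linForms
  infer_instance

theorem finrank_linForms_le (n : ℕ) : Module.finrank K (linForms K n) ≤ n + 1 :=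
  (LinearMap.finrank_range_le _).trans (by simp)

theorem space_T_eq_iSup {n d : ℕ} (p : ℕ → Fin (n + 1) → K) :
    Piece.T.space d p = ⨆ j : Fin d, Submodule.map
      (LinearMap.mulLeft K (∏ m ∈ Finset.univ.erase j, lin (p ((m : ℕ) + 2))))
      (homogeneousSubmodule (Fin (n + 1)) K 1) := by
  have h : Piece.fac (fun i => lin (p i)) d = List.ofFn fun m : Fin d => lin (p ((m : ℕ) + 2)) := by
    rw [Piece.fac, List.ofFn_eq_map, ← List.map_coe_finRange_eq_range, List.map_map]
    rfl
  rw [Piece.space, Piece.sub, h, Pd_ofFn, Submodule.iSup_mul]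
  simp only [span_singleton_mul_eq_map, linForms_eq_homogeneousSubmodule]

theorem finrank_space_T_le {n d : ℕ} (hd : 1 ≤ d) (p : ℕ → Fin (n + 1) → K) :
    Module.Finite K (Piece.T.space d p) ∧
      Module.finrank K (Piece.T.space d p) ≤ d * n + 1 := by
  have h := finrank_Pd_mul_le (linForms K n) (finrank_linForms_le n)
    (Piece.fac (fun i => lin (p i)) d)
    (fun a ha => by
      obtain ⟨j, _, rfl⟩ := List.mem_map.1 ha
      exact lin_mem _)
    (by
      rw [Piece.fac, Ne, List.map_eq_nil_iff, List.range_eq_nil]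
      omega)
  rwa [Piece.fac, List.length_map, List.length_range, mul_comm n] at h

end Assembly

/-- Corollary 4.2 of the paper: If `d ≥ 3`, `n ≥ 3`, `s ≥ 1` and `s ≤ s_1(d)`,
then there exist `d`-tuples `f_1,…,f_s` of linear forms in `K[x_0,…,x_n]` with
`dim Σ_i Σ_j π_j(f_i)·R_1 = min{s(dn+1), C(n+d,d)}` (i.e. `σ_s(Split_d(ℙⁿ))` is
nondefective whenever `s ≤ s_1(d)`). -/
theorem stmt10 (K : Type*) [Field K] [IsAlgClosed K] [CharZero K]
    (s n d : ℕ) (hs : 1 ≤ s) (hn : 3 ≤ n) (hd : 3 ≤ d)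
    (hs1 : (s : ℚ) ≤ s1 d) :
    ∃ f : Fin s → Fin d → MvPolynomial (Fin (n + 1)) K,
      (∀ i j, (f i j).IsHomogeneous 1) ∧
      Module.finrank K ↥(⨆ i : Fin s, ⨆ j : Fin d,
          Submodule.map (LinearMap.mulLeft K (∏ m ∈ Finset.univ.erase j, f i m))
            (homogeneousSubmodule (Fin (n + 1)) K 1))
        = min (s * (d * n + 1)) ((n + d).choose d) := by
  obtain ⟨S, hS, hB, hnum, hgood⟩ := exists_goodM_space K d hd
  have hsS : s ≤ S := by
    rw [← hS] at hs1
    exact_mod_cast hs1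
  obtain ⟨e, rfl⟩ := Nat.exists_eq_add_of_le' (show 2 ≤ d by omega)
  obtain ⟨p, hp⟩ := (goodM_T_of_space hn hB hgood).exists_fin
  have hfin := fun i => (finrank_space_T_le (d := e + 2) (by omega) (p i)).1
  have hrank := finrank_iSup_castLE hsS (fun i => Piece.T.space (e + 2) (p i))
    (fun i => (finrank_space_T_le (by omega) (p i)).2) hp
  refine ⟨fun i j => lin (p (Fin.castLE hsS i) ((j : ℕ) + 2)), fun i j => ?_, ?_⟩
  · rw [← mem_homogeneousSubmodule, ← linForms_eq_homogeneousSubmodule]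
    exact lin_mem _
  · have hle : s * ((e + 2) * n + 1) ≤ (n + (e + 2)).choose (e + 2) := by
      rw [← Nat.choose_symm_add]
      exact mul_le_choose hn hd (by omega)
    rw [min_eq_left hle, ← hrank,
      iSup_congr fun i => space_T_eq_iSup (d := e + 2) (p (Fin.castLE hsS i))]
end
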